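/- arXiv:1508.02363 — 8 statements merged into one kernel-verified Lean document; each statement's English description precedes it below -/
import Mathlib

section
/- Let Q ∈ S(ℝ²;ℂ) be a Schwartz function, regarded as a function of z = x + iy, and let k ∈ ℂ. Then there exists a bounded, infinitely differentiable (as a map ℝ² → ℂ) function m : ℂ → ℂ with m(z) → 0 as |z| → ∞, satisfying the D-bar equation ∂̄m(z) = ½ e^{k̄z̄ − kz} Q(z) (conj(m(z)) + 1) for all z ∈ ℂ. Moreover, the function z ↦ ½ e^{k̄z̄ − kz} Q(z)(conj(m(z)) + 1) (i.e. ∂̄m) belongs to S(ℝ²;ℂ), and m possesses a complete asymptotic expansion in powers of 1/z: for every N ≥ 1 there exist a₁, …, a_N ∈ ℂ such that m(z) − Σ_{j=1}^{N} a_j z^{−j} = O(|z|^{−(N+1)}) as |z| → ∞. -/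
open Complex MeasureTheory Filter Bornology Asymptotics

/-- The Wirtinger derivative ∂̄f = ½(∂ₓf + i ∂_y f) of a function f : ℂ → ℂ,
viewed as a map ℝ² → ℂ. -/
noncomputable def dbar (f : ℂ → ℂ) (z : ℂ) : ℂ :=
  (1 / 2) * (fderiv ℝ f z 1 + Complex.I * fderiv ℝ f z Complex.I)

section Part1

open Complex MeasureTheory Filter Bornology Asymptotics

noncomputable def wt (w : ℂ) : ℝ := ((1 + ‖w‖) ^ 4)⁻¹

lemma wt_pos (w : ℂ) : 0 < wt w := by unfold wt; positivity

lemma wt_le_one (w : ℂ) : wt w ≤ 1 := by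
  unfold wt
  apply inv_le_one_of_one_le₀
  apply one_le_pow₀
  linarith [norm_nonneg w]

lemma wt_continuous : Continuous wt := by
  unfold wt
  apply Continuous.inv₀ (by fun_prop)
  intro x; positivity

lemma wt_integrable : Integrable wt := by
  have h := integrable_one_add_norm (E := ℂ) (μ := volume) (r := 4) (by simp; norm_num)
  refine h.congr (Eventually.of_forall fun x => ?_)
  simp only [wt]
  rw [Real.rpow_neg (by positivity)]
  norm_cast

noncomputable def ker0 (w : ℂ) : ℝ := Set.indicator (Metric.ball (0:ℂ) 1) (fun w => ‖w‖⁻¹) w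

lemma ker0_integrable : Integrable ker0 := by
  unfold ker0
  rw [integrable_indicator_iff measurableSet_ball]
  apply integrableOn_ball_of_norm_le_rpow (C := 1) (α := 1) (by simp) (by simp)
  · refine Eventually.of_forall fun x => ?_
    simp [Real.rpow_neg_one]
  · exact (measurable_norm.inv).aestronglyMeasurable

lemma ker_bound (z w : ℂ) : wt w * ‖z - w‖⁻¹ ≤ ker0 (z - w) + wt w := by
  unfold ker0
  by_cases h : z - w ∈ Metric.ball (0:ℂ) 1
  · rw [Set.indicator_of_mem h]
    have : 0 ≤ ‖z - w‖⁻¹ := by positivity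
    nlinarith [wt_pos w, wt_le_one w]
  · rw [Set.indicator_of_notMem h]
    have h1 : 1 ≤ ‖z - w‖ := by simpa using h
    have : ‖z - w‖⁻¹ ≤ 1 := inv_le_one_of_one_le₀ h1
    nlinarith [wt_pos w]

lemma kerb_integrable (z : ℂ) : Integrable (fun w => ker0 (z - w) + wt w) :=
  (ker0_integrable.comp_sub_left z).add wt_integrable

lemma ker_integrable (z : ℂ) : Integrable (fun w => wt w * ‖z - w‖⁻¹) := by
  refine (kerb_integrable z).mono' ?_ (Eventually.of_forall fun w => ?_)
  · exact (wt_continuous.measurable.mul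
      ((measurable_const.sub measurable_id).norm.inv)).aestronglyMeasurable
  · rw [Real.norm_of_nonneg (mul_nonneg (wt_pos w).le (by positivity))]
    exact ker_bound z w

noncomputable def MM : ℝ := (∫ w, ker0 w) + ∫ w, wt w

lemma ker_int_le (z : ℂ) : ∫ w, wt w * ‖z - w‖⁻¹ ≤ MM := by
  calc _ ≤ ∫ w, (ker0 (z - w) + wt w) :=
        integral_mono (ker_integrable z) (kerb_integrable z) (ker_bound z)
    _ = MM := by
        rw [integral_add (ker0_integrable.comp_sub_left z) wt_integrable,
          integral_sub_left_eq_self]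
        rfl

lemma MM_nonneg : 0 ≤ MM :=
  le_trans (integral_nonneg fun w => mul_nonneg (wt_pos w).le (by positivity)) (ker_int_le 0)

/-- The (unnormalised) Cauchy transform. -/
noncomputable def cau (f : ℂ → ℂ) (z : ℂ) : ℂ := ∫ w, f w * (z - w)⁻¹

/-- Admissible densities. -/
structure Adm (f : ℂ → ℂ) (K : ℝ) : Prop where
  meas : Measurable f
  bd : ∀ w, ‖f w‖ ≤ K * wt w

lemma Adm.nonneg {f K} (h : Adm f K) : 0 ≤ K := by
  have := (norm_nonneg _).trans (h.bd 0)
  have h2 := wt_pos 0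
  by_contra hK
  push Not at hK
  nlinarith

lemma Adm.kmeas {f K} (h : Adm f K) : Measurable (fun p : ℂ × ℂ => f p.2 * (p.1 - p.2)⁻¹) :=
  (h.meas.comp measurable_snd).mul (measurable_fst.sub measurable_snd).inv

lemma Adm.integrable {f K} (h : Adm f K) (z : ℂ) : Integrable (fun w => f w * (z - w)⁻¹) := by
  refine ((ker_integrable z).const_mul K).mono' ?_ (Eventually.of_forall fun w => ?_)
  · exact (h.meas.mul (measurable_const.sub measurable_id).inv).aestronglyMeasurable
  · rw [norm_mul, norm_inv, ← mul_assoc]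
    exact mul_le_mul_of_nonneg_right (h.bd w) (by positivity)

lemma Adm.integrable' {f K} (h : Adm f K) : Integrable f :=
  (wt_integrable.const_mul K).mono' h.meas.aestronglyMeasurable (Eventually.of_forall h.bd)

lemma Adm.norm_int_le {f K} (h : Adm f K) (z : ℂ) : ∫ w, ‖f w * (z - w)⁻¹‖ ≤ K * MM := by
  calc _ ≤ ∫ w, K * (wt w * ‖z - w‖⁻¹) := by
        refine integral_mono (h.integrable z).norm ((ker_integrable z).const_mul K) fun w => ?_
        simp only [norm_mul, norm_inv, ← mul_assoc]
        exact mul_le_mul_of_nonneg_right (h.bd w) (by positivity)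
    _ ≤ K * MM := by
        rw [integral_const_mul]
        exact mul_le_mul_of_nonneg_left (ker_int_le z) h.nonneg

lemma Adm.cau_le {f K} (h : Adm f K) (z : ℂ) : ‖cau f z‖ ≤ K * MM :=
  (norm_integral_le_integral_norm _).trans (h.norm_int_le z)

lemma Adm.cau_meas {f K} (h : Adm f K) : Measurable (cau f) := by
  have := h.kmeas.stronglyMeasurable.integral_prod_right' (ν := (volume : Measure ℂ))
  exact this.measurable

lemma Adm.mul {f K} (h : Adm f K) {g : ℂ → ℂ} {B : ℝ} (hg : Measurable g)
    (hB : ∀ z, ‖g z‖ ≤ B) : Adm (fun z => f z * g z) (K * B) where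
  meas := h.meas.mul hg
  bd w := by
    rw [norm_mul]
    calc _ ≤ (K * wt w) * B := mul_le_mul (h.bd w) (hB w) (norm_nonneg _)
            (mul_nonneg h.nonneg (wt_pos w).le)
      _ = _ := by ring

lemma Adm.add {f g K L} (hf : Adm f K) (hg : Adm g L) : Adm (fun z => f z + g z) (K + L) where
  meas := hf.meas.add hg.meas
  bd w := (norm_add_le _ _).trans (by linarith [hf.bd w, hg.bd w])

lemma Adm.sub {f g K L} (hf : Adm f K) (hg : Adm g L) : Adm (fun z => f z - g z) (K + L) where
  meas := hf.meas.sub hg.meas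
  bd w := (norm_sub_le _ _).trans (by linarith [hf.bd w, hg.bd w])

lemma Adm.const_mul {f K} (hf : Adm f K) (c : ℂ) : Adm (fun z => c * f z) (‖c‖ * K) where
  meas := hf.meas.const_mul c
  bd w := by
    rw [norm_mul, mul_assoc]
    exact mul_le_mul_of_nonneg_left (hf.bd w) (norm_nonneg _)

lemma cau_add {f g K L} (hf : Adm f K) (hg : Adm g L) (z : ℂ) :
    cau (fun z => f z + g z) z = cau f z + cau g z := by
  unfold cau
  rw [← integral_add (hf.integrable z) (hg.integrable z)]
  simp only [add_mul]

lemma cau_sub {f g K L} (hf : Adm f K) (hg : Adm g L) (z : ℂ) :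
    cau (fun z => f z - g z) z = cau f z - cau g z := by
  unfold cau
  rw [← integral_sub (hf.integrable z) (hg.integrable z)]
  simp only [sub_mul]

lemma cau_const_mul (c : ℂ) (f : ℂ → ℂ) (z : ℂ) :
    cau (fun z => c * f z) z = c * cau f z := by
  unfold cau
  rw [← integral_const_mul]
  simp only [mul_assoc]

lemma rb_integrable {a b K L} (ha : Adm a K) (hb : Adm b L) (z : ℂ) :
    Integrable (fun p : ℂ × ℂ => (a p.1 * (z - p.1)⁻¹) * (b p.2 * (p.1 - p.2)⁻¹))
      (volume.prod volume) := by
  have hm : Measurable (fun p : ℂ × ℂ => (a p.1 * (z - p.1)⁻¹) * (b p.2 * (p.1 - p.2)⁻¹)) :=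
    ((ha.meas.comp measurable_fst).mul (measurable_const.sub measurable_fst).inv).mul hb.kmeas
  rw [integrable_prod_iff hm.aestronglyMeasurable]
  refine ⟨Eventually.of_forall fun w => (hb.integrable w).const_mul (a w * (z - w)⁻¹), ?_⟩
  refine ((ha.integrable z).norm.mul_const (L * MM)).mono'
    hm.norm.stronglyMeasurable.integral_prod_right'.aestronglyMeasurable
    (Eventually.of_forall fun w => ?_)
  rw [Real.norm_of_nonneg (integral_nonneg fun _ => norm_nonneg _)]
  simp only [norm_mul (a w * (z - w)⁻¹)]
  rw [integral_const_mul]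
  exact mul_le_mul_of_nonneg_left (hb.norm_int_le w) (norm_nonneg _)

/-- The Rota-Baxter identity for the Cauchy transform. -/
lemma rota {a b K L} (ha : Adm a K) (hb : Adm b L) (z : ℂ) :
    cau a z * cau b z = cau (fun w => a w * cau b w) z + cau (fun w => b w * cau a w) z := by
  have h1 : cau (fun w => a w * cau b w) z =
      ∫ p : ℂ × ℂ, (a p.1 * (z - p.1)⁻¹) * (b p.2 * (p.1 - p.2)⁻¹) ∂(volume.prod volume) := by
    rw [integral_prod _ (rb_integrable ha hb z)]
    unfold cau
    congr 1; ext w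
    simp only
    rw [integral_const_mul]; ring
  have hsw : Integrable (fun p : ℂ × ℂ => (b p.2 * (z - p.2)⁻¹) * (a p.1 * (p.2 - p.1)⁻¹))
      (volume.prod volume) := (rb_integrable hb ha z).swap
  have h2 : cau (fun w => b w * cau a w) z =
      ∫ p : ℂ × ℂ, (b p.2 * (z - p.2)⁻¹) * (a p.1 * (p.2 - p.1)⁻¹) ∂(volume.prod volume) := by
    rw [integral_prod_symm _ hsw]
    unfold cau
    congr 1; ext w
    simp only
    rw [integral_const_mul]; ring
  rw [h1, h2, ← integral_add (rb_integrable ha hb z) hsw]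
  unfold cau
  rw [← integral_prod_mul]
  have hne : ∀ᵐ p : ℂ × ℂ ∂((volume : Measure ℂ).prod volume), p.1 ≠ z ∧ p.2 ≠ z ∧ p.1 ≠ p.2 := by
    have hms : MeasurableSet {p : ℂ × ℂ | p.1 ≠ z ∧ p.2 ≠ z ∧ p.1 ≠ p.2} := by
      refine IsOpen.measurableSet ?_
      exact (isOpen_ne_fun continuous_fst continuous_const).inter
        ((isOpen_ne_fun continuous_snd continuous_const).inter
          (isOpen_ne_fun continuous_fst continuous_snd))
    rw [Measure.ae_prod_iff_ae_ae hms]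
    filter_upwards [Measure.ae_ne volume z] with x hx
    filter_upwards [Measure.ae_ne volume z, Measure.ae_ne volume x] with y hy hy2
    exact ⟨hx, hy, hy2.symm⟩
  refine integral_congr_ae ?_
  filter_upwards [hne] with p ⟨h1, h2, h3⟩
  have e1 : z - p.1 ≠ 0 := sub_ne_zero.2 h1.symm
  have e2 : z - p.2 ≠ 0 := sub_ne_zero.2 h2.symm
  have e3 : p.1 - p.2 ≠ 0 := sub_ne_zero.2 h3
  have e4 : p.2 - p.1 = -(p.1 - p.2) := by ring
  rw [e4, inv_neg]
  field_simp
  ring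


end Part1

section Part2

open Complex MeasureTheory Filter Bornology Asymptotics

lemma Adm.pow_identity {h K} (hh : Adm h K) (n : ℕ) (z : ℂ) :
    ((n : ℂ) + 1) * cau (fun w => h w * cau h w ^ n) z = cau h z ^ (n + 1) := by
  induction n generalizing z with
  | zero => simp
  | succ n ih =>
    have hn : Adm (fun w => h w * cau h w ^ n) (K * (K * MM) ^ n) :=
      hh.mul (hh.cau_meas.pow_const n) fun w => by
        rw [norm_pow]; exact pow_le_pow_left₀ (norm_nonneg _) (hh.cau_le w) n
    have hr := rota hh hn z
    have e1 : cau (fun w => h w * cau h w ^ (n + 1)) z =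
        (n + 1) * cau (fun w => h w * cau (fun w => h w * cau h w ^ n) w) z := by
      rw [← cau_const_mul]
      congr 1; ext w
      rw [← ih w]; ring
    have e2 : cau (fun w => h w * cau h w ^ (n + 1)) z =
        cau (fun w => (h w * cau h w ^ n) * cau h w) z := by
      congr 1; ext w; ring
    rw [pow_succ' (cau h z) (n + 1), ← ih z]
    rw [← e2] at hr
    push_cast
    linear_combination (-(n:ℂ) - 1) * hr + e1

lemma Adm.exp_meas {h K} (hh : Adm h K) : Measurable (fun w => exp (cau h w)) :=
  Complex.measurable_exp.comp hh.cau_meas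

lemma Adm.exp_le {h K} (hh : Adm h K) (w : ℂ) : ‖exp (cau h w)‖ ≤ Real.exp (K * MM) := by
  rw [Complex.norm_exp]
  exact Real.exp_le_exp.2 ((Complex.re_le_norm _).trans (hh.cau_le w))

lemma Adm.exp_identity {h K} (hh : Adm h K) (z : ℂ) :
    cau (fun w => h w * exp (cau h w)) z = exp (cau h z) - 1 := by
  have hn : ∀ n : ℕ, Adm (fun w => h w * (cau h w ^ n / (n.factorial : ℂ)))
      (K * ((K * MM) ^ n / n.factorial)) := fun n =>
    hh.mul ((hh.cau_meas.pow_const n).div_const _) fun w => by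
      rw [norm_div, norm_pow, Complex.norm_natCast]
      gcongr
      exact hh.cau_le w
  have hs : Summable fun n : ℕ => ∫ w, ‖(h w * (cau h w ^ n / (n.factorial : ℂ))) * (z - w)⁻¹‖ := by
    refine Summable.of_nonneg_of_le (fun n => integral_nonneg fun _ => norm_nonneg _)
      (fun n => (hn n).norm_int_le z) ?_
    exact ((Real.summable_pow_div_factorial (K * MM)).mul_left K).mul_right MM
  have H := hasSum_integral_of_summable_integral_norm (fun n => (hn n).integrable z) hs
  have hex : ∀ x : ℂ, HasSum (fun n : ℕ => x ^ n / (n.factorial : ℂ)) (exp x) := fun x => by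
    rw [Complex.exp_eq_exp_ℂ]; exact NormedSpace.expSeries_div_hasSum_exp x
  have h1 : ∀ w, ∑' n : ℕ, (h w * (cau h w ^ n / (n.factorial : ℂ))) * (z - w)⁻¹ =
      (h w * exp (cau h w)) * (z - w)⁻¹ := fun w =>
    (((hex (cau h w)).mul_left (h w)).mul_right ((z - w)⁻¹)).tsum_eq
  simp only [h1] at H
  have h2 : ∀ n : ℕ, ∫ w, (h w * (cau h w ^ n / (n.factorial : ℂ))) * (z - w)⁻¹ =
      cau h z ^ (n + 1) / ((n + 1).factorial : ℂ) := fun n => by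
    rw [← hh.pow_identity n z]
    have : ∫ w, (h w * (cau h w ^ n / (n.factorial : ℂ))) * (z - w)⁻¹ =
      cau (fun w => (n.factorial : ℂ)⁻¹ * (h w * cau h w ^ n)) z := by
      unfold cau; congr 1; ext w; ring
    rw [this, cau_const_mul, Nat.factorial_succ]
    push_cast
    have a1 : (n.factorial : ℂ) ≠ 0 := by exact_mod_cast n.factorial_ne_zero
    have a2 : (n : ℂ) + 1 ≠ 0 := by exact_mod_cast n.succ_ne_zero
    field_simp
  simp only [h2] at H
  have h3 := (hasSum_nat_add_iff' 1).2 (hex (cau h z))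
  simp at h3
  exact H.unique h3

lemma integrating_factor {h g K L} (hh : Adm h K) (hg : Adm g L) (z : ℂ) :
    exp (cau h z) * cau g z =
      cau (fun w => (g w + h w * cau g w) * exp (cau h w)) z := by
  have hE := hh.mul hh.exp_meas hh.exp_le
  have hr := rota hE hg z
  have hEu := hE.mul hg.cau_meas hg.cau_le
  have hgE := hg.mul hE.cau_meas hE.cau_le
  have key : cau (fun w => (g w + h w * cau g w) * exp (cau h w)) z =
      cau (fun w => g w + ((h w * exp (cau h w)) * cau g w +
        g w * cau (fun w => h w * exp (cau h w)) w)) z := by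
    congr 1; ext w
    rw [hh.exp_identity w]; ring
  rw [key, cau_add hg (hEu.add hgE), cau_add hEu hgE, ← hr, hh.exp_identity z]
  ring

lemma apriori {q K} (hq : Adm q K) {m f : ℂ → ℂ} {B F : ℝ} (hm : Measurable m)
    (hmB : ∀ z, ‖m z‖ ≤ B) (hf : Measurable f) (hfF : ∀ z, ‖f z‖ ≤ F)
    (heq : ∀ z, m z = f z + cau (fun w => q w * (starRingEnd ℂ) (m w)) z) (z : ℂ) :
    ‖m z‖ ≤ (1 + Real.exp (K * MM) * (K * Real.exp (K * MM) * MM)) * F := by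
  have hconj : Measurable (fun z : ℂ => (starRingEnd ℂ) z) := Complex.continuous_conj.measurable
  have hg : Adm (fun w => q w * (starRingEnd ℂ) (m w)) (K * B) :=
    hq.mul (hconj.comp hm) fun w => by simpa using hmB w
  set g := fun w => q w * (starRingEnd ℂ) (m w) with hgdef
  have hh : Adm (fun w => q w * (-((starRingEnd ℂ) (cau g w) / cau g w))) (K * 1) :=
    hq.mul ((hconj.comp hg.cau_meas).div hg.cau_meas).neg fun w => by
      rw [norm_neg, norm_div, RCLike.norm_conj]
      exact div_self_le_one _
  rw [mul_one] at hh
  set h := fun w => q w * (-((starRingEnd ℂ) (cau g w) / cau g w)) with hhdef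
  have hI := integrating_factor hh hg z
  have hp : (fun w => (g w + h w * cau g w) * exp (cau h w)) =
      fun w => (q w * exp (cau h w)) * (starRingEnd ℂ) (f w) := by
    ext w
    have : h w * cau g w = - (q w * (starRingEnd ℂ) (cau g w)) := by
      simp only [hhdef]
      by_cases h0 : cau g w = 0
      · simp [h0]
      · field_simp
    rw [this]
    have h2 : (starRingEnd ℂ) (m w) = (starRingEnd ℂ) (f w) + (starRingEnd ℂ) (cau g w) := by
      rw [← map_add, ← heq w]
    simp only [hgdef] at h2 ⊢
    rw [h2]; ring
  rw [hp] at hI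
  have hfin := ((hq.mul hh.exp_meas hh.exp_le).mul (hconj.comp hf) (B := F)
    fun w => by simpa using hfF w).cau_le z
  have hu : cau g z = exp (-cau h z) * (exp (cau h z) * cau g z) := by
    rw [← mul_assoc, ← Complex.exp_add]; simp
  have hE : ‖exp (-cau h z)‖ ≤ Real.exp (K * MM) := by
    rw [Complex.norm_exp]
    exact Real.exp_le_exp.2 ((Complex.re_le_norm _).trans (by rw [norm_neg]; exact hh.cau_le z))
  rw [heq z]
  have : ‖cau g z‖ ≤ Real.exp (K * MM) * (K * Real.exp (K * MM) * F * MM) := by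
    rw [hu, norm_mul, hI]
    exact mul_le_mul hE hfin (norm_nonneg _) (Real.exp_pos _).le
  calc _ ≤ ‖f z‖ + ‖cau g z‖ := norm_add_le _ _
    _ ≤ F + _ := add_le_add (hfF z) this
    _ = _ := by ring


end Part2

section Part3

open Complex MeasureTheory Filter Bornology Asymptotics

/-- Method of continuity. -/
lemma isUnit_of_apriori {E : Type*} [NormedAddCommGroup E] [NormedSpace ℝ E] [CompleteSpace E]
    (A : E →L[ℝ] E) (C : ℝ) (hC : 0 ≤ C)
    (h : ∀ t : ℝ, 0 ≤ t → t ≤ 1 → ∀ x, ‖x‖ ≤ C * ‖x - t • A x‖) :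
    IsUnit (1 - A) := by
  have step : ∀ s t : ℝ, 0 ≤ t → t ≤ 1 → |s - t| * (C * ‖A‖) < 1 → IsUnit (1 - t • A) →
      IsUnit (1 - s • A) := by
    rintro s t h0 h1 hst ⟨u, hu⟩
    have hui : ‖((u⁻¹ : (E →L[ℝ] E)ˣ) : E →L[ℝ] E)‖ ≤ C := by
      refine ContinuousLinearMap.opNorm_le_bound _ hC fun y => ?_
      have := h t h0 h1 ((u⁻¹ : (E →L[ℝ] E)ˣ).1 y)
      have e : (u⁻¹ : (E →L[ℝ] E)ˣ).1 y - t • A ((u⁻¹ : (E →L[ℝ] E)ˣ).1 y) = y := by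
        have h2 : (u.1 * (u⁻¹ : (E →L[ℝ] E)ˣ).1) y = y := by
          rw [u.mul_inv]; rfl
        rw [hu] at h2
        simpa using h2
      rwa [e] at this
    have hlt : ‖(s - t) • ((u⁻¹ : (E →L[ℝ] E)ˣ).1 * A)‖ < 1 := by
      rw [norm_smul, Real.norm_eq_abs]
      refine lt_of_le_of_lt ?_ hst
      refine mul_le_mul_of_nonneg_left ?_ (abs_nonneg _)
      exact (norm_mul_le _ _).trans (mul_le_mul_of_nonneg_right hui (norm_nonneg _))
    have e : 1 - s • A = u.1 * (1 - (s - t) • ((u⁻¹ : (E →L[ℝ] E)ˣ).1 * A)) := by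
      rw [mul_sub, mul_one, mul_smul_comm, ← mul_assoc, u.mul_inv, one_mul, hu, sub_smul]
      abel
    rw [e]
    exact u.isUnit.mul (isUnit_one_sub_of_norm_lt_one hlt)
  obtain ⟨N, hN⟩ := exists_nat_gt (C * ‖A‖)
  have hNpos : (0 : ℝ) < N := lt_of_le_of_lt (by positivity) hN
  have key : ∀ k : ℕ, k ≤ N → IsUnit (1 - ((k : ℝ) / N) • A) := by
    intro k
    induction k with
    | zero => intro _; simp
    | succ k ih =>
      intro hk
      refine step _ ((k : ℝ) / N) (by positivity) ?_ ?_ (ih (by omega))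
      · rw [div_le_one hNpos]; exact_mod_cast (by omega : k ≤ N)
      · have : (((k + 1 : ℕ) : ℝ) / N - k / N) = 1 / N := by push_cast; ring
        rw [this, abs_of_pos (by positivity), one_div, inv_mul_lt_iff₀ hNpos]
        linarith
  have := key N le_rfl
  rwa [div_self hNpos.ne', one_smul] at this

abbrev XX := BoundedContinuousFunction ℂ ℂ

lemma adm_bcf (b : XX) : Adm (fun w => (wt w : ℂ) * b w) ‖b‖ where
  meas := ((Complex.continuous_ofReal.comp wt_continuous).mul b.continuous).measurable
  bd w := by
    rw [norm_mul, Complex.norm_real, Real.norm_of_nonneg (wt_pos w).le, mul_comm]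
    exact mul_le_mul_of_nonneg_right (b.norm_coe_le_norm w) (wt_pos w).le

lemma wt_shift {z z0 : ℂ} (h : ‖z - z0‖ ≤ 1) (w : ℂ) : wt (z - w) ≤ (2 + ‖z0‖) ^ 4 * wt w := by
  unfold wt
  rw [← div_eq_mul_inv, inv_eq_one_div, div_le_div_iff₀ (by positivity) (by positivity), one_mul,
    ← mul_pow]
  refine pow_le_pow_left₀ (by positivity) ?_ 4
  have h1 : ‖w‖ ≤ ‖z - w‖ + ‖z - z0‖ + ‖z0‖ := by
    calc ‖w‖ = ‖-(z - w) + (z - z0) + z0‖ := by congr 1; ring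
      _ ≤ ‖-(z - w) + (z - z0)‖ + ‖z0‖ := norm_add_le _ _
      _ ≤ _ := by
        have := norm_add_le (-(z - w)) (z - z0)
        rw [norm_neg] at this
        linarith
  nlinarith [norm_nonneg z0, norm_nonneg (z - w)]

lemma cau_shift (f : ℂ → ℂ) (z : ℂ) : cau f z = ∫ w, f (z - w) * w⁻¹ := by
  unfold cau
  rw [← integral_sub_left_eq_self _ volume z]
  simp

lemma cau_continuous (b : XX) : Continuous (cau (fun w => (wt w : ℂ) * b w)) := by
  have hc : Continuous (fun w => (wt w : ℂ) * b w) :=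
    (Complex.continuous_ofReal.comp wt_continuous).mul b.continuous
  rw [continuous_iff_continuousAt]
  intro z0
  have : cau (fun w => (wt w : ℂ) * b w) =
      fun z => ∫ w, ((wt (z - w) : ℂ) * b (z - w)) * w⁻¹ := by
    ext z; exact cau_shift _ z
  rw [this]
  refine continuousAt_of_dominated
    (bound := fun w => ((2 + ‖z0‖) ^ 4 * ‖b‖) * (wt w * ‖0 - w‖⁻¹)) ?_ ?_ ?_ ?_
  · refine Eventually.of_forall fun z => ?_
    exact ((hc.comp (continuous_const.sub continuous_id)).measurable.mul
      measurable_inv).aestronglyMeasurable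
  · filter_upwards [Metric.closedBall_mem_nhds z0 one_pos] with z hz
    refine Eventually.of_forall fun w => ?_
    rw [norm_mul, norm_inv, zero_sub, norm_neg, ← mul_assoc]
    refine mul_le_mul_of_nonneg_right ?_ (by positivity)
    have h1 := (adm_bcf b).bd (z - w)
    have h2 := wt_shift (by simpa [dist_eq_norm] using hz) w
    calc _ ≤ _ := h1
      _ ≤ ‖b‖ * _ := mul_le_mul_of_nonneg_left h2 (norm_nonneg _)
      _ = _ := by ring
  · exact (ker_integrable 0).const_mul _
  · refine Eventually.of_forall fun w => ?_
    exact ((hc.comp (continuous_id.sub continuous_const)).mul continuous_const).continuousAt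

/-- The weighted Cauchy transform as an operator. -/
noncomputable def CW : XX →L[ℝ] XX :=
  LinearMap.mkContinuous
    { toFun := fun b => BoundedContinuousFunction.ofNormedAddCommGroup
        (fun z => (Real.pi : ℂ)⁻¹ * cau (fun w => (wt w : ℂ) * b w) z)
        (continuous_const.mul (cau_continuous b)) (Real.pi⁻¹ * (‖b‖ * MM)) (fun z => by
          rw [norm_mul, norm_inv, Complex.norm_real, Real.norm_of_nonneg Real.pi_pos.le]
          exact mul_le_mul_of_nonneg_left ((adm_bcf b).cau_le z) (by positivity))
      map_add' := fun b c => by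
        ext z
        simp only [BoundedContinuousFunction.coe_ofNormedAddCommGroup,
          BoundedContinuousFunction.coe_add, Pi.add_apply]
        rw [← mul_add, ← cau_add (adm_bcf b) (adm_bcf c)]
        congr 2; ext w; ring
      map_smul' := fun r b => by
        ext z
        simp only [BoundedContinuousFunction.coe_ofNormedAddCommGroup,
          BoundedContinuousFunction.coe_smul, RingHom.id_apply, Complex.real_smul]
        rw [mul_left_comm, ← cau_const_mul (r : ℂ)]
        refine congrArg (fun f => (Real.pi : ℂ)⁻¹ * cau f z) (funext fun w => ?_)
        ring }
    (Real.pi⁻¹ * MM) (fun b => by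
      have hM := MM_nonneg
      rw [BoundedContinuousFunction.norm_le (by positivity)]
      intro z
      simp only [LinearMap.coe_mk, AddHom.coe_mk,
        BoundedContinuousFunction.coe_ofNormedAddCommGroup]
      rw [norm_mul, norm_inv, Complex.norm_real, Real.norm_of_nonneg Real.pi_pos.le, mul_assoc,
        mul_comm MM]
      exact mul_le_mul_of_nonneg_left ((adm_bcf b).cau_le z) (by positivity))

lemma CW_apply (b : XX) (z : ℂ) :
    CW b z = (Real.pi : ℂ)⁻¹ * cau (fun w => (wt w : ℂ) * b w) z := rfl

noncomputable def starX : XX →L[ℝ] XX := ((starL' ℝ : XX ≃L[ℝ] XX) : XX →L[ℝ] XX)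

noncomputable def TT : XX →L[ℝ] XX →L[ℝ] XX :=
  ((ContinuousLinearMap.compL ℝ XX XX XX).flip starX) ∘L
    ((ContinuousLinearMap.compL ℝ XX XX XX) CW) ∘L (ContinuousLinearMap.mul ℝ XX)

lemma TT_apply (b m : XX) : TT b m = CW (b * star m) := rfl

lemma TT_apply_apply (b m : XX) (z : ℂ) : TT b m z =
    (Real.pi : ℂ)⁻¹ * cau (fun w => (wt w : ℂ) * b w * (starRingEnd ℂ) (m w)) z := by
  rw [TT_apply, CW_apply]
  congr 2; ext w
  simp [mul_assoc]

lemma isUnit_TT (b : XX) : IsUnit (1 - TT b) := by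
  have hK : 0 ≤ ‖b‖ * MM := mul_nonneg (norm_nonneg _) MM_nonneg
  have hC : 0 ≤ (1 + Real.exp (‖b‖ * MM) * (‖b‖ * Real.exp (‖b‖ * MM) * MM)) := by
    have := MM_nonneg
    positivity
  refine isUnit_of_apriori _ _ hC ?_
  intro t h0 h1 x
  have hq : Adm (fun w => ((t : ℂ) * (Real.pi : ℂ)⁻¹) * ((wt w : ℂ) * b w)) ‖b‖ := by
    have h := (adm_bcf b).const_mul ((t : ℂ) * (Real.pi : ℂ)⁻¹)
    refine ⟨h.meas, fun w => (h.bd w).trans ?_⟩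
    refine mul_le_mul_of_nonneg_right ?_ (wt_pos w).le
    refine mul_le_of_le_one_left (norm_nonneg _) ?_
    rw [norm_mul, norm_inv, Complex.norm_real, Complex.norm_real, Real.norm_of_nonneg h0,
      Real.norm_of_nonneg Real.pi_pos.le]
    refine mul_le_one₀ h1 (by positivity) (inv_le_one_of_one_le₀ ?_)
    linarith [Real.pi_gt_three]
  rw [BoundedContinuousFunction.norm_le (mul_nonneg hC (norm_nonneg _))]
  intro z
  refine apriori hq x.continuous.measurable x.norm_coe_le_norm
    (x - t • TT b x).continuous.measurable (x - t • TT b x).norm_coe_le_norm ?_ z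
  intro z
  have : cau (fun w => ((t : ℂ) * (Real.pi : ℂ)⁻¹) * ((wt w : ℂ) * b w) * (starRingEnd ℂ) (x w)) z
      = t * TT b x z := by
    rw [TT_apply_apply, ← mul_assoc, ← cau_const_mul]
    congr 1; ext w; ring
  rw [this]
  simp


end Part3

section Part4

open Complex MeasureTheory Filter Bornology Asymptotics
open scoped SchwartzMap LineDeriv ContDiff

lemma schwartz_bd {F : Type*} [NormedAddCommGroup F] [NormedSpace ℝ F] (f : 𝓢(ℂ, F)) :
    ∃ C : ℝ, 0 ≤ C ∧ ∀ z, (1 + ‖z‖) ^ 4 * ‖f z‖ ≤ C := by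
  refine ⟨2 ^ 4 * (Finset.Iic (4, 0)).sup (fun m => SchwartzMap.seminorm ℝ m.1 m.2) f,
    by positivity, fun z => ?_⟩
  have := SchwartzMap.one_add_le_sup_seminorm_apply (𝕜 := ℝ) (m := (4, 0)) (k := 4) (n := 0)
    le_rfl le_rfl f z
  simpa using this

lemma one_add_shift {z a x : ℂ} (h : ‖x - (z + a)‖ ≤ 1) :
    (1 + ‖z‖) ^ 4 ≤ (2 + ‖a‖) ^ 4 * (1 + ‖x‖) ^ 4 := by
  rw [← mul_pow]
  refine pow_le_pow_left₀ (by positivity) ?_ 4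
  have h1 : ‖z‖ ≤ ‖x‖ + ‖x - (z + a)‖ + ‖a‖ := by
    calc ‖z‖ = ‖x - (x - (z + a)) - a‖ := by congr 1; ring
      _ ≤ ‖x - (x - (z + a))‖ + ‖a‖ := norm_sub_le _ _
      _ ≤ _ := by linarith [norm_sub_le x (x - (z + a))]
  nlinarith [norm_nonneg a, norm_nonneg x]

lemma schwartz_bd_shift {F : Type*} [NormedAddCommGroup F] [NormedSpace ℝ F] (f : 𝓢(ℂ, F))
    (a : ℂ) : ∃ C : ℝ, 0 ≤ C ∧ ∀ z x, ‖x - (z + a)‖ ≤ 1 → (1 + ‖z‖) ^ 4 * ‖f x‖ ≤ C := by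
  obtain ⟨C, hC, h⟩ := schwartz_bd f
  refine ⟨(2 + ‖a‖) ^ 4 * C, by positivity, fun z x hx => ?_⟩
  calc _ ≤ ((2 + ‖a‖) ^ 4 * (1 + ‖x‖) ^ 4) * ‖f x‖ :=
        mul_le_mul_of_nonneg_right (one_add_shift hx) (norm_nonneg _)
    _ = (2 + ‖a‖) ^ 4 * ((1 + ‖x‖) ^ 4 * ‖f x‖) := by ring
    _ ≤ _ := mul_le_mul_of_nonneg_left (h x) (by positivity)

lemma FF_bd (q : 𝓢(ℂ, ℂ)) (a : ℂ) :
    ∃ C : ℝ, ∀ z, ‖(((1 + ‖z‖) ^ 4 : ℝ) : ℂ) * q (z + a)‖ ≤ C := by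
  obtain ⟨C, hC, h⟩ := schwartz_bd_shift q a
  refine ⟨C, fun z => ?_⟩
  rw [norm_mul, Complex.norm_real, Real.norm_of_nonneg (by positivity)]
  exact h z (z + a) (by simp)

noncomputable def FF (q : 𝓢(ℂ, ℂ)) (a : ℂ) : XX :=
  BoundedContinuousFunction.ofNormedAddCommGroup
    (fun z => (((1 + ‖z‖) ^ 4 : ℝ) : ℂ) * q (z + a))
    ((Complex.continuous_ofReal.comp (by fun_prop)).mul
      (q.continuous.comp (continuous_id.add continuous_const)))
    (FF_bd q a).choose (FF_bd q a).choose_spec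

lemma FF_apply (q : 𝓢(ℂ, ℂ)) (a z : ℂ) :
    FF q a z = (((1 + ‖z‖) ^ 4 : ℝ) : ℂ) * q (z + a) := rfl

lemma wt_FF (q : 𝓢(ℂ, ℂ)) (a z : ℂ) : (wt z : ℂ) * FF q a z = q (z + a) := by
  rw [FF_apply, ← mul_assoc, ← Complex.ofReal_mul]
  unfold wt
  rw [inv_mul_cancel₀ (by positivity)]
  simp

noncomputable def dFF (q : 𝓢(ℂ, ℂ)) (a : ℂ) : ℂ →L[ℝ] XX :=
  Complex.reCLM.smulRight (FF (∂_{(1 : ℂ)} q) a) + Complex.imCLM.smulRight (FF (∂_{I} q) a)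

lemma re_im_fderiv (L : ℂ →L[ℝ] ℂ) (v : ℂ) : (v.re : ℂ) * L 1 + v.im * L I = L v := by
  conv_rhs => rw [← Complex.re_add_im v]
  have h1 : (v.re : ℂ) = v.re • (1 : ℂ) := by simp
  have h2 : (v.im : ℂ) * I = v.im • I := by simp
  rw [map_add, h2, map_smul, h1, map_smul]
  simp

lemma dFF_apply (q : 𝓢(ℂ, ℂ)) (a v z : ℂ) :
    dFF q a v z = (((1 + ‖z‖) ^ 4 : ℝ) : ℂ) * fderiv ℝ q (z + a) v := by
  have : dFF q a v z = v.re • (FF (∂_{(1 : ℂ)} q) a z) + v.im • (FF (∂_{I} q) a z) := rfl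
  rw [this, FF_apply, FF_apply, SchwartzMap.lineDerivOp_apply_eq_fderiv,
    SchwartzMap.lineDerivOp_apply_eq_fderiv, Complex.real_smul, Complex.real_smul,
    ← re_im_fderiv (fderiv ℝ q (z + a)) v]
  ring

lemma FF_hasFDerivAt (q : 𝓢(ℂ, ℂ)) (a : ℂ) : HasFDerivAt (FF q) (dFF q a) a := by
  set q2 := SchwartzMap.fderivCLM ℝ ℂ (ℂ →L[ℝ] ℂ) (SchwartzMap.fderivCLM ℝ ℂ ℂ q) with hq2
  have hq2a : ∀ x, q2 x = fderiv ℝ (fderiv ℝ q) x := fun x => by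
    rw [hq2, SchwartzMap.fderivCLM_apply]; rfl
  obtain ⟨C, hC, h⟩ := schwartz_bd_shift q2 a
  have hd2 : Differentiable ℝ (fderiv ℝ q) := (SchwartzMap.fderivCLM ℝ ℂ ℂ q).differentiable
  have main : ∀ v : ℂ, ‖v‖ ≤ 1 → ‖FF q (a + v) - FF q a - dFF q a v‖ ≤ C * ‖v‖ ^ 2 := by
    intro v hv
    rw [BoundedContinuousFunction.norm_le (by positivity)]
    intro z
    simp only [BoundedContinuousFunction.coe_sub, Pi.sub_apply]
    rw [FF_apply, FF_apply, dFF_apply, ← mul_sub, ← mul_sub, norm_mul, Complex.norm_real,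
      Real.norm_of_nonneg (by positivity)]
    have hw : (0 : ℝ) < (1 + ‖z‖) ^ 4 := by positivity
    rw [← le_div_iff₀' hw]
    set y := z + a with hy
    have hb : ∀ x ∈ Metric.closedBall y ‖v‖, ‖fderiv ℝ (fderiv ℝ q) x‖ ≤ C / (1 + ‖z‖) ^ 4 := by
      intro x hx
      rw [le_div_iff₀' hw, ← hq2a]
      refine h z x ?_
      rw [Metric.mem_closedBall, dist_eq_norm] at hx
      exact hx.trans hv
    have hyb : y ∈ Metric.closedBall y ‖v‖ := Metric.mem_closedBall_self (norm_nonneg _)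
    have hb2 : ∀ x ∈ Metric.closedBall y ‖v‖,
        ‖fderiv ℝ q x - fderiv ℝ q y‖ ≤ C / (1 + ‖z‖) ^ 4 * ‖v‖ := by
      intro x hx
      refine ((convex_closedBall y ‖v‖).norm_image_sub_le_of_norm_fderiv_le
        (fun x _ => hd2 x) hb hyb hx).trans ?_
      rw [Metric.mem_closedBall, dist_eq_norm] at hx
      exact mul_le_mul_of_nonneg_left hx (by positivity)
    have hfin := (convex_closedBall y ‖v‖).norm_image_sub_le_of_norm_fderiv_le'
        (fun x _ => q.differentiable x) hb2 hyb (y := y + v) (by simp)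
    rw [add_sub_cancel_left] at hfin
    rw [← add_assoc, ← hy]
    calc _ ≤ _ := hfin
      _ = _ := by ring
  rw [hasFDerivAt_iff_isLittleO_nhds_zero]
  refine IsBigO.trans_isLittleO (g := fun v : ℂ => ‖v‖ ^ 2) ?_ (isLittleO_norm_pow_id one_lt_two)
  refine IsBigO.of_bound C ?_
  filter_upwards [Metric.closedBall_mem_nhds (0 : ℂ) one_pos] with v hv
  rw [Real.norm_of_nonneg (by positivity)]
  exact main v (by simpa using hv)

lemma FF_contDiff_nat (n : ℕ) : ∀ q : 𝓢(ℂ, ℂ), ContDiff ℝ n (FF q) := by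
  induction n with
  | zero =>
    intro q
    rw [Nat.cast_zero, contDiff_zero]
    exact continuous_iff_continuousAt.2 fun a => (FF_hasFDerivAt q a).continuousAt
  | succ n ih =>
    intro q
    rw [Nat.cast_succ, contDiff_succ_iff_fderiv]
    refine ⟨fun a => (FF_hasFDerivAt q a).differentiableAt, by simp, ?_⟩
    have : fderiv ℝ (FF q) = dFF q := funext fun a => (FF_hasFDerivAt q a).fderiv
    rw [this]
    exact (contDiff_const.smulRight (ih _)).add (contDiff_const.smulRight (ih _))

lemma FF_contDiff (q : 𝓢(ℂ, ℂ)) : ContDiff ℝ ∞ (FF q) :=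
  contDiff_infty.2 fun n => FF_contDiff_nat n q

lemma cau_translate (f : ℂ → ℂ) (z a : ℂ) : cau f (z + a) = cau (fun w => f (w + a)) z := by
  unfold cau
  rw [← integral_add_right_eq_self _ a]
  simp

noncomputable def sol (q : 𝓢(ℂ, ℂ)) (a : ℂ) : XX :=
  Ring.inverse (1 - TT (FF q a)) (CW (FF q a))

lemma abstract_contDiff {V E : Type*} [NormedAddCommGroup V] [NormedSpace ℝ V]
    [NormedAddCommGroup E] [NormedSpace ℝ E] [CompleteSpace E]
    (T : E →L[ℝ] E →L[ℝ] E) (C : E →L[ℝ] E) (F : V → E) (hF : ContDiff ℝ ∞ F)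
    (hu : ∀ a, IsUnit (1 - T (F a))) :
    ContDiff ℝ ∞ (fun a => Ring.inverse (1 - T (F a)) (C (F a))) := by
  have h1 : ContDiff ℝ ∞ (fun a => 1 - T (F a)) :=
    contDiff_const.sub (T.contDiff.comp hF)
  have h2 : ContDiff ℝ ∞ (fun a => Ring.inverse (1 - T (F a))) := by
    rw [contDiff_iff_contDiffAt]
    intro a
    obtain ⟨u, hu⟩ := hu a
    have := contDiffAt_ringInverse ℝ (n := ∞) u
    rw [hu] at this
    exact this.comp a h1.contDiffAt
  exact h2.clm_apply (C.contDiff.comp hF)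

lemma sol_contDiff (q : 𝓢(ℂ, ℂ)) : ContDiff ℝ ∞ (sol q) :=
  abstract_contDiff (E := XX) TT CW (FF q) (FF_contDiff q) (fun a => isUnit_TT (FF q a))

lemma sol_eq (q : 𝓢(ℂ, ℂ)) (a : ℂ) : sol q a - TT (FF q a) (sol q a) = CW (FF q a) := by
  have h := Ring.mul_inverse_cancel _ (isUnit_TT (FF q a))
  have := congrArg (fun L : XX →L[ℝ] XX => L (CW (FF q a))) h
  exact this

lemma sol_unique (q : 𝓢(ℂ, ℂ)) (a : ℂ) (x : XX) (hx : x - TT (FF q a) x = CW (FF q a)) :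
    x = sol q a := by
  have h := Ring.inverse_mul_cancel _ (isUnit_TT (FF q a))
  have := congrArg (fun L : XX →L[ℝ] XX => L x) h
  have h2 : Ring.inverse (1 - TT (FF q a)) (x - TT (FF q a) x) = x := this
  rw [hx] at h2
  exact h2.symm

lemma eq_iff_aux (q : 𝓢(ℂ, ℂ)) (a : ℂ) (x : XX) (z : ℂ) :
    (TT (FF q a) x + CW (FF q a)) z =
      (Real.pi : ℂ)⁻¹ * cau (fun w => q (w + a) * ((starRingEnd ℂ) (x w) + 1)) z := by
  rw [BoundedContinuousFunction.coe_add, Pi.add_apply, TT_apply, CW_apply, CW_apply, ← mul_add,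
    ← cau_add (adm_bcf _) (adm_bcf _)]
  congr 2; ext w
  rw [← wt_FF]
  simp
  ring

lemma sol_translate (q : 𝓢(ℂ, ℂ)) (a z : ℂ) : sol q a z = sol q 0 (z + a) := by
  set x : XX := (sol q 0).compContinuous ⟨fun z => z + a, by fun_prop⟩ with hx
  have hxa : ∀ z, x z = sol q 0 (z + a) := fun z => rfl
  rw [← hxa]
  have : x = sol q a := by
    apply sol_unique
    rw [sub_eq_iff_eq_add, add_comm]
    ext z
    rw [eq_iff_aux, hxa]
    have h0 := sol_eq q 0
    rw [sub_eq_iff_eq_add, add_comm] at h0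
    have h1 := DFunLike.congr_fun h0 (z + a)
    rw [eq_iff_aux, cau_translate] at h1
    simp only [add_zero] at h1
    exact h1
  rw [this]

lemma sol_main (q : 𝓢(ℂ, ℂ)) : ∃ m : ℂ → ℂ, ContDiff ℝ ∞ m ∧
    (∀ n : ℕ, ∃ C : ℝ, ∀ z, ‖iteratedFDeriv ℝ n m z‖ ≤ C) ∧
    ∀ z, m z = (Real.pi : ℂ)⁻¹ * cau (fun w => q w * ((starRingEnd ℂ) (m w) + 1)) z := by
  have hev : ∀ z : ℂ, (fun a => sol q 0 (a + z)) =
      (BoundedContinuousFunction.evalCLM ℝ z) ∘ (sol q) := fun z => by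
    ext a
    simp only [Function.comp]
    rw [add_comm, ← sol_translate]; rfl
  refine ⟨sol q 0, ?_, ?_, ?_⟩
  · have := hev 0
    simp only [add_zero] at this
    have h2 : (⇑(sol q 0)) = (BoundedContinuousFunction.evalCLM ℝ (0:ℂ)) ∘ (sol q) := this
    rw [h2]
    exact (ContinuousLinearMap.contDiff _).comp (sol_contDiff q)
  · intro n
    refine ⟨‖iteratedFDeriv ℝ n (sol q) 0‖, fun z => ?_⟩
    have h1 : iteratedFDeriv ℝ n (fun a => sol q 0 (a + z)) 0 = iteratedFDeriv ℝ n (sol q 0) z := by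
      rw [iteratedFDeriv_comp_add_right]; simp
    rw [← h1, hev z, ContinuousLinearMap.iteratedFDeriv_comp_left _
      ((sol_contDiff q).contDiffAt) (i := n) (by exact_mod_cast le_top)]
    refine (ContinuousLinearMap.norm_compContinuousMultilinearMap_le _ _).trans ?_
    refine mul_le_of_le_one_left (norm_nonneg _) ?_
    refine ContinuousLinearMap.opNorm_le_bound _ zero_le_one fun y => ?_
    rw [one_mul]
    exact y.norm_coe_le_norm z
  · intro z
    have h0 := sol_eq q 0
    rw [sub_eq_iff_eq_add, add_comm] at h0
    have h1 := DFunLike.congr_fun h0 z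
    rw [eq_iff_aux] at h1
    simpa only [add_zero] using h1

lemma CW_FF (q : 𝓢(ℂ, ℂ)) (a : ℂ) : CW (FF q a) 0 = (Real.pi : ℂ)⁻¹ * cau q a := by
  rw [CW_apply]
  simp only [wt_FF]
  rw [← cau_translate, zero_add]

lemma cau_fderiv (q : 𝓢(ℂ, ℂ)) (a v : ℂ) :
    fderiv ℝ (fun z => (Real.pi : ℂ)⁻¹ * cau q z) a v = (Real.pi : ℂ)⁻¹ *
      (v.re * cau (∂_{(1 : ℂ)} q : 𝓢(ℂ, ℂ)) a + v.im * cau (∂_{I} q : 𝓢(ℂ, ℂ)) a) := by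
  have h := ((BoundedContinuousFunction.evalCLM ℝ (0:ℂ)).comp CW).hasFDerivAt.comp a
    (FF_hasFDerivAt q a)
  have e : (fun z => (Real.pi : ℂ)⁻¹ * cau q z) =
      ((BoundedContinuousFunction.evalCLM ℝ (0:ℂ)).comp CW) ∘ FF q := by
    ext a; exact (CW_FF q a).symm
  rw [e, h.fderiv]
  have : (CW (dFF q a v)) 0 = v.re • (CW (FF (∂_{(1 : ℂ)} q) a) 0) +
      v.im • (CW (FF (∂_{I} q) a) 0) := by
    have : dFF q a v = v.re • (FF (∂_{(1 : ℂ)} q) a) + v.im • (FF (∂_{I} q) a) := rfl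
    rw [this, map_add, map_smul, map_smul]; rfl
  refine Eq.trans this ?_
  rw [CW_FF, CW_FF, Complex.real_smul, Complex.real_smul]
  ring


end Part4

section Part5

open Complex MeasureTheory Filter Bornology Asymptotics
open scoped SchwartzMap LineDeriv ContDiff

noncomputable def ee (t : ℝ) : ℂ := Real.cos t + Real.sin t * I

lemma ee_cont : Continuous ee := by unfold ee; fun_prop

lemma ee_eq (t : ℝ) : ee t = exp (t * I) := by
  rw [Complex.exp_mul_I, ee]; push_cast; rfl

lemma ee_norm (t : ℝ) : ‖ee t‖ = 1 := by
  rw [ee_eq]; exact Complex.norm_exp_ofReal_mul_I t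

lemma ee_hasDerivAt (t : ℝ) : HasDerivAt ee (I * ee t) t := by
  have h : HasDerivAt (fun t : ℝ => exp ((t : ℂ) * I)) (exp (t * I) * (1 * I)) t :=
    ((Complex.ofRealCLM.hasDerivAt (x := t)).mul_const I).cexp
  have e : ee = fun t : ℝ => exp ((t : ℂ) * I) := funext ee_eq
  rw [e]
  simpa [mul_comm] using h

noncomputable def rad (r : ℝ) : ℝ := ((1 + ‖r‖) ^ 4)⁻¹

lemma rad_integrable : Integrable rad := by
  have h := integrable_one_add_norm (E := ℝ) (μ := volume) (r := 4) (by simp)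
  refine h.congr (Eventually.of_forall fun x => ?_)
  simp only [rad]
  rw [Real.rpow_neg (by positivity)]
  norm_cast

lemma pol_bd (g : 𝓢(ℂ, ℂ)) (z : ℂ) : ∃ C : ℝ, ∀ (r t : ℝ) (d : ℂ), ‖d‖ ≤ 1 →
    ‖fderiv ℝ g (z - r * ee t) d‖ ≤ C * rad r := by
  obtain ⟨C, hC, h⟩ := schwartz_bd (SchwartzMap.fderivCLM ℝ ℂ ℂ g)
  refine ⟨C * (2 + ‖z‖) ^ 4, fun r t d hd => ?_⟩
  have h1 := h (z - r * ee t)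
  rw [SchwartzMap.fderivCLM_apply] at h1
  have h2 := wt_shift (z := z) (z0 := z) (by simp) (r * ee t)
  have h3 : wt (r * ee t) = rad r := by
    unfold wt rad; rw [norm_mul, ee_norm, Complex.norm_real, mul_one]
  rw [h3] at h2
  have h4 : ‖fderiv ℝ g (z - r * ee t)‖ ≤ C * wt (z - r * ee t) := by
    unfold wt
    rw [← div_eq_mul_inv, le_div_iff₀' (by positivity)]
    exact h1
  calc _ ≤ ‖fderiv ℝ g (z - r * ee t)‖ * ‖d‖ := ContinuousLinearMap.le_opNorm _ _
    _ ≤ ‖fderiv ℝ g (z - r * ee t)‖ * 1 := mul_le_mul_of_nonneg_left hd (norm_nonneg _)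
    _ ≤ C * wt (z - r * ee t) := by rw [mul_one]; exact h4
    _ ≤ C * ((2 + ‖z‖) ^ 4 * rad r) := mul_le_mul_of_nonneg_left h2 hC
    _ = _ := by ring

lemma fderiv_cont (g : 𝓢(ℂ, ℂ)) : Continuous (fderiv ℝ g) :=
  (SchwartzMap.fderivCLM ℝ ℂ ℂ g).continuous

lemma pol_integrable (g : 𝓢(ℂ, ℂ)) (z : ℂ) (d : ℝ → ℂ) (hd : Continuous d) (hd1 : ∀ t, ‖d t‖ ≤ 1) :
    Integrable (fun p : ℝ × ℝ => fderiv ℝ g (z - p.1 * ee p.2) (d p.2))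
      ((volume.restrict (Set.Ioi 0)).prod (volume.restrict (Set.Ioo (-Real.pi) Real.pi))) := by
  obtain ⟨C, hC⟩ := pol_bd g z
  have hc : Continuous (fun p : ℝ × ℝ => fderiv ℝ g (z - p.1 * ee p.2) (d p.2)) := by
    refine Continuous.clm_apply ((fderiv_cont g).comp ?_) (hd.comp continuous_snd)
    exact continuous_const.sub ((Complex.continuous_ofReal.comp continuous_fst).mul
      (ee_cont.comp continuous_snd))
  have hi : Integrable (fun p : ℝ × ℝ => (C * rad p.1) * (1 : ℝ))
      ((volume.restrict (Set.Ioi 0)).prod (volume.restrict (Set.Ioo (-Real.pi) Real.pi))) :=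
    Integrable.mul_prod (f := fun r => C * rad r) (g := fun _ => (1 : ℝ))
      ((rad_integrable.const_mul C).restrict) (integrable_const _)
  refine hi.mono' hc.aestronglyMeasurable (Eventually.of_forall fun p => ?_)
  rw [mul_one]
  exact hC _ _ _ (hd1 _)

lemma pol_r (g : 𝓢(ℂ, ℂ)) (z : ℂ) (t : ℝ) :
    ∫ r in Set.Ioi (0 : ℝ), fderiv ℝ g (z - r * ee t) (ee t) = g z := by
  obtain ⟨C, hC⟩ := pol_bd g z
  have hcont : Continuous (fun r : ℝ => z - r * ee t) := by fun_prop
  have hder : ∀ r : ℝ, HasDerivAt (fun r : ℝ => -g (z - r * ee t))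
      (fderiv ℝ g (z - r * ee t) (ee t)) r := by
    intro r
    have h1 : HasDerivAt (fun r : ℝ => z - r * ee t) (-(ee t)) r := by
      have := ((Complex.ofRealCLM.hasDerivAt (x := r)).mul_const (ee t)).const_sub z
      simpa using this
    have := ((g.differentiable (z - r * ee t)).hasFDerivAt.comp_hasDerivAt r h1).neg
    have e : -(fderiv ℝ g (z - r * ee t) (-(ee t))) = fderiv ℝ g (z - r * ee t) (ee t) := by
      rw [map_neg, neg_neg]
    rw [e] at this
    exact this
  have hintg : IntegrableOn (fun r : ℝ => fderiv ℝ g (z - r * ee t) (ee t)) (Set.Ioi 0) := by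
    refine ((rad_integrable.const_mul C).restrict (s := Set.Ioi 0)).mono' ?_
      (Eventually.of_forall fun r => hC r t _ (ee_norm t).le)
    exact (((fderiv_cont g).comp hcont).clm_apply continuous_const).aestronglyMeasurable
  have hlim : Tendsto (fun r : ℝ => -g (z - r * ee t)) atTop (nhds (-0)) := by
    refine Tendsto.neg (g.tendsto_cocompact.comp ?_)
    rw [← Metric.cobounded_eq_cocompact, ← tendsto_norm_atTop_iff_cobounded]
    refine tendsto_atTop_mono (f := fun r : ℝ => r - ‖z‖) (fun r => ?_)
      (tendsto_atTop_add_const_right _ _ tendsto_id)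
    have h1 := norm_sub_norm_le (r * ee t) z
    rw [norm_mul, ee_norm, mul_one, Complex.norm_real, norm_sub_rev] at h1
    linarith [Real.le_norm_self r]
  have := integral_Ioi_of_hasDerivAt_of_tendsto (a := (0 : ℝ))
    (g.continuous.comp hcont).neg.continuousWithinAt (fun r _ => hder r) hintg hlim
  rw [this]; simp

lemma pol_t (g : 𝓢(ℂ, ℂ)) (z : ℂ) (r : ℝ) (hr : 0 < r) :
    ∫ t in Set.Ioo (-Real.pi) Real.pi, fderiv ℝ g (z - r * ee t) (I * ee t) = 0 := by
  have hder : ∀ t : ℝ, HasDerivAt (fun t : ℝ => -(r : ℂ)⁻¹ * g (z - r * ee t))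
      (fderiv ℝ g (z - r * ee t) (I * ee t)) t := by
    intro t
    have h1 : HasDerivAt (fun t : ℝ => z - r * ee t) (-(r * (I * ee t))) t :=
      ((ee_hasDerivAt t).const_mul (r : ℂ)).const_sub z
    have := ((g.differentiable (z - r * ee t)).hasFDerivAt.comp_hasDerivAt t h1).const_mul
      (-(r : ℂ)⁻¹)
    have hr' : (r : ℂ) ≠ 0 := by exact_mod_cast hr.ne'
    have e : (r : ℂ) * (I * ee t) = r • (I * ee t) := by simp
    have e2 : -(r : ℂ)⁻¹ * fderiv ℝ g (z - r * ee t) (-(r * (I * ee t))) =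
        fderiv ℝ g (z - r * ee t) (I * ee t) := by
      rw [map_neg, e, map_smul, Complex.real_smul]
      field_simp
    rw [e2] at this
    exact this
  have hc : Continuous (fun t : ℝ => fderiv ℝ g (z - r * ee t) (I * ee t)) := by
    refine Continuous.clm_apply ((fderiv_cont g).comp ?_) (continuous_const.mul ee_cont)
    exact continuous_const.sub (continuous_const.mul ee_cont)
  rw [← integral_Ioc_eq_integral_Ioo, ← intervalIntegral.integral_of_le (by linarith [Real.pi_pos]),
    intervalIntegral.integral_eq_sub_of_hasDerivAt (fun t _ => hder t)
      (hc.intervalIntegrable _ _)]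
  have : ee (-Real.pi) = ee Real.pi := by simp [ee]
  rw [this, sub_self]

lemma pompeiu (g : 𝓢(ℂ, ℂ)) (z : ℂ) :
    cau (fun w => fderiv ℝ g w 1 + I * fderiv ℝ g w I) z = 2 * Real.pi * g z := by
  rw [cau_shift, ← Complex.integral_comp_polarCoord_symm]
  have e1 : ∫ p in polarCoord.target, p.1 • ((fderiv ℝ g (z - Complex.polarCoord.symm p) 1 +
        I * fderiv ℝ g (z - Complex.polarCoord.symm p) I) * (Complex.polarCoord.symm p)⁻¹) =
      ∫ p in (Set.Ioi (0:ℝ)) ×ˢ (Set.Ioo (-Real.pi) Real.pi),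
        (fderiv ℝ g (z - p.1 * ee p.2) (ee p.2) +
          I * fderiv ℝ g (z - p.1 * ee p.2) (I * ee p.2)) := by
    refine setIntegral_congr_fun (measurableSet_Ioi.prod measurableSet_Ioo) ?_
    rintro ⟨r, t⟩ ⟨hr, -⟩
    simp only [Set.mem_Ioi] at hr
    have hp : Complex.polarCoord.symm (r, t) = r * ee t := by
      rw [Complex.polarCoord_symm_apply, ee]
    simp only [hp]
    have hr' : (r : ℂ) ≠ 0 := by exact_mod_cast hr.ne'
    rw [← re_im_fderiv _ (ee t), ← re_im_fderiv _ (I * ee t)]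
    have hre : (ee t).re = Real.cos t := by simp [ee, -ofReal_cos, -ofReal_sin]
    have him : (ee t).im = Real.sin t := by simp [ee, -ofReal_cos, -ofReal_sin]
    have hre2 : (I * ee t).re = -Real.sin t := by simp [him]
    have him2 : (I * ee t).im = Real.cos t := by simp [hre]
    rw [hre, him, hre2, him2, Complex.real_smul, mul_inv]
    have hinv : (ee t)⁻¹ = Real.cos t - Real.sin t * I := by
      apply inv_eq_of_mul_eq_one_right
      have hcs : (Real.cos t : ℂ) ^ 2 + (Real.sin t : ℂ) ^ 2 = 1 := by
        exact_mod_cast Real.cos_sq_add_sin_sq t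
      rw [ee]
      linear_combination hcs - (Real.sin t : ℂ) ^ 2 * I_sq
    rw [hinv]
    generalize fderiv ℝ g (z - r * ee t) 1 = A
    generalize fderiv ℝ g (z - r * ee t) I = B
    push_cast
    generalize Complex.cos t = c
    generalize Complex.sin t = s
    have : (r : ℂ) * (r : ℂ)⁻¹ = 1 := mul_inv_cancel₀ hr'
    linear_combination (A + I * B) * (c - s * I) * this - B * s * I_sq
  rw [e1]
  have h1 := pol_integrable g z ee ee_cont (fun t => (ee_norm t).le)
  have h2 := (pol_integrable g z (fun t => I * ee t) (continuous_const.mul ee_cont)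
    (fun t => by simp [ee_norm])).const_mul I
  rw [Measure.volume_eq_prod, ← Measure.prod_restrict, integral_add h1 h2,
    integral_prod_symm _ h1, integral_prod _ h2]
  simp only [pol_r]
  have h3 : ∫ r in Set.Ioi (0 : ℝ), ∫ t in Set.Ioo (-Real.pi) Real.pi,
      I * fderiv ℝ g (z - r * ee t) (I * ee t) = 0 := by
    rw [setIntegral_congr_fun (g := fun _ => (0 : ℂ)) measurableSet_Ioi]
    · simp
    · intro r hr
      simp only
      rw [integral_const_mul, pol_t g z r hr, mul_zero]
  rw [h3]
  simp [Real.pi_pos.le]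
  left; ring


end Part5

section Part6

open Complex MeasureTheory Filter Bornology Asymptotics
open scoped SchwartzMap LineDeriv ContDiff

lemma adm_schwartz (g : 𝓢(ℂ, ℂ)) : ∃ K, Adm g K := by
  obtain ⟨C, hC0, hC⟩ := schwartz_bd g
  refine ⟨C, g.continuous.measurable, fun w => ?_⟩
  have h1 : 0 < (1 + ‖w‖) ^ 4 := by positivity
  have := hC w
  unfold wt
  rw [← div_eq_mul_inv, le_div_iff₀ h1]
  linarith

lemma dbar_cau (g : 𝓢(ℂ, ℂ)) (z : ℂ) :
    (1 / 2) * (fderiv ℝ (fun z => (Real.pi : ℂ)⁻¹ * cau g z) z 1 +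
      Complex.I * fderiv ℝ (fun z => (Real.pi : ℂ)⁻¹ * cau g z) z Complex.I) = g z := by
  rw [cau_fderiv, cau_fderiv]
  obtain ⟨K1, h1⟩ := adm_schwartz (∂_{(1 : ℂ)} g)
  obtain ⟨K2, h2⟩ := adm_schwartz (∂_{I} g)
  have h := pompeiu g z
  have e : cau (fun w => fderiv ℝ g w 1 + I * fderiv ℝ g w I) z =
      cau (∂_{(1 : ℂ)} g : 𝓢(ℂ, ℂ)) z + I * cau (∂_{I} g : 𝓢(ℂ, ℂ)) z := by
    rw [← cau_const_mul, ← cau_add h1 (h2.const_mul I)]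
    congr 1
  rw [e] at h
  have hp : (Real.pi : ℂ) ≠ 0 := by exact_mod_cast Real.pi_ne_zero
  simp only [one_re, one_im, I_re, I_im, ofReal_zero, ofReal_one, one_mul, zero_mul, add_zero,
    zero_add]
  field_simp
  linear_combination h

lemma cexp_tg : Function.HasTemperateGrowth (fun t : ℝ => Complex.exp (t * I)) := by
  have hd : ∀ n : ℕ, iteratedDeriv n (fun t : ℝ => Complex.exp (t * I)) =
      fun t : ℝ => I ^ n * Complex.exp (t * I) := by
    intro n
    induction n with
    | zero => simp
    | succ n ih =>
      rw [iteratedDeriv_succ, ih]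
      ext t
      have h1 : HasDerivAt (fun t : ℝ => (t : ℂ) * I) (1 * I) t :=
        (Complex.ofRealCLM.hasDerivAt (x := t)).mul_const I
      have := (h1.cexp.const_mul (I ^ n)).deriv
      rw [this]
      ring
  refine ⟨?_, fun n => ⟨0, 1, fun t => ?_⟩⟩
  · exact (Complex.ofRealCLM.contDiff.mul contDiff_const).cexp
  · rw [norm_iteratedFDeriv_eq_norm_iteratedDeriv, hd]
    simp [Complex.norm_exp]

lemma exp_tg (k : ℂ) : Function.HasTemperateGrowth
    (fun z : ℂ => Complex.exp ((starRingEnd ℂ) (k * z) - k * z)) := by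
  let φ : ℂ →L[ℝ] ℝ := (-2 : ℝ) • (Complex.imCLM.comp (ContinuousLinearMap.mul ℝ ℂ k))
  have := cexp_tg.comp φ.hasTemperateGrowth
  convert this using 1
  ext z
  simp only [Function.comp_apply, φ]
  congr 1
  apply Complex.ext <;> simp
  ring

lemma mom (g : 𝓢(ℂ, ℂ)) (n : ℕ) : ∃ G : 𝓢(ℂ, ℂ), ∀ z, G z = z ^ n * g z := by
  have h : Function.HasTemperateGrowth (fun z : ℂ => z ^ n) :=
    Function.HasTemperateGrowth.id'.pow n
  exact ⟨SchwartzMap.smulLeftCLM ℂ (fun z : ℂ => z ^ n) g, fun z => by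
    rw [SchwartzMap.smulLeftCLM_apply_apply h, smul_eq_mul]⟩

lemma mul_cau (g : 𝓢(ℂ, ℂ)) (z : ℂ) :
    z * cau g z = cau (fun w => w * g w) z + ∫ w, g w := by
  obtain ⟨K, hK⟩ := adm_schwartz g
  obtain ⟨G, hG⟩ := mom g 1
  obtain ⟨K1, hK1⟩ := adm_schwartz G
  have e : (fun w => w * g w) = G := by ext w; rw [hG, pow_one]
  rw [e]
  unfold cau
  rw [← integral_const_mul, ← integral_add (hK1.integrable z) hK.integrable']
  refine integral_congr_ae ?_
  have : ∀ᵐ w : ℂ, w ≠ z := by simp [ae_iff]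
  filter_upwards [this] with w hw
  rw [hG]
  have : z - w ≠ 0 := sub_ne_zero.2 hw.symm
  field_simp
  ring

lemma pow_mul_cau (g : 𝓢(ℂ, ℂ)) (n : ℕ) (z : ℂ) (hz : z ≠ 0) :
    cau g z = ∑ j ∈ Finset.range n, (∫ w, w ^ j * g w) * z ^ (-(j : ℤ) - 1) +
      z ^ (-(n : ℤ)) * cau (fun w => w ^ n * g w) z := by
  induction n with
  | zero => simp
  | succ n ih =>
    obtain ⟨G, hG⟩ := mom g n
    have h := mul_cau G z
    have e : (fun w => w ^ n * g w) = G := by ext w; rw [hG]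
    have e2 : (fun w => w ^ (n + 1) * g w) = fun w => w * G w := by ext w; rw [hG]; ring
    have e3 : (∫ w, w ^ n * g w) = ∫ w, G w := by rw [e]
    rw [Finset.sum_range_succ, e3, ih, e, e2]
    have e4 : z ^ (-(n : ℤ)) = z * z ^ (-(n : ℤ) - 1) := by
      rw [zpow_sub_one₀ hz]; field_simp
    have e5 : -((n + 1 : ℕ) : ℤ) = -(n : ℤ) - 1 := by push_cast; ring
    rw [e4, e5]
    linear_combination z ^ (-(n : ℤ) - 1) * h

lemma cau_expand (g : 𝓢(ℂ, ℂ)) (N : ℕ) :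
    (fun z => cau g z - ∑ j ∈ Finset.range N, (∫ w, w ^ j * g w) * z ^ (-(j : ℤ) - 1))
      =O[cobounded ℂ] fun z => ‖z‖ ^ (-(N : ℤ) - 1) := by
  obtain ⟨G, hG⟩ := mom g (N + 1)
  obtain ⟨K, hK⟩ := adm_schwartz G
  have e : (fun w => w ^ (N + 1) * g w) = G := by ext w; rw [hG]
  refine IsBigO.of_bound (‖∫ w, w ^ N * g w‖ + K * MM) ?_
  filter_upwards [eventually_ne_cobounded (0 : ℂ)] with z hz
  rw [pow_mul_cau g (N + 1) z hz, e, Finset.sum_range_succ]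
  have e5 : -((N + 1 : ℕ) : ℤ) = -(N : ℤ) - 1 := by push_cast; ring
  rw [e5, add_assoc, add_sub_cancel_left, mul_comm (z ^ _), ← add_mul, norm_mul, norm_zpow,
    norm_zpow, norm_norm]
  gcongr
  exact (norm_add_le _ _).trans (by gcongr; exact hK.cau_le z)

lemma cau_expand' (g : 𝓢(ℂ, ℂ)) (N : ℕ) : ∃ a : Fin N → ℂ,
    (fun z => (Real.pi : ℂ)⁻¹ * cau g z - ∑ j : Fin N, a j * z ^ (-(j : ℤ) - 1))
      =O[cobounded ℂ] fun z => ‖z‖ ^ (-(N : ℤ) - 1) := by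
  refine ⟨fun j => (Real.pi : ℂ)⁻¹ * ∫ w, w ^ (j : ℕ) * g w, ?_⟩
  refine ((cau_expand g N).const_mul_left (Real.pi : ℂ)⁻¹).congr_left fun z => ?_
  rw [mul_sub, Finset.mul_sum, Finset.sum_range]
  simp only [mul_assoc]

lemma cau_tendsto (g : 𝓢(ℂ, ℂ)) :
    Tendsto (fun z => (Real.pi : ℂ)⁻¹ * cau g z) (cobounded ℂ) (nhds 0) := by
  have h := (cau_expand g 0).const_mul_left (Real.pi : ℂ)⁻¹
  simp only [Finset.range_zero, Finset.sum_empty, sub_zero] at h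
  refine h.trans_tendsto ?_
  simpa [Function.comp_def] using tendsto_inv_atTop_zero.comp (tendsto_norm_cobounded_atTop (E := ℂ))

theorem main_thm (Q : 𝓢(ℂ, ℂ)) (k : ℂ) : ∃ (m : ℂ → ℂ) (P : 𝓢(ℂ, ℂ)),
    (∃ C : ℝ, ∀ z, ‖m z‖ ≤ C) ∧ ContDiff ℝ (⊤ : ℕ∞) m ∧
    (∀ z, P z = (1 / 2) * Complex.exp ((starRingEnd ℂ) (k * z) - k * z) * Q z *
      ((starRingEnd ℂ) (m z) + 1)) ∧ m = fun z => (Real.pi : ℂ)⁻¹ * cau P z := by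
  let q : 𝓢(ℂ, ℂ) := (1 / 2 : ℂ) • SchwartzMap.smulLeftCLM ℂ
    (fun z : ℂ => Complex.exp ((starRingEnd ℂ) (k * z) - k * z)) Q
  have hq : ∀ z, q z = (1 / 2) * Complex.exp ((starRingEnd ℂ) (k * z) - k * z) * Q z := by
    intro z
    simp only [q, smul_apply]
    rw [SchwartzMap.smulLeftCLM_apply_apply (exp_tg k), smul_eq_mul, smul_eq_mul, mul_assoc]
  obtain ⟨m, hm1, hm2, hm3⟩ := sol_main q
  have hmt : Function.HasTemperateGrowth m := by
    refine ⟨hm1, fun n => ?_⟩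
    obtain ⟨C, hC⟩ := hm2 n
    exact ⟨0, C, fun z => by simpa using hC z⟩
  have hmc : Function.HasTemperateGrowth (fun z => (starRingEnd ℂ) (m z) + 1) :=
    ((Complex.conjCLE.toContinuousLinearMap.hasTemperateGrowth).comp hmt).add
      (Function.HasTemperateGrowth.const 1)
  let P : 𝓢(ℂ, ℂ) := SchwartzMap.smulLeftCLM ℂ (fun z => (starRingEnd ℂ) (m z) + 1) q
  have hP : ∀ z, P z = q z * ((starRingEnd ℂ) (m z) + 1) := by
    intro z
    simp only [P]
    rw [SchwartzMap.smulLeftCLM_apply_apply hmc, smul_eq_mul, mul_comm]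
  refine ⟨m, P, ?_, hm1, fun z => by rw [hP, hq], ?_⟩
  · obtain ⟨C, hC⟩ := hm2 0
    exact ⟨C, fun z => by simpa using hC z⟩
  · ext z
    rw [hm3 z]
    congr 2
    ext w
    rw [hP]


end Part6

/-- Existence, smoothness, decay, Schwartz-class right-hand side and complete asymptotic
expansion in powers of 1/z for the solution m of the D-bar equation
∂̄m = ½ e^{k̄z̄ − kz} Q (m̄ + 1). -/
theorem stmt0 (Q : SchwartzMap ℂ ℂ) (k : ℂ) :
    ∃ m : ℂ → ℂ,
      (∃ C : ℝ, ∀ z : ℂ, ‖m z‖ ≤ C) ∧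
      ContDiff ℝ (⊤ : ℕ∞) m ∧
      Tendsto m (cobounded ℂ) (nhds 0) ∧
      (∀ z : ℂ, dbar m z =
        (1 / 2) * Complex.exp ((starRingEnd ℂ) (k * z) - k * z) * Q z
          * ((starRingEnd ℂ) (m z) + 1)) ∧
      (∃ P : SchwartzMap ℂ ℂ, ∀ z : ℂ, P z =
        (1 / 2) * Complex.exp ((starRingEnd ℂ) (k * z) - k * z) * Q z
          * ((starRingEnd ℂ) (m z) + 1)) ∧
      (∀ N : ℕ, 1 ≤ N → ∃ a : Fin N → ℂ,
        (fun z : ℂ => m z - ∑ j : Fin N, a j * z ^ (-(j : ℤ) - 1))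
          =O[cobounded ℂ] fun z : ℂ => ‖z‖ ^ (-(N : ℤ) - 1)) := by
  obtain ⟨m, P, hb, hc, hP, hm⟩ := main_thm Q k
  have hd : ∀ z, dbar m z = P z := by
    intro z
    rw [hm]
    exact dbar_cau P z
  refine ⟨m, hb, hc, ?_, fun z => by rw [hd, hP], ⟨P, hP⟩, fun N _ => ?_⟩
  · rw [hm]
    exact cau_tendsto P
  · rw [hm]
    exact cau_expand' P N
end

section
/- The function ξ ↦ e^{−|ξ|²}/ξ (with ξ = ξ₁ + iξ₂) is absolutely integrable on ℝ², and for every (x,y) ∈ ℝ² with z = x + iy ≠ 0 one has F⁻¹(ξ ↦ e^{−|ξ|²}/ξ)(x,y) = (1/(2π)) ∫_{ℝ²} (e^{−(ξ₁²+ξ₂²)}/(ξ₁ + iξ₂)) e^{i(ξ₁x + ξ₂y)} dξ₁ dξ₂ = (i/(x + iy)) (1 − e^{−(x² + y²)/4}). -/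
open Complex MeasureTheory Filter

/-- The inverse Fourier transform on ℝ² ≅ ℂ, with the symmetric 1/(2π) normalization:
F⁻¹(g)(z) = (1/(2π)) ∫ g(ξ) e^{i(ξ₁x + ξ₂y)} dξ, where z = x + iy and ξ = ξ₁ + iξ₂. -/
noncomputable def fourierInvT (g : ℂ → ℂ) (z : ℂ) : ℂ :=
  (1 / (2 * Real.pi)) *
    ∫ ξ : ℂ, g ξ * Complex.exp (Complex.I * Complex.ofReal (ξ.re * z.re + ξ.im * z.im))

lemma g_int {t : ℝ} (ht : 0 < t) (a : ℝ) :
    Integrable (fun x : ℝ => cexp (I * a * x) * cexp (-(t : ℂ) * (x : ℂ) ^ 2)) := by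
  have h := integrable_cexp_neg_mul_sq (b := (t : ℂ)) (by simpa using ht)
  refine h.mono (by fun_prop) (ae_of_all _ fun x => ?_)
  have : I * a * x = ((a * x : ℝ) : ℂ) * I := by push_cast; ring
  rw [norm_mul, this, norm_exp_ofReal_mul_I, one_mul]

lemma xg_int {t : ℝ} (ht : 0 < t) (a : ℝ) :
    Integrable (fun x : ℝ => (x : ℂ) * (cexp (I * a * x) * cexp (-(t : ℂ) * (x : ℂ) ^ 2))) := by
  have h := integrable_mul_cexp_neg_mul_sq (b := (t : ℂ)) (by simpa using ht)
  refine h.mono (by fun_prop) (ae_of_all _ fun x => ?_)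
  have : I * a * x = ((a * x : ℝ) : ℂ) * I := by push_cast; ring
  rw [norm_mul, norm_mul, norm_mul, this, norm_exp_ofReal_mul_I, one_mul]

lemma xg_integral {t : ℝ} (ht : 0 < t) (a : ℝ) :
    ∫ x : ℝ, (x : ℂ) * (cexp (I * a * x) * cexp (-(t : ℂ) * (x : ℂ) ^ 2)) =
      I * a / (2 * t) * ∫ x : ℝ, cexp (I * a * x) * cexp (-(t : ℂ) * (x : ℂ) ^ 2) := by
  have hd : ∀ x : ℝ, HasDerivAt (fun x : ℝ => cexp (I * a * x) * cexp (-(t : ℂ) * (x : ℂ) ^ 2))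
      (I * a * (cexp (I * a * x) * cexp (-(t : ℂ) * (x : ℂ) ^ 2)) -
        2 * t * ((x : ℂ) * (cexp (I * a * x) * cexp (-(t : ℂ) * (x : ℂ) ^ 2)))) x := by
    intro x
    have hx : HasDerivAt (fun x : ℝ => (x : ℂ)) 1 x := ofRealCLM.hasDerivAt
    have h1 := (hx.const_mul (I * a)).cexp
    have h2 := ((hx.pow 2).const_mul (-(t : ℂ))).cexp
    refine (h1.mul h2).congr_deriv ?_
    simp
    ring
  have h := integral_eq_zero_of_hasDerivAt_of_integrable hd
    (((g_int ht a).const_mul _).sub ((xg_int ht a).const_mul _)) (g_int ht a)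
  rw [integral_sub ((g_int ht a).const_mul _) ((xg_int ht a).const_mul _),
    integral_const_mul, integral_const_mul] at h
  have : (t : ℂ) ≠ 0 := by exact_mod_cast ht.ne'
  generalize (∫ x : ℝ, (x : ℂ) * (cexp (I * a * x) * cexp (-(t : ℂ) * (x : ℂ) ^ 2))) = X at *
  generalize (∫ x : ℝ, cexp (I * a * x) * cexp (-(t : ℂ) * (x : ℂ) ^ 2)) = Y at *
  field_simp
  linear_combination -h

lemma g2_integral {t : ℝ} (ht : 0 < t) (z : ℂ) :
    ∫ ξ : ℂ, (starRingEnd ℂ) ξ * cexp (-(normSq ξ : ℂ) * t) *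
      cexp (I * Complex.ofReal (ξ.re * z.re + ξ.im * z.im)) =
      I * Real.pi * (starRingEnd ℂ) z / 2 * (1 / (t : ℂ) ^ 2 * cexp (-(normSq z : ℂ) / (4 * t))) := by
  have htc : (t : ℂ) ≠ 0 := by exact_mod_cast ht.ne'
  set G : ℝ → ℝ → ℂ := fun a x => cexp (I * a * x) * cexp (-(t : ℂ) * (x : ℂ) ^ 2) with hG
  have e1 : ∀ ξ : ℂ, (starRingEnd ℂ) ξ * cexp (-(normSq ξ : ℂ) * t) *
      cexp (I * Complex.ofReal (ξ.re * z.re + ξ.im * z.im)) =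
      (ξ.re * G z.re ξ.re) * G z.im ξ.im - I * (G z.re ξ.re * (ξ.im * G z.im ξ.im)) := by
    intro ξ
    have : (starRingEnd ℂ) ξ = ξ.re - I * ξ.im := by
      apply Complex.ext <;> simp
    have e : cexp (-(normSq ξ : ℂ) * t) *
      cexp (I * Complex.ofReal (ξ.re * z.re + ξ.im * z.im)) = G z.re ξ.re * G z.im ξ.im := by
      simp only [hG, ← Complex.exp_add]
      congr 1
      rw [normSq_apply]
      push_cast
      ring
    rw [mul_assoc, e, this]
    ring
  have hv := Complex.volume_preserving_equiv_real_prod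
  have e2 : ∫ ξ : ℂ, ((ξ.re * G z.re ξ.re) * G z.im ξ.im - I * (G z.re ξ.re * (ξ.im * G z.im ξ.im)))
      = ∫ p : ℝ × ℝ, ((p.1 * G z.re p.1) * G z.im p.2 - I * (G z.re p.1 * (p.2 * G z.im p.2))) := by
    exact hv.integral_comp' (f := Complex.measurableEquivRealProd)
      (fun p : ℝ × ℝ => ((p.1 * G z.re p.1) * G z.im p.2 - I * (G z.re p.1 * (p.2 * G z.im p.2))))
  have i1 : Integrable (fun p : ℝ × ℝ => (p.1 * G z.re p.1) * G z.im p.2) :=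
    (xg_int ht z.re).mul_prod (g_int ht z.im)
  have i2 : Integrable (fun p : ℝ × ℝ => G z.re p.1 * (p.2 * G z.im p.2)) :=
    (g_int ht z.re).mul_prod (xg_int ht z.im)
  have f1 : ∫ p : ℝ × ℝ, (p.1 * G z.re p.1) * G z.im p.2 =
    (∫ x : ℝ, x * G z.re x) * ∫ x, G z.im x :=
    integral_prod_mul (fun x : ℝ => x * G z.re x) (G z.im)
  have f2 : ∫ p : ℝ × ℝ, G z.re p.1 * (p.2 * G z.im p.2) =
    (∫ x : ℝ, G z.re x) * ∫ x : ℝ, x * G z.im x :=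
    integral_prod_mul (G z.re) (fun x : ℝ => x * G z.im x)
  rw [integral_congr_ae (ae_of_all _ e1), e2, integral_sub i1 (i2.const_mul I),
    integral_const_mul, f1, f2]
  simp only [hG]
  rw [xg_integral ht, xg_integral ht, fourierIntegral_gaussian (by simpa using ht),
    fourierIntegral_gaussian (by simpa using ht)]
  have hs : ((Real.pi : ℂ) / t) ^ (1 / 2 : ℂ) * ((Real.pi : ℂ) / t) ^ (1 / 2 : ℂ) = Real.pi / t := by
    have : ((Real.pi : ℂ) / t) ≠ 0 := div_ne_zero (by exact_mod_cast Real.pi_ne_zero) htc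
    rw [← Complex.cpow_add _ _ this]
    norm_num
  have he : cexp (-(z.re : ℂ) ^ 2 / (4 * t)) * cexp (-(z.im : ℂ) ^ 2 / (4 * t)) =
      cexp (-(normSq z : ℂ) / (4 * t)) := by
    rw [← Complex.exp_add, normSq_apply]
    congr 1
    push_cast
    ring
  have hz : (starRingEnd ℂ) z = z.re - I * z.im := by
    apply Complex.ext <;> simp
  rw [← he, hz]
  generalize cexp (-(z.re : ℂ) ^ 2 / (4 * t)) = A
  generalize cexp (-(z.im : ℂ) ^ 2 / (4 * t)) = B
  generalize ((Real.pi : ℂ) / t) ^ (1 / 2 : ℂ) = S at *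
  calc _ = (S * S) * (I * (z.re - I * z.im) / (2 * t)) * A * B := by ring
    _ = _ := by rw [hs]; field_simp

lemma int1 : Integrable (fun ξ : ℂ => cexp (-(normSq ξ : ℂ)) / ξ) := by
  have h := Complex.integral_rpow_mul_exp_neg_mul_rpow (p := 2) (q := -1) (b := 1)
    (by norm_num) (by norm_num) (by norm_num)
  have hi : Integrable (fun x : ℂ => ‖x‖ ^ (-1 : ℝ) * Real.exp (-1 * ‖x‖ ^ (2 : ℝ))) := by
    apply Integrable.of_integral_ne_zero
    rw [h]
    have := Real.Gamma_pos_of_pos (s := (-1 + 2) / 2) (by norm_num)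
    positivity
  refine hi.mono (Measurable.aestronglyMeasurable (by fun_prop)) (ae_of_all _ fun ξ => ?_)
  have : -(normSq ξ : ℂ) = ((-normSq ξ : ℝ) : ℂ) := by push_cast; rfl
  rw [norm_div, this, Complex.norm_exp_ofReal, norm_mul, Real.rpow_neg_one, norm_inv, norm_norm,
    Real.norm_of_nonneg (Real.exp_pos _).le, normSq_eq_norm_sq]
  simp [div_eq_mul_inv, mul_comm]

lemma inner_t {ξ : ℂ} (hξ : ξ ≠ 0) :
    ∫ t in Set.Ioi (1 : ℝ), cexp (-(normSq ξ : ℂ) * t) = cexp (-(normSq ξ : ℂ)) / normSq ξ := by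
  rw [integral_exp_mul_complex_Ioi (by simpa using hξ)]
  simp [neg_div_neg_eq]

lemma int2 (z : ℂ) : Integrable (Function.uncurry fun (ξ : ℂ) (t : ℝ) =>
      (starRingEnd ℂ) ξ * cexp (-(normSq ξ : ℂ) * t) *
      cexp (I * Complex.ofReal (ξ.re * z.re + ξ.im * z.im)))
      (volume.prod (volume.restrict (Set.Ioi (1 : ℝ)))) := by
  have h0 : ∀ᵐ ξ : ℂ, ξ ≠ 0 := Measure.ae_ne volume 0
  have hm : Continuous (Function.uncurry fun (ξ : ℂ) (t : ℝ) =>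
      (starRingEnd ℂ) ξ * cexp (-(normSq ξ : ℂ) * t) *
      cexp (I * Complex.ofReal (ξ.re * z.re + ξ.im * z.im))) := by
    have := Complex.continuous_normSq
    simp only [Function.uncurry_def]
    fun_prop
  rw [integrable_prod_iff hm.aestronglyMeasurable]
  constructor
  · filter_upwards [h0] with ξ hξ
    have hre : (-(normSq ξ : ℂ)).re < 0 := by simpa using hξ
    have hb : Integrable (fun t : ℝ => cexp (-(normSq ξ : ℂ) * t))
      (volume.restrict (Set.Ioi (1 : ℝ))) := integrableOn_exp_mul_complex_Ioi hre 1
    simp only [Function.uncurry_apply_pair]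
    exact (hb.const_mul _).mul_const _
  · refine int1.norm.congr ?_
    filter_upwards [h0] with ξ hξ
    have hn : 0 < normSq ξ := by simpa using hξ
    have e : ∀ t : ℝ, ‖Function.uncurry (fun (ξ : ℂ) (t : ℝ) =>
      (starRingEnd ℂ) ξ * cexp (-(normSq ξ : ℂ) * t) *
      cexp (I * Complex.ofReal (ξ.re * z.re + ξ.im * z.im))) (ξ, t)‖ =
        ‖ξ‖ * Real.exp (-normSq ξ * t) := by
      intro t
      have e1 : -(normSq ξ : ℂ) * t = ((-normSq ξ * t : ℝ) : ℂ) := by push_cast; rfl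
      simp only [Function.uncurry_apply_pair]
      rw [norm_mul, norm_mul, mul_comm I, norm_exp_ofReal_mul_I, e1, norm_exp_ofReal,
        RCLike.norm_conj, mul_one]
    simp only [e]
    rw [integral_const_mul, integral_exp_mul_Ioi (by linarith)]
    have : -(normSq ξ : ℂ) = ((-normSq ξ : ℝ) : ℂ) := by push_cast; rfl
    rw [norm_div, this, Complex.norm_exp_ofReal, normSq_eq_norm_sq]
    have : ‖ξ‖ ≠ 0 := by simpa using hξ
    field_simp

/-- The function e^{−|ξ|²}/ξ is absolutely integrable on ℝ², and its inverse Fourier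
transform is (i/z)(1 − e^{−|z|²/4}) for z ≠ 0. -/
theorem stmt2 :
    Integrable (fun ξ : ℂ => Complex.exp (-(Complex.normSq ξ : ℂ)) / ξ) ∧
    ∀ z : ℂ, z ≠ 0 →
      fourierInvT (fun ξ : ℂ => Complex.exp (-(Complex.normSq ξ : ℂ)) / ξ) z =
        (Complex.I / z) * (1 - Complex.exp (-(Complex.normSq z : ℂ) / 4)) := by
  refine ⟨int1, fun z hz => ?_⟩
  have hpi : (Real.pi : ℂ) ≠ 0 := by exact_mod_cast Real.pi_ne_zero
  have hN : (normSq z : ℂ) ≠ 0 := by exact_mod_cast (normSq_pos.2 hz).ne'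
  have hNz : (normSq z : ℂ) = z * (starRingEnd ℂ) z := (mul_conj z).symm
  have hi := int2 z
  have h1 : ∫ ξ : ℂ, cexp (-(normSq ξ : ℂ)) / ξ *
      cexp (I * Complex.ofReal (ξ.re * z.re + ξ.im * z.im)) =
      ∫ ξ : ℂ, ∫ t in Set.Ioi (1 : ℝ), (starRingEnd ℂ) ξ * cexp (-(normSq ξ : ℂ) * t) *
      cexp (I * Complex.ofReal (ξ.re * z.re + ξ.im * z.im)) := by
    apply integral_congr_ae
    filter_upwards [Measure.ae_ne (volume : Measure ℂ) 0] with ξ hξ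
    rw [integral_mul_const, integral_const_mul, inner_t hξ, ← mul_conj ξ]
    have : (starRingEnd ℂ) ξ ≠ 0 := by simpa using hξ
    field_simp
  have h2 : ∀ t ∈ Set.Ioi (1 : ℝ), ∫ ξ : ℂ, (starRingEnd ℂ) ξ * cexp (-(normSq ξ : ℂ) * t) *
      cexp (I * Complex.ofReal (ξ.re * z.re + ξ.im * z.im)) =
      I * Real.pi * (starRingEnd ℂ) z / 2 *
        (1 / (t : ℂ) ^ 2 * cexp (-(normSq z : ℂ) / (4 * t))) :=
    fun t ht => g2_integral (lt_trans one_pos ht) z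
  have hint : IntegrableOn (fun t : ℝ => I * Real.pi * (starRingEnd ℂ) z / 2 *
        (1 / (t : ℂ) ^ 2 * cexp (-(normSq z : ℂ) / (4 * t)))) (Set.Ioi 1) :=
    (IntegrableOn.congr_fun (f := fun t : ℝ => ∫ ξ : ℂ, (starRingEnd ℂ) ξ *
      cexp (-(normSq ξ : ℂ) * t) * cexp (I * Complex.ofReal (ξ.re * z.re + ξ.im * z.im)))
      hi.integral_prod_right h2 measurableSet_Ioi)
  have hd : ∀ t ∈ Set.Ici (1 : ℝ), HasDerivAt (fun t : ℝ => I * Real.pi * (starRingEnd ℂ) z / 2 *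
        (4 / normSq z) * cexp (-(normSq z : ℂ) / 4 * (t : ℂ)⁻¹))
      (I * Real.pi * (starRingEnd ℂ) z / 2 *
        (1 / (t : ℂ) ^ 2 * cexp (-(normSq z : ℂ) / (4 * t)))) t := by
    intro t ht
    have ht0 : (t : ℂ) ≠ 0 := by
      have : (0 : ℝ) < t := lt_of_lt_of_le one_pos ht
      exact_mod_cast this.ne'
    have hx : HasDerivAt (fun x : ℝ => (x : ℂ)) 1 t := ofRealCLM.hasDerivAt
    refine ((((hx.fun_inv ht0).const_mul (-(normSq z : ℂ) / 4)).cexp).const_mul _).congr_deriv ?_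
    have : -(normSq z : ℂ) / (4 * t) = -(normSq z : ℂ) / 4 * (t : ℂ)⁻¹ := by field_simp
    rw [this]
    field_simp
  have hlim : Tendsto (fun t : ℝ => I * Real.pi * (starRingEnd ℂ) z / 2 *
        (4 / normSq z) * cexp (-(normSq z : ℂ) / 4 * (t : ℂ)⁻¹)) atTop
      (nhds (I * Real.pi * (starRingEnd ℂ) z / 2 * (4 / normSq z) * cexp (-(normSq z : ℂ) / 4 * 0))) := by
    have h : Tendsto (fun t : ℝ => ((t : ℂ))⁻¹) atTop (nhds 0) := by
      have := (Complex.continuous_ofReal.tendsto 0).comp tendsto_inv_atTop_zero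
      simpa [Function.comp_def] using this
    exact ((Complex.continuous_exp.tendsto _).comp (h.const_mul _)).const_mul _
  unfold fourierInvT
  rw [h1, integral_integral_swap hi, setIntegral_congr_fun measurableSet_Ioi h2,
    integral_Ioi_of_hasDerivAt_of_tendsto' hd hint hlim]
  have hzb : (starRingEnd ℂ) z ≠ 0 := by simpa using hz
  simp only [mul_zero, Complex.exp_zero, ofReal_one, inv_one, mul_one]
  generalize cexp (-(normSq z : ℂ) / 4) = E
  rw [hNz]
  field_simp
  ring
end

section
/- Let n ∈ ℕ. The function ξ ↦ (ξ̄ⁿ/ξ) e^{−|ξ|²} (with ξ = ξ₁ + iξ₂, ξ̄ = ξ₁ − iξ₂) is absolutely integrable on ℝ², and for every z = x + iy ≠ 0 one has F⁻¹(ξ ↦ (ξ̄ⁿ/ξ) e^{−|ξ|²})(x,y) = i (2i)ⁿ (n!/z^{n+1}) [ 1 − e^{−|z|²/4} Σ_{k=0}^{n} (1/k!) (z z̄ / 4)^k ], where z̄ = x − iy and |z|² = z z̄. -/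
open Complex MeasureTheory Filter

/-- Gaussian with oscillating factor. -/
noncomputable def gE (s : ℝ) (z ξ : ℂ) : ℂ :=
  Complex.exp (-(s : ℂ) * (ξ * (starRingEnd ℂ) ξ)
    + Complex.I / 2 * (ξ * (starRingEnd ℂ) z + (starRingEnd ℂ) ξ * z))

lemma osc_eq (z ξ : ℂ) : ξ * (starRingEnd ℂ) z + (starRingEnd ℂ) ξ * z
    = 2 * ((ξ.re * z.re + ξ.im * z.im : ℝ) : ℂ) := by
  apply Complex.ext <;> simp <;> ring

lemma gE_eq (s : ℝ) (z ξ : ℂ) : gE s z ξ = Complex.exp (-(s : ℂ) * (Complex.normSq ξ : ℂ))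
    * Complex.exp (Complex.I * ((ξ.re * z.re + ξ.im * z.im : ℝ) : ℂ)) := by
  rw [gE, osc_eq, Complex.mul_conj, ← Complex.exp_add]
  congr 1
  ring

lemma norm_gE (s : ℝ) (z ξ : ℂ) : ‖gE s z ξ‖ = Real.exp (-s * ‖ξ‖ ^ (2 : ℝ)) := by
  rw [gE_eq, norm_mul, mul_comm Complex.I, Complex.norm_exp_ofReal_mul_I, mul_one,
    Complex.norm_exp, Complex.normSq_eq_norm_sq]
  congr 1
  rw [← Complex.ofReal_neg, ← Complex.ofReal_mul, Complex.ofReal_re]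
  norm_num

lemma continuous_gE (z : ℂ) : Continuous (fun p : ℂ × ℝ => gE p.2 z p.1) := by
  unfold gE
  have := Complex.continuous_conj
  fun_prop

lemma continuous_gE' (s : ℝ) (z : ℂ) : Continuous (gE s z) := by
  have : Continuous (fun ξ : ℂ => ((ξ, s) : ℂ × ℝ)) := by fun_prop
  exact (continuous_gE z).comp this

lemma integrable_radial (q s : ℝ) (hq : -2 < q) (hs : 0 < s) :
    Integrable (fun ξ : ℂ => ‖ξ‖ ^ q * Real.exp (-s * ‖ξ‖ ^ (2 : ℝ))) := by
  apply Integrable.of_integral_ne_zero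
  rw [Complex.integral_rpow_mul_exp_neg_mul_rpow (by norm_num) hq hs]
  have h1 : 0 < Real.Gamma ((q + 2) / 2) := Real.Gamma_pos_of_pos (by linarith)
  have := Real.pi_pos
  positivity

lemma integrable_mono (s : ℝ) (hs : 0 < s) (z : ℂ) (a b : ℕ) :
    Integrable (fun ξ : ℂ => ξ ^ a * (starRingEnd ℂ) ξ ^ b * gE s z ξ) := by
  have h0 := integrable_radial ((a + b : ℕ) : ℝ) s
    (by have : (0 : ℝ) ≤ ((a + b : ℕ) : ℝ) := by positivity
        linarith) hs
  refine h0.mono' ?_ (ae_of_all _ fun ξ => ?_)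
  · have := continuous_gE' s z
    have := Complex.continuous_conj
    exact Continuous.aestronglyMeasurable (by fun_prop)
  · rw [norm_mul, norm_mul, norm_pow, norm_pow, norm_gE, RCLike.norm_conj, Real.rpow_natCast,
      pow_add]

lemma hasLineDeriv_g (s : ℝ) (z : ℂ) (m : ℕ) (ξ v : ℂ) :
    HasLineDerivAt ℝ (fun ξ : ℂ => (starRingEnd ℂ) ξ ^ m * gE s z ξ)
      (v * ((starRingEnd ℂ) ξ ^ m * (-(s : ℂ) * (starRingEnd ℂ) ξ
          + Complex.I / 2 * (starRingEnd ℂ) z) * gE s z ξ)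
        + (starRingEnd ℂ) v * ((m * (starRingEnd ℂ) ξ ^ (m - 1) + (starRingEnd ℂ) ξ ^ m *
          (-(s : ℂ) * ξ + Complex.I / 2 * z)) * gE s z ξ)) ξ v := by
  unfold HasLineDerivAt gE
  have hA : HasDerivAt (fun t : ℝ => ξ + t • v) v 0 := by
    simpa using ((hasDerivAt_id (0 : ℝ)).smul_const v).const_add ξ
  have hB : HasDerivAt (fun t : ℝ => (starRingEnd ℂ) (ξ + t • v)) ((starRingEnd ℂ) v) 0 := by
    have : HasDerivAt (fun t : ℝ => (starRingEnd ℂ) ξ + t • (starRingEnd ℂ) v)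
        ((starRingEnd ℂ) v) 0 := by
      simpa using ((hasDerivAt_id (0 : ℝ)).smul_const ((starRingEnd ℂ) v)).const_add
        ((starRingEnd ℂ) ξ)
    convert! this using 2
    simp
  have hX := (((hA.mul hB).const_mul (-(s : ℂ))).add (((hA.mul_const ((starRingEnd ℂ) z)).add
    (hB.mul_const z)).const_mul (Complex.I / 2))).cexp
  have := (hB.pow m).mul hX
  convert! this using 1
  simp
  ring

lemma integral_line_zero (g g' : ℂ → ℂ) (v : ℂ) (hg : Integrable g) (hg' : Integrable g')
    (h : ∀ ξ, HasLineDerivAt ℝ g (g' ξ) ξ v) : ∫ ξ, g' ξ = 0 := by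
  have := integral_bilinear_hasLineDerivAt_right_eq_neg_left_of_integrable (μ := volume)
    (f := fun _ : ℂ => (1 : ℂ)) (f' := fun _ => 0) (g := g) (g' := g') (v := v)
    (B := ContinuousLinearMap.mul ℝ ℂ) (by simp) (by simpa using hg') (by simpa using hg)
    (fun x _ => by simpa [HasLineDerivAt] using hasDerivAt_const (0 : ℝ) (1 : ℂ))
    (fun x _ => h x)
  simpa using this

lemma gauss_step (s : ℝ) (hs : 0 < s) (z : ℂ) (m : ℕ) :
    ∫ ξ : ℂ, (starRingEnd ℂ) ξ ^ (m + 1) * gE s z ξ =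
      (Complex.I * (starRingEnd ℂ) z / (2 * s)) * ∫ ξ : ℂ, (starRingEnd ℂ) ξ ^ m * gE s z ξ := by
  have hI := integrable_mono s hs z
  have h0 : Integrable (fun ξ : ℂ => (starRingEnd ℂ) ξ ^ m * gE s z ξ) := by
    simpa using hI 0 m
  have h1 : Integrable (fun ξ : ℂ => (starRingEnd ℂ) ξ ^ (m + 1) * gE s z ξ) := by
    simpa using hI 0 (m + 1)
  have hP : Integrable (fun ξ : ℂ => (starRingEnd ℂ) ξ ^ m * (-(s : ℂ) * (starRingEnd ℂ) ξ
          + Complex.I / 2 * (starRingEnd ℂ) z) * gE s z ξ) := by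
    convert! (h1.const_mul (-(s : ℂ))).add (h0.const_mul (Complex.I / 2 * (starRingEnd ℂ) z))
      using 2
    simp only [Pi.add_apply]
    ring
  have hQ : Integrable (fun ξ : ℂ => ((m * (starRingEnd ℂ) ξ ^ (m - 1) + (starRingEnd ℂ) ξ ^ m *
          (-(s : ℂ) * ξ + Complex.I / 2 * z)) * gE s z ξ)) := by
    convert! (((hI 0 (m - 1)).const_mul (m : ℂ)).add ((hI 1 m).const_mul (-(s : ℂ)))).add
      (h0.const_mul (Complex.I / 2 * z)) using 2
    simp only [Pi.add_apply]
    ring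
  have key : ∀ v : ℂ, v * (∫ ξ : ℂ, (starRingEnd ℂ) ξ ^ m * (-(s : ℂ) * (starRingEnd ℂ) ξ
          + Complex.I / 2 * (starRingEnd ℂ) z) * gE s z ξ) + (starRingEnd ℂ) v *
          (∫ ξ : ℂ, ((m * (starRingEnd ℂ) ξ ^ (m - 1) + (starRingEnd ℂ) ξ ^ m *
          (-(s : ℂ) * ξ + Complex.I / 2 * z)) * gE s z ξ)) = 0 := by
    intro v
    rw [← integral_const_mul, ← integral_const_mul,
      ← integral_add (hP.const_mul _) (hQ.const_mul _)]
    exact integral_line_zero _ _ v h0 ((hP.const_mul _).add (hQ.const_mul _))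
      (fun ξ => hasLineDeriv_g s z m ξ v)
  have k1 := key 1
  have kI := key Complex.I
  simp only [map_one, one_mul, Complex.conj_I] at k1 kI
  have hP0 : (∫ ξ : ℂ, (starRingEnd ℂ) ξ ^ m * (-(s : ℂ) * (starRingEnd ℂ) ξ
          + Complex.I / 2 * (starRingEnd ℂ) z) * gE s z ξ) = 0 := by
    linear_combination (1 / 2) * k1 - (Complex.I / 2) * kI
      + (1 / 2) * ((∫ ξ : ℂ, (starRingEnd ℂ) ξ ^ m * (-(s : ℂ) * (starRingEnd ℂ) ξ
          + Complex.I / 2 * (starRingEnd ℂ) z) * gE s z ξ) -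
          (∫ ξ : ℂ, ((m * (starRingEnd ℂ) ξ ^ (m - 1) + (starRingEnd ℂ) ξ ^ m *
          (-(s : ℂ) * ξ + Complex.I / 2 * z)) * gE s z ξ))) * Complex.I_mul_I
  have hsplit : (∫ ξ : ℂ, (starRingEnd ℂ) ξ ^ m * (-(s : ℂ) * (starRingEnd ℂ) ξ
          + Complex.I / 2 * (starRingEnd ℂ) z) * gE s z ξ) =
      -(s : ℂ) * (∫ ξ : ℂ, (starRingEnd ℂ) ξ ^ (m + 1) * gE s z ξ)
      + Complex.I / 2 * (starRingEnd ℂ) z * ∫ ξ : ℂ, (starRingEnd ℂ) ξ ^ m * gE s z ξ := by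
    rw [← integral_const_mul, ← integral_const_mul,
      ← integral_add (h1.const_mul _) (h0.const_mul _)]
    congr 1
    funext ξ
    ring
  rw [hsplit] at hP0
  have hs' : (s : ℂ) ≠ 0 := by exact_mod_cast hs.ne'
  field_simp
  linear_combination (-2) * hP0

lemma gauss_zero (s : ℝ) (hs : 0 < s) (z : ℂ) :
    ∫ ξ : ℂ, gE s z ξ = Real.pi / s * Complex.exp (-(Complex.normSq z : ℂ) / (4 * s)) := by
  have := GaussianFourier.integral_cexp_neg_mul_sq_norm_add (V := ℂ) (b := (s : ℂ))
    (by simpa using hs) Complex.I z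
  rw [Complex.finrank_real_complex] at this
  convert! this using 1
  · congr 1
    funext ξ
    rw [gE_eq, ← Complex.exp_add, Complex.normSq_eq_norm_sq]
    congr 2
    · push_cast; rfl
    · congr 2
      simp [Complex.inner]
  · rw [Complex.normSq_eq_norm_sq]
    simp

lemma gauss_all (s : ℝ) (hs : 0 < s) (z : ℂ) (m : ℕ) :
    ∫ ξ : ℂ, (starRingEnd ℂ) ξ ^ m * gE s z ξ = (Complex.I * (starRingEnd ℂ) z / (2 * s)) ^ m *
      (Real.pi / s * Complex.exp (-(Complex.normSq z : ℂ) / (4 * s))) := by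
  induction m with
  | zero => simpa using gauss_zero s hs z
  | succ m ih => rw [gauss_step s hs, ih]; ring

lemma prod_integrable (n : ℕ) (z : ℂ) :
    Integrable (fun p : ℂ × ℝ => (starRingEnd ℂ) p.1 ^ (n + 1) * gE p.2 z p.1)
      ((volume : Measure ℂ).prod (volume.restrict (Set.Ioi (1 : ℝ)))) := by
  have hc : Continuous (fun p : ℂ × ℝ => (starRingEnd ℂ) p.1 ^ (n + 1) * gE p.2 z p.1) := by
    have := continuous_gE z
    have := Complex.continuous_conj
    fun_prop
  rw [integrable_prod_iff' hc.aestronglyMeasurable]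
  constructor
  · refine (ae_restrict_iff' measurableSet_Ioi).2 (ae_of_all _ fun s hs => ?_)
    have hs : (1 : ℝ) < s := hs
    simpa using integrable_mono s (by linarith) z 0 (n + 1)
  · have h : IntegrableOn (fun s : ℝ => s ^ (-(((n + 1 : ℕ) : ℝ) + 2) / 2)) (Set.Ioi 1) :=
      integrableOn_Ioi_rpow_of_lt (by
        have : (0 : ℝ) ≤ n := by positivity
        push_cast
        linarith) one_pos
    have h2 := (h.const_mul (2 * Real.pi / 2)).mul_const
      (Real.Gamma ((((n + 1 : ℕ) : ℝ) + 2) / 2))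
    refine (integrableOn_congr_fun ?_ measurableSet_Ioi).1 h2
    intro s hs
    have hs : (1 : ℝ) < s := hs
    simp only
    rw [← Complex.integral_rpow_mul_exp_neg_mul_rpow (by norm_num) (by
        have : (0 : ℝ) ≤ ((n + 1 : ℕ) : ℝ) := by positivity
        linarith) (by linarith)]
    congr 1
    funext ξ
    rw [norm_mul, norm_pow, norm_gE, RCLike.norm_conj, Real.rpow_natCast]

lemma inner_integral (n : ℕ) (z ξ : ℂ) :
    ∫ s in Set.Ioi (1 : ℝ), (starRingEnd ℂ) ξ ^ (n + 1) * gE s z ξ =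
      (starRingEnd ℂ) ξ ^ n / ξ * Complex.exp (-(Complex.normSq ξ : ℂ)) *
        Complex.exp (Complex.I * ((ξ.re * z.re + ξ.im * z.im : ℝ) : ℂ)) := by
  by_cases h : ξ = 0
  · simp [h]
  have hn : 0 < Complex.normSq ξ := Complex.normSq_pos.2 h
  have h1 := integral_exp_mul_complex_Ioi (a := -(Complex.normSq ξ : ℂ)) (by simpa using h) 1
  have hr : ∀ s : ℝ, (starRingEnd ℂ) ξ ^ (n + 1) * gE s z ξ =
      ((starRingEnd ℂ) ξ ^ (n + 1) *
        Complex.exp (Complex.I * ((ξ.re * z.re + ξ.im * z.im : ℝ) : ℂ))) *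
        Complex.exp (-(Complex.normSq ξ : ℂ) * s) := by
    intro s
    rw [gE_eq, show -(Complex.normSq ξ : ℂ) * s = -(s : ℂ) * Complex.normSq ξ by ring]
    ring
  simp_rw [hr]
  rw [integral_const_mul, h1]
  have hcj : (starRingEnd ℂ) ξ ≠ 0 := by simpa using h
  rw [Complex.ofReal_one, mul_one, neg_div_neg_eq]
  generalize Complex.exp (-(Complex.normSq ξ : ℂ)) = X
  rw [← Complex.mul_conj]
  field_simp
  ring

lemma sum_deriv (n : ℕ) (u : ℝ) :
    HasDerivAt (fun u : ℝ => Real.exp (-u) * ∑ k ∈ Finset.range (n + 1),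
      (1 / (k.factorial : ℝ)) * u ^ k) (-(Real.exp (-u) * (u ^ n / n.factorial))) u := by
  induction n with
  | zero =>
    simpa using (hasDerivAt_neg u).exp
  | succ n ih =>
    have h2 := (((hasDerivAt_neg u).exp).mul
      ((hasDerivAt_pow (n + 1) u).const_mul (1 / ((n + 1).factorial : ℝ))))
    convert! ih.add h2 using 1
    · funext w
      simp only [Pi.add_apply, Pi.mul_apply]
      rw [Finset.sum_range_succ _ (n + 1)]
      ring
    · rw [Nat.factorial_succ]
      have : (n.factorial : ℝ) ≠ 0 := by exact_mod_cast n.factorial_ne_zero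
      have : (n : ℝ) + 1 ≠ 0 := by positivity
      push_cast
      field_simp
      ring

lemma s_integral (n : ℕ) (t : ℝ) (ht : 0 ≤ t) :
    ∫ s in Set.Ioi (1 : ℝ), Real.exp (-(t / s)) * ((t / s) ^ n / n.factorial) * (t / s ^ 2) =
      1 - Real.exp (-t) * ∑ k ∈ Finset.range (n + 1), (1 / (k.factorial : ℝ)) * t ^ k := by
  have h := integral_Ioi_of_hasDerivAt_of_nonneg' (a := (1 : ℝ)) (l := 1)
    (g := fun s : ℝ => Real.exp (-(t / s)) * ∑ k ∈ Finset.range (n + 1),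
      (1 / (k.factorial : ℝ)) * (t / s) ^ k)
    (g' := fun s => Real.exp (-(t / s)) * ((t / s) ^ n / n.factorial) * (t / s ^ 2)) ?_ ?_ ?_
  · simpa using h
  · intro s hs
    have hs : (1 : ℝ) ≤ s := hs
    have hs0 : s ≠ 0 := by linarith
    have hd : HasDerivAt (fun s : ℝ => t / s) (-(t / s ^ 2)) s := by
      convert! (hasDerivAt_inv hs0).const_mul t using 1
      field_simp
    have := (sum_deriv n (t / s)).comp s hd
    convert! this using 1
    ring
  · intro s hs
    have hs : (1 : ℝ) < s := hs
    positivity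
  · have hc : Tendsto (fun s : ℝ => t / s) atTop (nhds 0) := tendsto_const_nhds.div_atTop tendsto_id
    have h0 := (sum_deriv n 0).continuousAt.tendsto.comp hc
    convert! h0 using 2
    simp [Finset.sum_range_succ']

/-- The function ξ̄ⁿ e^{−|ξ|²}/ξ is absolutely integrable on ℝ², and its inverse Fourier
transform equals i(2i)ⁿ (n!/z^{n+1}) [1 − e^{−|z|²/4} Σ_{k=0}^{n} (zz̄/4)^k / k!] for z ≠ 0. -/
theorem stmt3 (n : ℕ) :
    Integrable (fun ξ : ℂ =>
      ((starRingEnd ℂ) ξ) ^ n / ξ * Complex.exp (-(Complex.normSq ξ : ℂ))) ∧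
    ∀ z : ℂ, z ≠ 0 →
      fourierInvT (fun ξ : ℂ =>
          ((starRingEnd ℂ) ξ) ^ n / ξ * Complex.exp (-(Complex.normSq ξ : ℂ))) z =
        Complex.I * (2 * Complex.I) ^ n * ((n.factorial : ℂ) / z ^ (n + 1)) *
          (1 - Complex.exp (-(Complex.normSq z : ℂ) / 4) *
            ∑ k ∈ Finset.range (n + 1),
              (1 / (k.factorial : ℂ)) * (z * (starRingEnd ℂ) z / 4) ^ k) := by
  constructor
  · have h := (prod_integrable n 0).integral_prod_left
    refine h.congr (ae_of_all _ fun ξ => ?_)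
    simp only
    rw [inner_integral]
    simp
  · intro z hz
    unfold fourierInvT
    have h1 : ∀ ξ : ℂ, ((starRingEnd ℂ) ξ) ^ n / ξ * Complex.exp (-(Complex.normSq ξ : ℂ)) *
        Complex.exp (Complex.I * Complex.ofReal (ξ.re * z.re + ξ.im * z.im)) =
        ∫ s in Set.Ioi (1 : ℝ), (starRingEnd ℂ) ξ ^ (n + 1) * gE s z ξ :=
      fun ξ => (inner_integral n z ξ).symm
    simp_rw [h1]
    rw [integral_integral_swap (f := fun (ξ : ℂ) (s : ℝ) =>
      (starRingEnd ℂ) ξ ^ (n + 1) * gE s z ξ) (prod_integrable n z)]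
    have hcj : (starRingEnd ℂ) z ≠ 0 := by simpa using hz
    have hf : (n.factorial : ℂ) ≠ 0 := by exact_mod_cast n.factorial_ne_zero
    have h2 : ∀ s ∈ Set.Ioi (1 : ℝ), (∫ ξ : ℂ, (starRingEnd ℂ) ξ ^ (n + 1) * gE s z ξ) =
        (Real.pi * (2 * Complex.I) ^ (n + 1) * n.factorial / z ^ (n + 1)) *
          ((Real.exp (-((Complex.normSq z / 4) / s)) * (((Complex.normSq z / 4) / s) ^ n /
            n.factorial) * ((Complex.normSq z / 4) / s ^ 2) : ℝ) : ℂ) := by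
      intro s hs
      have hs : (1 : ℝ) < s := hs
      have hs0 : (s : ℂ) ≠ 0 := by
        have : s ≠ 0 := by linarith
        exact_mod_cast this
      rw [gauss_all s (by linarith) z]
      push_cast
      rw [show -(Complex.normSq z : ℂ) / (4 * s) = -((Complex.normSq z : ℂ) / 4 / s) by
        field_simp]
      generalize Complex.exp (-((Complex.normSq z : ℂ) / 4 / s)) = X
      rw [← Complex.mul_conj]
      generalize (starRingEnd ℂ) z = w at *
      have h4 : ((4 : ℂ)) ^ n = 2 ^ n * 2 ^ n := by
        rw [← mul_pow]; norm_num
      simp only [div_pow, mul_pow, pow_succ, h4]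
      field_simp
      ring
    rw [setIntegral_congr_fun measurableSet_Ioi h2, integral_const_mul, integral_complex_ofReal,
      s_integral n _ (by have := Complex.normSq_nonneg z; positivity)]
    have hpi : (Real.pi : ℂ) ≠ 0 := by exact_mod_cast Real.pi_ne_zero
    rw [Complex.mul_conj]
    push_cast
    rw [show -((Complex.normSq z : ℂ) / 4) = -(Complex.normSq z : ℂ) / 4 by ring]
    field_simp
    ring
end

section
/- Let n ∈ ℕ. For every z = x + iy ∈ ℂ (including z = 0) one has F⁻¹(ξ ↦ (ξ̄ⁿ/ξ) e^{−|ξ|²})(x,y) = i (2i)ⁿ n! e^{−|z|²/4} (z̄/4)^{n+1} Σ_{k=0}^{∞} (1/(k+n+1)!) (z z̄ / 4)^k, where z̄ = x − iy and the series converges absolutely for every z. (This is the power-series form of the explicit inverse Fourier transform of ξ̄ⁿ e^{−|ξ|²}/ξ; in particular the value at z = 0 is 0.) -/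
open Complex MeasureTheory Filter

lemma aux_fwd (m n : ℕ) :
    (fwdDiff (1 : ℕ))^[m] (fun x : ℕ => (1 : ℂ) / ((x : ℂ) + 1)) n =
      (-1) ^ m * (m.factorial : ℂ) * (n.factorial : ℂ) / ((m + n + 1).factorial : ℂ) := by
  induction m generalizing n with
  | zero =>
    have h1 : (n.factorial : ℂ) ≠ 0 := by exact_mod_cast n.factorial_ne_zero
    have h2 : (n : ℂ) + 1 ≠ 0 := by exact_mod_cast n.succ_ne_zero
    simp only [Function.iterate_zero, id, zero_add, Nat.factorial_succ, Nat.factorial_zero]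
    push_cast
    field_simp
  | succ m ih =>
    rw [Function.iterate_succ_apply', fwdDiff, ih, ih]
    have e1 : m + (n + 1) + 1 = (m + n + 1) + 1 := by ring
    have e2 : m + 1 + n + 1 = (m + n + 1) + 1 := by ring
    rw [e1, e2, Nat.factorial_succ (m + n + 1), Nat.factorial_succ m, Nat.factorial_succ n]
    have h1 : ((m + n + 1).factorial : ℂ) ≠ 0 := by exact_mod_cast (m + n + 1).factorial_ne_zero
    have h2 : ((m + n + 1 + 1 : ℕ) : ℂ) ≠ 0 := by exact_mod_cast (m + n + 1).succ_ne_zero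
    push_cast at h2 ⊢
    field_simp
    ring

lemma aux_fin (m n : ℕ) :
    ∑ k ∈ Finset.range (m + 1), ((-1 : ℂ) ^ k / ((k.factorial : ℂ) * (n + 1 + k)))
      * (1 / ((m - k).factorial : ℂ)) = (n.factorial : ℂ) / ((m + n + 1).factorial : ℂ) := by
  have h := aux_fwd m n
  rw [fwdDiff_iter_eq_sum_shift] at h
  have hm : (m.factorial : ℂ) ≠ 0 := by exact_mod_cast m.factorial_ne_zero
  have hs : ((-1 : ℂ) ^ m) * (-1) ^ m = 1 := by rw [← mul_pow]; simp
  have h2 : ((-1 : ℂ) ^ m) * ∑ k ∈ Finset.range (m + 1),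
      ((-1 : ℤ) ^ (m - k) * (m.choose k : ℤ)) • ((1 : ℂ) / (((n + k • 1 : ℕ) : ℂ) + 1)) =
      m.factorial * ((n.factorial : ℂ) / ((m + n + 1).factorial : ℂ)) := by
    rw [h]
    linear_combination (m.factorial * ((n.factorial : ℂ) / ((m + n + 1).factorial : ℂ))) * hs
  apply mul_left_cancel₀ hm
  rw [← h2, Finset.mul_sum, Finset.mul_sum]
  refine Finset.sum_congr rfl fun k hk => ?_
  have hk' : k ≤ m := Nat.lt_succ_iff.mp (Finset.mem_range.mp hk)
  have hc : (m.choose k : ℂ) * k.factorial * (m - k).factorial = m.factorial := by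
    exact_mod_cast Nat.choose_mul_factorial_mul_factorial hk'
  have h3 : (k.factorial : ℂ) ≠ 0 := by exact_mod_cast k.factorial_ne_zero
  have h4 : ((m - k).factorial : ℂ) ≠ 0 := by exact_mod_cast (m - k).factorial_ne_zero
  have h5 : (n : ℂ) + 1 + k ≠ 0 := by
    have : ((n + k + 1 : ℕ) : ℂ) ≠ 0 := by exact_mod_cast (n + k).succ_ne_zero
    push_cast at this
    intro h; apply this; rw [← h]; ring
  have h6 : (-1 : ℂ) ^ m * (-1) ^ (m - k) = (-1) ^ k := by
    have : (-1 : ℂ) ^ m = (-1) ^ (m - k) * (-1) ^ k := by rw [← pow_add]; congr 1; omega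
    rw [this]
    have h7 : ((-1 : ℂ) ^ (m - k)) * (-1) ^ (m - k) = 1 := by rw [← mul_pow]; simp
    linear_combination (-1) ^ k * h7
  have h5' : (n : ℂ) + k + 1 ≠ 0 := by rwa [add_right_comm]
  rw [← hc, zsmul_eq_mul]
  push_cast
  rw [show ((-1 : ℂ) ^ m * ((-1) ^ (m - k) * (m.choose k : ℂ) * (1 / ((n : ℂ) + (k • 1 : ℕ) + 1)))) =
    ((-1 : ℂ) ^ m * (-1) ^ (m - k)) * (m.choose k : ℂ) * (1 / ((n : ℂ) + (k • 1 : ℕ) + 1)) by ring, h6]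
  simp only [smul_eq_mul, mul_one]
  rw [add_right_comm (n : ℂ) k 1]
  field_simp

lemma aux_summ1 (n : ℕ) (w : ℂ) :
    Summable (fun k : ℕ => ‖(1 / ((k + n + 1).factorial : ℂ)) * w ^ k‖) := by
  refine Summable.of_nonneg_of_le (fun _ => norm_nonneg _) (fun k => ?_)
    (Real.summable_pow_div_factorial ‖w‖)
  rw [norm_mul, norm_div, norm_pow, norm_one, Complex.norm_natCast, div_mul_eq_mul_div, one_mul]
  have : k.factorial ≤ (k + n + 1).factorial := Nat.factorial_le (by omega)
  gcongr

lemma aux_summ2 (n : ℕ) (w : ℂ) :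
    Summable (fun k : ℕ => ‖(-w) ^ k / ((k.factorial : ℂ) * (n + 1 + k))‖) := by
  refine Summable.of_nonneg_of_le (fun _ => norm_nonneg _) (fun k => ?_)
    (Real.summable_pow_div_factorial ‖w‖)
  have : ((n : ℂ) + 1 + k) = ((n + 1 + k : ℕ) : ℂ) := by push_cast; ring
  rw [this, norm_div, norm_mul, norm_pow, norm_neg, Complex.norm_natCast, Complex.norm_natCast]
  have h1 : (1 : ℝ) ≤ ((n + 1 + k : ℕ) : ℝ) := by exact_mod_cast (by omega)
  gcongr
  exact le_mul_of_one_le_right (by positivity) h1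

lemma aux_exp_hasSum (w : ℂ) : HasSum (fun k : ℕ => w ^ k / (k.factorial : ℂ)) (Complex.exp w) := by
  rw [Complex.exp_eq_exp_ℂ]
  exact NormedSpace.expSeries_div_hasSum_exp w

lemma aux_exp_summ (w : ℂ) : Summable (fun k : ℕ => ‖w ^ k / (k.factorial : ℂ)‖) :=
  NormedSpace.norm_expSeries_div_summable w

lemma aux_kummer (n : ℕ) (w : ℂ) :
    ∑' k : ℕ, (-w) ^ k / ((k.factorial : ℂ) * (n + 1 + k)) =
      (n.factorial : ℂ) * Complex.exp (-w) *
        ∑' k : ℕ, (1 / ((k + n + 1).factorial : ℂ)) * w ^ k := by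
  have h := tsum_mul_tsum_eq_tsum_sum_range_of_summable_norm (aux_summ2 n w) (aux_exp_summ w)
  rw [(aux_exp_hasSum w).tsum_eq] at h
  have h2 : ∀ m : ℕ, ∑ k ∈ Finset.range (m + 1), (-w) ^ k / ((k.factorial : ℂ) * (n + 1 + k)) *
      (w ^ (m - k) / ((m - k).factorial : ℂ)) =
      (n.factorial : ℂ) * ((1 / ((m + n + 1).factorial : ℂ)) * w ^ m) := by
    intro m
    have := aux_fin m n
    rw [show (n.factorial : ℂ) * ((1 / ((m + n + 1).factorial : ℂ)) * w ^ m) =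
      ((n.factorial : ℂ) / ((m + n + 1).factorial : ℂ)) * w ^ m by ring, ← this, Finset.sum_mul]
    refine Finset.sum_congr rfl fun k hk => ?_
    have hk' : k ≤ m := Nat.lt_succ_iff.mp (Finset.mem_range.mp hk)
    have : w ^ m = w ^ k * w ^ (m - k) := by rw [← pow_add]; congr 1; omega
    rw [this, neg_pow]
    ring
  simp_rw [h2] at h
  rw [tsum_mul_left] at h
  have h3 : Complex.exp w * Complex.exp (-w) = 1 := by rw [← Complex.exp_add]; simp
  calc _ = (∑' k : ℕ, (-w) ^ k / ((k.factorial : ℂ) * (n + 1 + k))) *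
        (Complex.exp w * Complex.exp (-w)) := by rw [h3, mul_one]
    _ = _ := by rw [← mul_assoc, h]; ring

/-- The integrable factor. -/
noncomputable def auxG (n : ℕ) (ξ : ℂ) : ℂ :=
  ((starRingEnd ℂ) ξ) ^ n / ξ * Complex.exp (-(Complex.normSq ξ : ℂ))

lemma aux_norm_G (n : ℕ) (ξ : ℂ) : ‖auxG n ξ‖ = ‖ξ‖ ^ n / ‖ξ‖ * Real.exp (-‖ξ‖ ^ 2) := by
  unfold auxG
  rw [norm_mul, norm_div, norm_pow, RCLike.norm_conj, Complex.norm_exp]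
  congr 2
  rw [Complex.normSq_eq_norm_sq, ← Complex.ofReal_neg, Complex.ofReal_re]

lemma aux_meas_G (n : ℕ) : Measurable (auxG n) := by
  unfold auxG
  have h1 : Measurable (fun ξ : ℂ => (starRingEnd ℂ) ξ) := Complex.continuous_conj.measurable
  have h2 : Measurable (fun ξ : ℂ => (Complex.normSq ξ : ℂ)) :=
    (Complex.continuous_ofReal.comp Complex.continuous_normSq).measurable
  exact ((h1.pow_const n).div measurable_id).mul (Complex.measurable_exp.comp h2.neg)

lemma aux_integrable (n : ℕ) (c : ℝ) :
    Integrable (fun ξ : ℂ => ‖auxG n ξ‖ * Real.exp (c * ‖ξ‖)) := by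
  have hq : (-2 : ℝ) < (n : ℝ) - 1 := by have : (0 : ℝ) ≤ n := n.cast_nonneg; linarith
  have hI := Complex.integral_rpow_mul_exp_neg_mul_rpow (p := 2) (q := (n : ℝ) - 1) (b := 1 / 2)
    (by norm_num) hq (by norm_num)
  have hJ : Integrable (fun ξ : ℂ => ‖ξ‖ ^ ((n : ℝ) - 1) * Real.exp (-(1 / 2) * ‖ξ‖ ^ (2 : ℝ))) := by
    apply Integrable.of_integral_ne_zero
    rw [hI]
    have : 0 < Real.Gamma (((n : ℝ) - 1 + 2) / 2) := Real.Gamma_pos_of_pos (by linarith)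
    positivity
  refine (hJ.const_mul (Real.exp (c ^ 2 / 2))).mono' ?_ ?_
  · exact ((aux_meas_G n).norm.mul
      (Real.measurable_exp.comp (measurable_norm.const_mul c))).aestronglyMeasurable
  · filter_upwards [Measure.ae_ne volume (0 : ℂ)] with ξ hξ
    have hpos : 0 < ‖ξ‖ := norm_pos_iff.mpr hξ
    rw [Real.norm_of_nonneg (by positivity), aux_norm_G, Real.rpow_sub_one hpos.ne',
      Real.rpow_natCast, Real.rpow_two, mul_assoc, ← Real.exp_add, mul_left_comm, ← Real.exp_add]
    refine mul_le_mul_of_nonneg_left (Real.exp_le_exp.mpr ?_) (by positivity)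
    nlinarith [sq_nonneg (‖ξ‖ - c)]

lemma aux_rot (n a b : ℕ) (h : a ≠ n + 1 + b) :
    ∫ ξ : ℂ, auxG n ξ * (ξ ^ a * ((starRingEnd ℂ) ξ) ^ b) = 0 := by
  set θ : ℝ := Real.pi / ((a : ℝ) - (n + 1 + b)) with hθ
  have hd : ((a : ℝ) - (n + 1 + b)) ≠ 0 := by
    intro h0; apply h
    have : (a : ℝ) = ((n + 1 + b : ℕ) : ℝ) := by push_cast; linarith
    exact_mod_cast this
  set u : Circle := Circle.exp θ with hu
  have hint := ((rotation u).measurePreserving).integral_comp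
    (rotation u).toHomeomorph.measurableEmbedding
    (fun ξ : ℂ => auxG n ξ * (ξ ^ a * ((starRingEnd ℂ) ξ) ^ b))
  have hun : (u : ℂ) * (starRingEnd ℂ) (u : ℂ) = 1 := by
    rw [Complex.mul_conj]; simp
  have hu0 : (u : ℂ) ≠ 0 := u.coe_ne_zero
  have hns : Complex.normSq (u : ℂ) = 1 := by simp
  have huc : (starRingEnd ℂ) (u : ℂ) = (u : ℂ)⁻¹ := (eq_inv_of_mul_eq_one_right hun)
  have hk : (u : ℂ) ^ a * ((u : ℂ)⁻¹) ^ (n + 1 + b) = -1 := by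
    rw [hu, Circle.coe_exp, ← Complex.exp_neg, ← Complex.exp_nat_mul, ← Complex.exp_nat_mul,
      ← Complex.exp_add, ← Complex.exp_pi_mul_I]
    congr 1
    have : ((a : ℂ) - (n + 1 + b)) * θ = Real.pi := by
      have : ((a : ℝ) - (n + 1 + b)) * θ = Real.pi := by rw [hθ]; field_simp
      exact_mod_cast this
    rw [← this]; push_cast; ring
  have hf : ∀ ξ : ℂ, auxG n (rotation u ξ) *
      ((rotation u ξ) ^ a * ((starRingEnd ℂ) (rotation u ξ)) ^ b) =
      -1 * (auxG n ξ * (ξ ^ a * ((starRingEnd ℂ) ξ) ^ b)) := by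
    intro ξ
    rw [← hk, rotation_apply]
    unfold auxG
    rw [map_mul, Complex.normSq_mul, hns, one_mul, huc, div_eq_mul_inv, div_eq_mul_inv, mul_inv]
    ring
  simp_rw [hf] at hint
  rw [integral_const_mul] at hint
  linear_combination (-1 / 2 : ℂ) * hint

lemma aux_diag (n b : ℕ) :
    ∫ ξ : ℂ, auxG n ξ * (ξ ^ (n + 1 + b) * ((starRingEnd ℂ) ξ) ^ b) =
      Real.pi * ((n + b).factorial : ℂ) := by
  have hI := Complex.integral_rpow_mul_exp_neg_rpow (p := 2) (q := ((2 * (n + b) : ℕ) : ℝ))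
    (by norm_num) (by have : (0 : ℝ) ≤ ((2 * (n + b) : ℕ) : ℝ) := Nat.cast_nonneg _
                      linarith)
  have e : (((2 * (n + b) : ℕ) : ℝ) + 2) / 2 = ((n + b : ℕ) : ℝ) + 1 := by push_cast; ring
  rw [e, Real.Gamma_nat_eq_factorial] at hI
  have hI2 : ((∫ x : ℂ, ‖x‖ ^ (((2 * (n + b) : ℕ) : ℝ)) * Real.exp (-‖x‖ ^ (2 : ℝ)) : ℝ) : ℂ) =
      Real.pi * ((n + b).factorial : ℂ) := by
    rw [hI]; push_cast; ring
  rw [← hI2, ← integral_complex_ofReal]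
  apply integral_congr_ae
  filter_upwards [Measure.ae_ne volume (0 : ℂ)] with ξ hξ
  rw [Real.rpow_natCast, Real.rpow_two]
  unfold auxG
  push_cast
  have h1 : ξ * (starRingEnd ℂ) ξ = (‖ξ‖ : ℂ) ^ 2 := Complex.mul_conj' ξ
  rw [Complex.normSq_eq_norm_sq, pow_mul, ← h1]
  push_cast
  rw [← h1]
  field_simp
  ring

lemma aux_main (n : ℕ) (M N : ℂ) :
    HasSum (fun b : ℕ => M ^ (n + 1 + b) / ((n + 1 + b).factorial : ℂ) *
        (N ^ b / (b.factorial : ℂ)) * (Real.pi * ((n + b).factorial : ℂ)))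
      (∫ ξ : ℂ, auxG n ξ * (Complex.exp (M * ξ) * Complex.exp (N * (starRingEnd ℂ) ξ))) := by
  set F : ℕ × ℕ → ℂ → ℂ := fun p ξ => auxG n ξ *
    ((M * ξ) ^ p.1 / (p.1.factorial : ℂ) * ((N * (starRingEnd ℂ) ξ) ^ p.2 / (p.2.factorial : ℂ)))
    with hF
  have hreal : ∀ r : ℝ, HasSum (fun k : ℕ => r ^ k / (k.factorial : ℝ)) (Real.exp r) := by
    intro r
    rw [Real.exp_eq_exp_ℝ]
    exact NormedSpace.expSeries_div_hasSum_exp r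
  have hbound : ∀ ξ : ℂ, HasSum (fun p => ‖F p ξ‖)
      (‖auxG n ξ‖ * Real.exp ((‖M‖ + ‖N‖) * ‖ξ‖)) := by
    intro ξ
    have hs := summable_mul_of_summable_norm
      (NormedSpace.norm_expSeries_div_summable (‖M‖ * ‖ξ‖))
      (NormedSpace.norm_expSeries_div_summable (‖N‖ * ‖ξ‖))
    have := ((hreal (‖M‖ * ‖ξ‖)).mul (hreal (‖N‖ * ‖ξ‖)) hs).mul_left ‖auxG n ξ‖
    rw [← Real.exp_add, ← add_mul] at this
    have e : (fun p => ‖F p ξ‖) = fun i : ℕ × ℕ => ‖auxG n ξ‖ *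
        ((‖M‖ * ‖ξ‖) ^ i.1 / (i.1.factorial : ℝ) * ((‖N‖ * ‖ξ‖) ^ i.2 / (i.2.factorial : ℝ))) := by
      funext p
      simp [hF]
    rw [e]
    exact this
  have hmeas : ∀ p, AEStronglyMeasurable (F p) volume := by
    intro p
    have h1 : Measurable (fun ξ : ℂ => (starRingEnd ℂ) ξ) := Complex.continuous_conj.measurable
    exact ((aux_meas_G n).mul ((((measurable_id.const_mul M).pow_const _).div_const _).mul
      (((h1.const_mul N).pow_const _).div_const _))).aestronglyMeasurable
  have key := hasSum_integral_of_dominated_convergence (μ := volume) (F := F)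
    (f := fun ξ : ℂ => auxG n ξ * (Complex.exp (M * ξ) * Complex.exp (N * (starRingEnd ℂ) ξ)))
    (fun p ξ => ‖F p ξ‖) hmeas (fun p => ae_of_all _ fun ξ => le_rfl)
    (ae_of_all _ fun ξ => (hbound ξ).summable)
    (by simp_rw [fun ξ => (hbound ξ).tsum_eq]; exact aux_integrable n _)
    (ae_of_all _ fun ξ => by
      have hs := summable_mul_of_summable_norm (aux_exp_summ (M * ξ))
        (aux_exp_summ (N * (starRingEnd ℂ) ξ))
      exact ((aux_exp_hasSum (M * ξ)).mul (aux_exp_hasSum (N * (starRingEnd ℂ) ξ)) hs).mul_left _)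
  have hval : ∀ p : ℕ × ℕ, ∫ ξ, F p ξ = M ^ p.1 / (p.1.factorial : ℂ) *
      (N ^ p.2 / (p.2.factorial : ℂ)) *
      ∫ ξ : ℂ, auxG n ξ * (ξ ^ p.1 * ((starRingEnd ℂ) ξ) ^ p.2) := by
    intro p
    rw [← integral_const_mul]
    congr 1
    ext ξ
    simp only [hF, mul_pow]
    ring
  have hinj : Function.Injective (fun b : ℕ => (n + 1 + b, b)) := fun x y h => (Prod.mk.inj h).2
  rw [← hinj.hasSum_iff] at key
  · have e : (fun b : ℕ => M ^ (n + 1 + b) / ((n + 1 + b).factorial : ℂ) *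
        (N ^ b / (b.factorial : ℂ)) * (Real.pi * ((n + b).factorial : ℂ))) =
        (fun p => ∫ ξ, F p ξ) ∘ fun b : ℕ => (n + 1 + b, b) := by
      funext b
      simp only [Function.comp]
      rw [hval, aux_diag]
    rw [e]
    exact key
  · rintro ⟨a, b⟩ hp
    rw [hval, aux_rot, mul_zero]
    intro h
    exact hp ⟨b, by simp at h; simp [h]⟩

/-- Power-series form of the inverse Fourier transform. -/
theorem stmt4 (n : ℕ) :
    ∀ z : ℂ,
      Summable (fun k : ℕ =>
        ‖(1 / ((k + n + 1).factorial : ℂ)) * (z * (starRingEnd ℂ) z / 4) ^ k‖) ∧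
      fourierInvT (fun ξ : ℂ =>
          ((starRingEnd ℂ) ξ) ^ n / ξ * Complex.exp (-(Complex.normSq ξ : ℂ))) z =
        Complex.I * (2 * Complex.I) ^ n * (n.factorial : ℂ) *
          Complex.exp (-(Complex.normSq z : ℂ) / 4) * ((starRingEnd ℂ) z / 4) ^ (n + 1) *
          ∑' k : ℕ, (1 / ((k + n + 1).factorial : ℂ)) * (z * (starRingEnd ℂ) z / 4) ^ k := by
  intro z
  refine ⟨aux_summ1 n _, ?_⟩
  set w : ℂ := z * (starRingEnd ℂ) z / 4 with hw
  set M : ℂ := Complex.I * (starRingEnd ℂ) z / 2 with hM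
  set N : ℂ := Complex.I * z / 2 with hN
  have hMN : M * N = -w := by
    rw [hM, hN, hw]
    linear_combination (z * (starRingEnd ℂ) z / 4) * Complex.I_mul_I
  have hexp : ∀ ξ : ℂ, Complex.exp (Complex.I * Complex.ofReal (ξ.re * z.re + ξ.im * z.im)) =
      Complex.exp (M * ξ) * Complex.exp (N * (starRingEnd ℂ) ξ) := by
    intro ξ
    rw [← Complex.exp_add]
    congr 1
    have e : (Complex.ofReal (ξ.re * z.re + ξ.im * z.im)) =
        ((starRingEnd ℂ) z * ξ + z * (starRingEnd ℂ) ξ) / 2 := by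
      apply Complex.ext <;> simp <;> ring
    rw [e, hM, hN]; ring
  have h := (aux_main n M N).tsum_eq
  have hpi : (Real.pi : ℂ) ≠ 0 := by exact_mod_cast Real.pi_ne_zero
  have h2 : ∀ b : ℕ, M ^ (n + 1 + b) / ((n + 1 + b).factorial : ℂ) *
        (N ^ b / (b.factorial : ℂ)) * (Real.pi * ((n + b).factorial : ℂ)) =
      (Real.pi * M ^ (n + 1)) * ((-w) ^ b / ((b.factorial : ℂ) * (n + 1 + b))) := by
    intro b
    rw [← hMN, show n + 1 + b = (n + b) + 1 by ring, Nat.factorial_succ]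
    have h3 : ((n + b).factorial : ℂ) ≠ 0 := by exact_mod_cast (n + b).factorial_ne_zero
    have h4 : (b.factorial : ℂ) ≠ 0 := by exact_mod_cast b.factorial_ne_zero
    have h5 : (n : ℂ) + b + 1 ≠ 0 := by exact_mod_cast (n + b).succ_ne_zero
    push_cast
    rw [add_right_comm (n : ℂ) 1 b]
    field_simp
    ring
  simp_rw [h2] at h
  rw [tsum_mul_left, aux_kummer] at h
  have hfi : fourierInvT (fun ξ : ℂ =>
      ((starRingEnd ℂ) ξ) ^ n / ξ * Complex.exp (-(Complex.normSq ξ : ℂ))) z =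
      (1 / (2 * Real.pi)) *
      ∫ ξ : ℂ, auxG n ξ * (Complex.exp (M * ξ) * Complex.exp (N * (starRingEnd ℂ) ξ)) := by
    unfold fourierInvT auxG
    simp_rw [hexp]
  rw [hfi, ← h]
  have hwe : -(Complex.normSq z : ℂ) / 4 = -w := by
    rw [hw, Complex.mul_conj]; ring
  rw [hwe]
  have hMp : M ^ (n + 1) / 2 = Complex.I * (2 * Complex.I) ^ n * ((starRingEnd ℂ) z / 4) ^ (n + 1) := by
    have : M = (2 * Complex.I) * ((starRingEnd ℂ) z / 4) := by rw [hM]; ring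
    rw [this, mul_pow]; ring
  rw [show Complex.I * (2 * Complex.I) ^ n * (n.factorial : ℂ) *
          Complex.exp (-w) * ((starRingEnd ℂ) z / 4) ^ (n + 1) =
      (Complex.I * (2 * Complex.I) ^ n * ((starRingEnd ℂ) z / 4) ^ (n + 1)) *
      ((n.factorial : ℂ) * Complex.exp (-w)) by ring, ← hMp]
  field_simp
end

section
/- Define F : ℂ ∖ {0} → ℂ by F(z) = (i/z)(1 − e^{−|z|²/4}). Then F is infinitely differentiable as a map ℝ² ∖ {0} → ℂ, and for every n ∈ ℕ and every z = x + iy ≠ 0 one has F⁻¹(ξ ↦ (ξ̄ⁿ/ξ) e^{−|ξ|²})(x,y) = (−2i)ⁿ (∂_z)ⁿ F evaluated at z, where (∂_z)ⁿ denotes the n-fold iterated Wirtinger derivative ∂_z = ½(∂ₓ − i∂_y). -/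
open Complex MeasureTheory Filter

/-- The Wirtinger derivative ∂_z f = ½(∂ₓf − i ∂_y f), as an operator on functions ℂ → ℂ
viewed as maps ℝ² → ℂ. -/
noncomputable def dz (f : ℂ → ℂ) : ℂ → ℂ :=
  fun z => (1 / 2) * (fderiv ℝ f z 1 - Complex.I * fderiv ℝ f z Complex.I)


open scoped Topology RealInnerProductSpace FourierTransform

noncomputable def gfun (n : ℕ) (ξ : ℂ) : ℂ :=
  ((starRingEnd ℂ) ξ) ^ n / ξ * Complex.exp (-(Complex.normSq ξ : ℂ))

noncomputable def Ffun (w : ℂ) : ℂ :=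
  (Complex.I / w) * (1 - Complex.exp (-(Complex.normSq w : ℂ) / 4))

noncomputable def LL : ℂ →L[ℝ] ℂ →L[ℝ] ℝ := (-(1 / (2 * Real.pi))) • innerSL ℝ

lemma LL_apply (v w : ℂ) : LL v w = -(1 / (2 * Real.pi)) * (v.re * w.re + v.im * w.im) := by
  have h : inner ℝ v w = v.re * w.re + v.im * w.im := by
    rw [Complex.inner]; simp; ring
  rw [← h]; rfl

lemma char_LL (v w a : ℂ) : Real.fourierChar (-(LL v w)) • a =
    a * Complex.exp (Complex.I * Complex.ofReal (v.re * w.re + v.im * w.im)) := by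
  rw [Circle.smul_def, Real.fourierChar_apply, LL_apply, smul_eq_mul, mul_comm]
  congr 2
  have : (Real.pi : ℂ) ≠ 0 := by exact_mod_cast Real.pi_ne_zero
  push_cast
  field_simp

lemma fI_eq (g : ℂ → ℂ) (z : ℂ) : fourierInvT g z = (1 / (2 * Real.pi)) *
    VectorFourier.fourierIntegral Real.fourierChar volume LL.toLinearMap₁₂ g z := by
  rw [fourierInvT, VectorFourier.fourierIntegral]
  congr 2
  ext v
  exact (char_LL v z (g v)).symm

lemma fI_eq' (g : ℂ → ℂ) : fourierInvT g = fun z => (1 / (2 * Real.pi) : ℂ) *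
    VectorFourier.fourierIntegral Real.fourierChar volume LL.toLinearMap₁₂ g z :=
  funext (fI_eq g)

lemma integrable_fI {g : ℂ → ℂ} (hg : Integrable g) (z : ℂ) : Integrable (fun ξ : ℂ =>
    g ξ * Complex.exp (Complex.I * Complex.ofReal (ξ.re * z.re + ξ.im * z.im))) := by
  refine hg.mul_bdd (c := 1) (by fun_prop) (ae_of_all _ fun v => ?_)
  rw [mul_comm, Complex.norm_exp_ofReal_mul_I]

lemma fI_sub_mul {g h : ℂ → ℂ} (hg : Integrable g) (hh : Integrable h) (c d z : ℂ) :
    fourierInvT (fun ξ => c * g ξ + d * h ξ) z = c * fourierInvT g z + d * fourierInvT h z := by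
  have e1 := integrable_fI hg z
  have e2 := integrable_fI hh z
  simp only [fourierInvT, add_mul, mul_assoc]
  rw [integral_add (e1.const_mul c) (e2.const_mul d), integral_const_mul, integral_const_mul]
  ring

lemma fI_hasFDerivAt {g : ℂ → ℂ} (hg : Integrable g) (hg' : Integrable (fun ξ => ξ * g ξ))
    (z : ℂ) : HasFDerivAt (fourierInvT g) ((1 / (2 * Real.pi) : ℂ) •
      VectorFourier.fourierIntegral Real.fourierChar volume LL.toLinearMap₁₂
        (VectorFourier.fourierSMulRight LL g) z) z := by
  rw [fI_eq']
  have := VectorFourier.hasFDerivAt_fourierIntegral LL hg (by simpa using hg'.norm) z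
  exact this.const_mul _

lemma fI_fderiv {g : ℂ → ℂ} (hg : Integrable g) (hg' : Integrable (fun ξ => ξ * g ξ))
    (z u : ℂ) : fderiv ℝ (fourierInvT g) z u =
      fourierInvT (fun ξ => Complex.I * (ξ.re * u.re + ξ.im * u.im : ℝ) * g ξ) z := by
  rw [(fI_hasFDerivAt hg hg' z).fderiv, fI_eq]
  simp only [smul_apply, smul_eq_mul]
  congr 1
  have hint : Integrable (VectorFourier.fourierSMulRight LL g) := by
    refine ((hg'.norm.const_mul (2 * Real.pi * ‖LL‖))).mono'
      hg.1.fourierSMulRight (ae_of_all _ fun v => ?_)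
    have := VectorFourier.norm_fourierSMulRight_le LL g v
    simpa [mul_assoc] using this
  have hint2 := (VectorFourier.fourierIntegral_convergent_iff Real.continuous_fourierChar
    (L := LL.toLinearMap₁₂) (μ := volume) (by exact LL.continuous₂) z).2 hint
  rw [VectorFourier.fourierIntegral, ContinuousLinearMap.integral_apply hint2]
  rw [VectorFourier.fourierIntegral]
  congr 1
  ext v
  have hpi : (Real.pi : ℂ) ≠ 0 := by exact_mod_cast Real.pi_ne_zero
  change Real.fourierChar (-(LL v z)) • (VectorFourier.fourierSMulRight LL g v u) = _
  congr 1
  rw [VectorFourier.fourierSMulRight_apply, LL_apply]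
  simp only [smul_eq_mul, Complex.real_smul]
  push_cast
  field_simp

lemma re_int {g : ℂ → ℂ} (hg : Integrable g) (hg' : Integrable (fun ξ => ξ * g ξ)) :
    Integrable (fun ξ : ℂ => (ξ.re : ℂ) * g ξ) := by
  refine hg'.norm.mono' (by have := hg.1; fun_prop) (ae_of_all _ fun v => ?_)
  rw [norm_mul, norm_mul, Complex.norm_real]
  gcongr
  exact Complex.abs_re_le_norm v

lemma im_int {g : ℂ → ℂ} (hg : Integrable g) (hg' : Integrable (fun ξ => ξ * g ξ)) :
    Integrable (fun ξ : ℂ => (ξ.im : ℂ) * g ξ) := by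
  refine hg'.norm.mono' (by have := hg.1; fun_prop) (ae_of_all _ fun v => ?_)
  rw [norm_mul, norm_mul, Complex.norm_real]
  gcongr
  exact Complex.abs_im_le_norm v

lemma fI_comb {g : ℂ → ℂ} (hg : Integrable g) (hg' : Integrable (fun ξ => ξ * g ξ))
    (c d z : ℂ) : c * fderiv ℝ (fourierInvT g) z 1 + d * fderiv ℝ (fourierInvT g) z Complex.I
      = fourierInvT (fun ξ => Complex.I * (c * ξ.re + d * ξ.im) * g ξ) z := by
  have h1 : fderiv ℝ (fourierInvT g) z 1
      = Complex.I * fourierInvT (fun ξ => ξ.re * g ξ) z := by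
    rw [fI_fderiv hg hg']
    have := fI_sub_mul (re_int hg hg') (re_int hg hg') Complex.I 0 z
    simp only [zero_mul, add_zero] at this
    rw [← this]; simp [mul_assoc]
  have h2 : fderiv ℝ (fourierInvT g) z Complex.I
      = Complex.I * fourierInvT (fun ξ => ξ.im * g ξ) z := by
    rw [fI_fderiv hg hg']
    have := fI_sub_mul (im_int hg hg') (re_int hg hg') Complex.I 0 z
    simp only [zero_mul, add_zero] at this
    rw [← this]; simp [mul_assoc]
  rw [h1, h2, ← mul_assoc, ← mul_assoc, ← fI_sub_mul (re_int hg hg') (im_int hg hg')]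
  congr 1
  ext v
  ring

lemma norm_gfun (n : ℕ) (ξ : ℂ) : ‖gfun n ξ‖ = ‖ξ‖ ^ n / ‖ξ‖ * Real.exp (-‖ξ‖ ^ 2) := by
  rw [gfun, norm_mul, norm_div, norm_pow, RCLike.norm_conj, Complex.norm_exp,
    Complex.normSq_eq_norm_sq]
  congr 2

lemma gfun_meas (n : ℕ) : Measurable (gfun n) := by
  unfold gfun
  have : Measurable (fun ξ : ℂ => Complex.normSq ξ) := Complex.continuous_normSq.measurable
  have h2 : Measurable (fun ξ : ℂ => (starRingEnd ℂ) ξ) := Complex.continuous_conj.measurable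
  fun_prop

lemma gfun_int (n : ℕ) : Integrable (gfun n) := by
  rw [← integrable_norm_iff (gfun_meas n).aestronglyMeasurable]
  simp only [norm_gfun]
  rw [integrable_fun_norm_addHaar volume
    (f := fun y : ℝ => y ^ n / y * Real.exp (-y ^ 2))]
  have := integrableOn_rpow_mul_exp_neg_rpow (p := 2) (s := n) (by
    have : (0 : ℝ) ≤ n := Nat.cast_nonneg n
    linarith) (by norm_num)
  refine this.congr_fun (fun y hy => ?_) measurableSet_Ioi
  have hy : y ≠ 0 := ne_of_gt hy
  simp [Complex.finrank_real_complex]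
  field_simp

lemma gfun_int' (n : ℕ) : Integrable (fun ξ => ξ * gfun n ξ) := by
  refine (gfun_int (n + 1)).norm.mono' (measurable_id.mul (gfun_meas n)).aestronglyMeasurable
    (ae_of_all _ fun v => ?_)
  rw [norm_mul, norm_gfun, norm_gfun]
  apply le_of_eq
  ring

lemma dz_fI (n : ℕ) (z : ℂ) : dz (fourierInvT (gfun n)) z =
    (Complex.I / 2) * fourierInvT (gfun (n + 1)) z := by
  have h := fI_comb (gfun_int n) (gfun_int' n) (1 / 2) (-Complex.I / 2) z
  have h2 := fI_sub_mul (gfun_int (n + 1)) (gfun_int (n + 1)) (Complex.I / 2) 0 z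
  simp only [zero_mul, add_zero] at h2
  rw [← h2, dz]
  trans
  swap
  · trans
    · exact h
    · congr 1
      ext v
      have : (starRingEnd ℂ) v = v.re - v.im * Complex.I := by
        apply Complex.ext <;> simp
      simp only [gfun, pow_succ]
      have h3 : (1 / 2 * (v.re : ℂ) + -Complex.I / 2 * v.im) = (starRingEnd ℂ) v / 2 := by
        rw [this]; ring
      rw [h3]; ring
  · ring

lemma dbar_fI (z : ℂ) : fderiv ℝ (fourierInvT (gfun 0)) z Complex.I
    - Complex.I * fderiv ℝ (fourierInvT (gfun 0)) z 1 =
    Complex.exp (-(Complex.normSq z : ℂ) / 4) / 2 := by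
  have h := fI_comb (gfun_int 0) (gfun_int' 0) (-Complex.I) 1 z
  have h0 : fderiv ℝ (fourierInvT (gfun 0)) z Complex.I
    - Complex.I * fderiv ℝ (fourierInvT (gfun 0)) z 1 =
    -Complex.I * fderiv ℝ (fourierInvT (gfun 0)) z 1
      + 1 * fderiv ℝ (fourierInvT (gfun 0)) z Complex.I := by ring
  rw [h0, h, fourierInvT]
  have hG := GaussianFourier.integral_cexp_neg_mul_sq_norm_add (b := 1) (by simp) Complex.I z
  have hae : (fun ξ : ℂ => Complex.I * (-Complex.I * ξ.re + 1 * ξ.im) * gfun 0 ξ *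
      Complex.exp (Complex.I * Complex.ofReal (ξ.re * z.re + ξ.im * z.im))) =ᵐ[volume]
      (fun v : ℂ => Complex.exp (-1 * ‖v‖ ^ 2 + Complex.I * (inner ℝ z v : ℝ))) := by
    have : ∀ᵐ v : ℂ, v ≠ 0 := by
      simp [ae_iff]
    filter_upwards [this] with v hv
    have h1 : Complex.I * (-Complex.I * v.re + 1 * v.im) = v := by
      conv_rhs => rw [← Complex.re_add_im v]
      linear_combination (-(v.re : ℂ)) * Complex.I_sq
    have h2 : inner ℝ z v = v.re * z.re + v.im * z.im := by
      rw [Complex.inner]; simp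
    rw [h1, h2, gfun, Complex.exp_add, Complex.normSq_eq_norm_sq]
    field_simp
    push_cast
    simp
  rw [integral_congr_ae hae, hG]
  have hpi : (Real.pi : ℂ) ≠ 0 := by exact_mod_cast Real.pi_ne_zero
  simp [Complex.finrank_real_complex, Complex.normSq_eq_norm_sq]
  field_simp

lemma Ffun_hasFDerivAt {z : ℂ} (hz : z ≠ 0) : ∃ L : ℂ →L[ℝ] ℂ, HasFDerivAt Ffun L z ∧
    L Complex.I - Complex.I * L 1 = Complex.exp (-(Complex.normSq z : ℂ) / 4) / 2 := by
  have h1 : HasFDerivAt (fun w : ℂ => Complex.I / w) _ z :=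
    (((hasDerivAt_inv hz).const_mul Complex.I).hasFDerivAt).restrictScalars ℝ
  have hre : HasFDerivAt (fun w : ℂ => w.re) Complex.reCLM z := Complex.reCLM.hasFDerivAt
  have him : HasFDerivAt (fun w : ℂ => w.im) Complex.imCLM z := Complex.imCLM.hasFDerivAt
  have hn := (hre.mul hre).add (him.mul him)
  have hn2 := (Complex.ofRealCLM.hasFDerivAt (x := z.re * z.re + z.im * z.im)).comp z hn
  have he := (((hn2.neg.mul_const (4 : ℂ)⁻¹).cexp).const_sub 1)
  have hF := h1.mul he
  refine ⟨_, hF.congr_of_eventuallyEq (Eventually.of_forall fun w => ?_), ?_⟩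
  · simp [Ffun, Complex.normSq_apply, div_eq_mul_inv]
  · have hzz : (z.re : ℂ) + z.im * Complex.I = z := Complex.re_add_im z
    simp [Complex.normSq_apply]
    have hk : z⁻¹ * ((z.re : ℂ) + z.im * Complex.I) = 1 := by
      rw [hzz]; exact inv_mul_cancel₀ hz
    simp only [div_eq_mul_inv]
    generalize Complex.exp _ = e
    linear_combination e / 2 * hk - z⁻¹ * e * z.re / 2 * Complex.I_sq

lemma Ffun_bound (z : ℂ) : ‖Ffun z‖ ≤ ‖z‖ / 4 ∧ ‖Ffun z‖ ≤ ‖z‖⁻¹ := by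
  have h1 : ‖Ffun z‖ = ‖z‖⁻¹ * (1 - Real.exp (-‖z‖ ^ 2 / 4)) := by
    have h2 : (1 - Complex.exp (-(Complex.normSq z : ℂ) / 4)) =
        ((1 - Real.exp (-‖z‖ ^ 2 / 4) : ℝ) : ℂ) := by
      rw [Complex.normSq_eq_norm_sq]; push_cast; rfl
    rw [Ffun, h2, norm_mul, norm_div, Complex.norm_I, one_div, Complex.norm_real,
      Real.norm_of_nonneg]
    have : Real.exp (-‖z‖ ^ 2 / 4) ≤ 1 := Real.exp_le_one_iff.2 (by
      have := sq_nonneg ‖z‖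
      linarith)
    linarith
  have h3 := Real.add_one_le_exp (-‖z‖ ^ 2 / 4)
  have h4 := Real.exp_pos (-‖z‖ ^ 2 / 4)
  have h5 : 0 ≤ ‖z‖⁻¹ := by positivity
  rw [h1]
  constructor
  · calc ‖z‖⁻¹ * (1 - Real.exp (-‖z‖ ^ 2 / 4)) ≤ ‖z‖⁻¹ * (‖z‖ ^ 2 / 4) := by
          gcongr; linarith
      _ = ‖z‖ / 4 := by
          by_cases h : ‖z‖ = 0
          · simp [h]
          · field_simp
  · nlinarith

lemma fI_zero (z : ℂ) : fourierInvT (gfun 0) z = Ffun z := by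
  have hG : ∀ z, DifferentiableAt ℝ (fourierInvT (gfun 0)) z := fun z =>
    (fI_hasFDerivAt (gfun_int 0) (gfun_int' 0) z).differentiableAt
  have hd : Differentiable ℂ (fun z => fourierInvT (gfun 0) z - Ffun z) := by
    rw [← differentiableOn_univ]
    rw [← Complex.differentiableOn_compl_singleton_and_continuousAt_iff (c := 0) univ_mem]
    constructor
    · intro w hw
      apply DifferentiableAt.differentiableWithinAt
      obtain ⟨L, hL, hL2⟩ := Ffun_hasFDerivAt (z := w) (by simpa using hw)
      have hs := (hG w).hasFDerivAt.sub hL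
      rw [differentiableAt_complex_iff_differentiableAt_real]
      refine ⟨hs.differentiableAt, ?_⟩
      erw [hs.fderiv]
      have h3 := dbar_fI w
      simp only [sub_apply, smul_eq_mul]
      linear_combination h3 - hL2
    · refine (hG 0).continuousAt.sub ?_
      have h0 : Ffun 0 = 0 := by simp [Ffun]
      rw [ContinuousAt, h0]
      apply squeeze_zero_norm (fun w => (Ffun_bound w).1)
      have : Continuous (fun w : ℂ => ‖w‖ / 4) := by fun_prop
      simpa using this.tendsto 0
  have ht : Tendsto (fun z => fourierInvT (gfun 0) z - Ffun z) (cocompact ℂ) (𝓝 0) := by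
    rw [← sub_zero (0 : ℂ)]
    apply Tendsto.sub
    · have h1 := tendsto_integral_exp_inner_smul_cocompact (gfun 0)
      let e : ℂ ≃ₜ ℂ := Homeomorph.mulRight₀ (-(1 / (2 * Real.pi)) : ℂ) (by
        have : (Real.pi : ℂ) ≠ 0 := by exact_mod_cast Real.pi_ne_zero
        simp [this])
      have h2 := (h1.comp e.isClosedEmbedding.tendsto_cocompact).const_mul
        (1 / (2 * Real.pi) : ℂ)
      rw [mul_zero] at h2
      refine h2.congr fun z => ?_
      rw [fI_eq, VectorFourier.fourierIntegral]
      refine congrArg (fun t => (1 / (2 * Real.pi) : ℂ) * t)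
        (integral_congr_ae (ae_of_all _ fun v => ?_))
      have : inner ℝ v (e z) = LL v z := by
        rw [LL_apply, Complex.inner]
        have : e z = ((-(1 / (2 * Real.pi)) : ℝ) : ℂ) * z := by
          simp [e, mul_comm]
        rw [this]
        generalize -(1 / (2 * Real.pi)) = c
        simp; ring
      simp only [this]; rfl
    · apply squeeze_zero_norm (fun w => (Ffun_bound w).2)
      exact tendsto_inv_atTop_zero.comp (tendsto_norm_cocompact_atTop)
  have := hd.apply_eq_of_tendsto_cocompact z ht
  exact sub_eq_zero.1 this

lemma main_n (n : ℕ) : ∀ z : ℂ, z ≠ 0 →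
    fourierInvT (gfun n) z = (-2 * Complex.I) ^ n * (dz^[n] Ffun) z := by
  induction n with
  | zero => intro z _; simpa using fI_zero z
  | succ n ih =>
    intro z hz
    have hc : (-2 * Complex.I) ≠ 0 := by simp
    have hev : dz^[n] Ffun =ᶠ[𝓝 z] fun w => ((-2 * Complex.I) ^ n)⁻¹ * fourierInvT (gfun n) w := by
      filter_upwards [isOpen_ne.mem_nhds hz] with w hw
      rw [ih w hw]
      field_simp
    rw [Function.iterate_succ_apply', dz, hev.fderiv_eq]
    have hG := (fI_hasFDerivAt (gfun_int n) (gfun_int' n) z).differentiableAt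
    rw [fderiv_const_mul hG]
    have h := dz_fI n z
    rw [dz] at h
    simp only [smul_apply, smul_eq_mul]
    have hk : ((-2 * Complex.I) ^ n) * ((-2 * Complex.I) ^ n)⁻¹ = 1 :=
      mul_inv_cancel₀ (pow_ne_zero _ hc)
    rw [pow_succ]
    linear_combination (2 * Complex.I) * h * (((-2 * Complex.I) ^ n) * ((-2 * Complex.I) ^ n)⁻¹)
      + fourierInvT (gfun (n + 1)) z * (((-2 * Complex.I) ^ n) * ((-2 * Complex.I) ^ n)⁻¹) * Complex.I_sq - fourierInvT (gfun (n + 1)) z * hk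

/-- With F(z) = (i/z)(1 − e^{−|z|²/4}), the function F is smooth away from the origin and
F⁻¹(ξ̄ⁿ e^{−|ξ|²}/ξ)(z) = (−2i)ⁿ (∂_z)ⁿ F(z) for every n and every z ≠ 0. -/
theorem stmt5 :
    ContDiffOn ℝ (⊤ : ℕ∞)
      (fun z : ℂ => (Complex.I / z) * (1 - Complex.exp (-(Complex.normSq z : ℂ) / 4)))
      {(0 : ℂ)}ᶜ ∧
    ∀ n : ℕ, ∀ z : ℂ, z ≠ 0 →
      fourierInvT (fun ξ : ℂ =>
          ((starRingEnd ℂ) ξ) ^ n / ξ * Complex.exp (-(Complex.normSq ξ : ℂ))) z =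
        (-2 * Complex.I) ^ n *
          (dz^[n] (fun w : ℂ =>
            (Complex.I / w) * (1 - Complex.exp (-(Complex.normSq w : ℂ) / 4)))) z := by
  refine ⟨?_, fun n z hz => main_n n z hz⟩
  have hn : ContDiff ℝ (⊤ : ℕ∞) (fun z : ℂ => (Complex.normSq z : ℂ)) := by
    have : (fun z : ℂ => (Complex.normSq z : ℂ)) =
        fun z => Complex.ofRealCLM (Complex.reCLM z * Complex.reCLM z
          + Complex.imCLM z * Complex.imCLM z) := by
      ext z; simp [Complex.normSq_apply]
    rw [this]
    fun_prop
  have he : ContDiff ℝ (⊤ : ℕ∞)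
      (fun z : ℂ => 1 - Complex.exp (-(Complex.normSq z : ℂ) / 4)) :=
    contDiff_const.sub ((hn.neg.div_const 4).cexp)
  have hi : ContDiffOn ℝ (⊤ : ℕ∞) (fun z : ℂ => Complex.I / z) {(0 : ℂ)}ᶜ := by
    simp only [div_eq_mul_inv]
    exact contDiffOn_const.mul (contDiffOn_id.inv fun x hx => hx)
  exact hi.mul he.contDiffOn
end

section
/- Define G : ℂ ∖ {0} → ℂ by G(z) = (1/z)(1 − e^{−|z|²/4}). Then for every n ∈ ℕ and every z ≠ 0, the n-fold iterated Wirtinger derivative of G satisfies (∂_z)ⁿ G(z) = ((−1)ⁿ n! / z^{n+1}) [ 1 − e^{−|z|²/4} Σ_{k=0}^{n} (1/k!) (z z̄ / 4)^k ], where z̄ denotes the complex conjugate of z and |z|² = z z̄. -/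
open Complex Filter

/-- The derivative of `1 - e^{-s} S_n(s)` telescopes. -/
lemma hasDerivAt_phi (n : ℕ) (s : ℂ) :
    HasDerivAt (fun s : ℂ => 1 - Complex.exp (-s) *
      ∑ k ∈ Finset.range (n + 1), (1 / (k.factorial : ℂ)) * s ^ k)
      (Complex.exp (-s) * s ^ n / (n.factorial : ℂ)) s := by
  have he : HasDerivAt (fun s : ℂ => Complex.exp (-s)) (Complex.exp (-s) * (-1)) s :=
    (hasDerivAt_id s).neg.cexp
  induction n with
  | zero =>
    have := he.const_sub 1
    simpa using this
  | succ n ih =>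
    have h2 := ih.sub (he.mul ((hasDerivAt_pow (n + 1) s).const_mul
      (1 / ((n + 1).factorial : ℂ))))
    have hn : (n.factorial : ℂ) ≠ 0 := by exact_mod_cast n.factorial_ne_zero
    have hn1 : (n : ℂ) + 1 ≠ 0 := by exact_mod_cast n.succ_ne_zero
    refine (h2.congr_deriv ?_).congr_of_eventuallyEq (Eventually.of_forall fun w => ?_)
    · rw [Nat.factorial_succ]
      push_cast
      field_simp
      ring
    · simp only [Finset.sum_range_succ _ (n + 1), Pi.sub_apply, Pi.mul_apply]
      ring

lemma dz_of_hasFDerivAt {f : ℂ → ℂ} {L : ℂ →L[ℝ] ℂ} {z : ℂ} (h : HasFDerivAt f L z) :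
    dz f z = (1 / 2) * (L 1 - Complex.I * L Complex.I) := by
  simp only [dz, h.fderiv]

lemma dz_step (n : ℕ) (c z : ℂ) (hz : z ≠ 0) (φ : ℂ → ℂ) (φ' : ℂ)
    (hφ : HasDerivAt φ φ' (z * (starRingEnd ℂ) z / 4)) :
    dz (fun w => c / w ^ (n + 1) * φ (w * (starRingEnd ℂ) w / 4)) z =
      c * (-(n + 1) / z ^ (n + 2) * φ (z * (starRingEnd ℂ) z / 4)
        + 1 / z ^ (n + 1) * (φ' * ((starRingEnd ℂ) z / 4))) := by
  have hp : HasDerivAt (fun w : ℂ => c / w ^ (n + 1)) (c * (-(n + 1) / z ^ (n + 2))) z := by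
    have h := ((hasDerivAt_pow (n + 1) z).fun_inv (pow_ne_zero _ hz)).const_mul c
    refine (h.congr_deriv ?_)
    push_cast
    field_simp
    ring
  have hc : HasFDerivAt (fun w : ℂ => (starRingEnd ℂ) w) (Complex.conjCLE : ℂ →L[ℝ] ℂ) z :=
    Complex.conjCLE.hasFDerivAt
  have hu := ((hasFDerivAt_id (𝕜 := ℝ) z).mul hc).mul_const (1 / 4 : ℂ)
  have hu' : HasFDerivAt (fun w : ℂ => w * (starRingEnd ℂ) w / 4) _ z :=
    hu.congr_of_eventuallyEq (Eventually.of_forall fun w => by simp [div_eq_mul_inv])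
  have hφu := (hφ.hasFDerivAt.restrictScalars ℝ).comp z hu'
  have hall := (hp.hasFDerivAt.restrictScalars ℝ).mul hφu
  have h3 := dz_of_hasFDerivAt hall
  refine Eq.trans h3 ?_
  simp
  ring_nf
  simp only [Complex.I_sq]
  ring

/-- With G(z) = (1/z)(1 − e^{−|z|²/4}), the iterated Wirtinger derivatives are
(∂_z)ⁿ G(z) = ((−1)ⁿ n!/z^{n+1}) [1 − e^{−|z|²/4} Σ_{k=0}^{n} (zz̄/4)^k/k!] for z ≠ 0. -/
theorem stmt6 (n : ℕ) (z : ℂ) (hz : z ≠ 0) :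
    (dz^[n] (fun w : ℂ => (1 / w) * (1 - Complex.exp (-(Complex.normSq w : ℂ) / 4)))) z =
      ((-1 : ℂ) ^ n * (n.factorial : ℂ) / z ^ (n + 1)) *
        (1 - Complex.exp (-(Complex.normSq z : ℂ) / 4) *
          ∑ k ∈ Finset.range (n + 1),
            (1 / (k.factorial : ℂ)) * (z * (starRingEnd ℂ) z / 4) ^ k) := by
  induction n generalizing z with
  | zero => simp [Complex.mul_conj, neg_div]
  | succ n ih =>
    rw [Function.iterate_succ_apply']
    have hev : (dz^[n] (fun w : ℂ => (1 / w) *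
        (1 - Complex.exp (-(Complex.normSq w : ℂ) / 4)))) =ᶠ[nhds z]
        (fun w => ((-1 : ℂ) ^ n * (n.factorial : ℂ)) / w ^ (n + 1) *
          (fun s : ℂ => 1 - Complex.exp (-s) *
            ∑ k ∈ Finset.range (n + 1), (1 / (k.factorial : ℂ)) * s ^ k)
              (w * (starRingEnd ℂ) w / 4)) := by
      filter_upwards [isOpen_ne.mem_nhds hz] with w hw
      rw [ih w hw]
      simp only [Complex.mul_conj, neg_div]
    have h1 : ∀ f g : ℂ → ℂ, f =ᶠ[nhds z] g → dz f z = dz g z := by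
      intro f g h
      simp only [dz, h.fderiv_eq]
    rw [h1 _ _ hev, dz_step n _ z hz _ _ (hasDerivAt_phi n _)]
    have hn : (n.factorial : ℂ) ≠ 0 := by exact_mod_cast n.factorial_ne_zero
    have hn1 : (n : ℂ) + 1 ≠ 0 := by exact_mod_cast n.succ_ne_zero
    have hE : -(Complex.normSq z : ℂ) / 4 = -(z * (starRingEnd ℂ) z / 4) := by
      rw [Complex.mul_conj, neg_div]
    rw [hE, Finset.sum_range_succ _ (n + 1), Nat.factorial_succ]
    push_cast
    generalize Complex.exp (-(z * (starRingEnd ℂ) z / 4)) = e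
    generalize ∑ k ∈ Finset.range (n + 1),
      (1 / (k.factorial : ℂ)) * (z * (starRingEnd ℂ) z / 4) ^ k = S
    generalize (starRingEnd ℂ) z = v
    field_simp
    ring
end

section
/- Let h ∈ S(ℝ²;ℂ). Then the function ξ ↦ (−2i/ξ) F(h)(ξ) (with ξ = ξ₁ + iξ₂) is absolutely integrable on ℝ², and the function u(x,y) = (1/(2π)) ∫_{ℝ²} (−2i/(ξ₁ + iξ₂)) F(h)(ξ₁,ξ₂) e^{i(ξ₁x + ξ₂y)} dξ₁ dξ₂ is infinitely differentiable on ℝ². -/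
open Complex MeasureTheory Filter

/-- The Fourier transform on ℝ² ≅ ℂ, with the symmetric 1/(2π) normalization:
F(f)(ξ) = (1/(2π)) ∫ f(z) e^{−i(ξ₁x + ξ₂y)} dz, where z = x + iy and ξ = ξ₁ + iξ₂. -/
noncomputable def fourierT (f : ℂ → ℂ) (ξ : ℂ) : ℂ :=
  (1 / (2 * Real.pi)) *
    ∫ z : ℂ, f z * Complex.exp (-Complex.I * Complex.ofReal (ξ.re * z.re + ξ.im * z.im))


open FourierTransform in
/-- The Fourier transform is Schwartz. -/
lemma fourierT_schwartz (h : SchwartzMap ℂ ℂ) :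
    ∃ G : SchwartzMap ℂ ℂ, ∀ ξ, fourierT (fun z => h z) ξ = G ξ := by
  have hpi : (2 * Real.pi)⁻¹ ≠ 0 := by positivity
  let e : ℂ ≃L[ℝ] ℂ := ContinuousLinearEquiv.smulLeft (Units.mk0 _ hpi)
  refine ⟨((1 / (2 * Real.pi) : ℂ)) • SchwartzMap.compCLMOfContinuousLinearEquiv ℝ e (𝓕 h), ?_⟩
  intro ξ
  have he : e ξ = (2 * Real.pi)⁻¹ • ξ := rfl
  simp only [_root_.smul_apply, SchwartzMap.compCLMOfContinuousLinearEquiv_apply,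
    Function.comp, he, SchwartzMap.fourier_coe, Real.fourier_eq', fourierT, smul_eq_mul]
  congr 1
  apply integral_congr_ae
  refine Eventually.of_forall fun z => ?_
  simp only
  rw [mul_comm]
  congr 2
  rw [inner_smul_right, Complex.inner]
  have : (Real.pi : ℂ) ≠ 0 := by exact_mod_cast Real.pi_ne_zero
  push_cast
  simp
  field_simp

/-- `1/‖ξ‖` is locally integrable in the plane. -/
lemma inv_norm_integrableOn :
    IntegrableOn (fun ξ : ℂ => ‖ξ‖⁻¹) (Metric.ball 0 1) := by
  have := (integrableOn_fun_norm_addHaar (E := ℂ) volume (f := fun y : ℝ => y⁻¹) (r := 1)).2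
  refine this ?_
  have h1 : IntegrableOn (fun _ : ℝ => (1 : ℝ)) (Set.Ioo 0 1) := by simp
  refine h1.congr_fun ?_ measurableSet_Ioo
  intro y hy
  have : y ≠ 0 := hy.1.ne'
  simp [this]

lemma moments (G : SchwartzMap ℂ ℂ) (n : ℕ) :
    Integrable (fun ξ : ℂ => ‖ξ‖ ^ n * ‖(-2 * Complex.I / ξ) * G ξ‖) := by
  have hm : AEStronglyMeasurable (fun ξ : ℂ => ‖ξ‖ ^ n * ‖(-2 * Complex.I / ξ) * G ξ‖) := by
    have : Measurable G := G.continuous.measurable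
    exact Measurable.aestronglyMeasurable (by fun_prop)
  cases n with
  | succ n =>
    refine ((G.integrable_pow_mul volume n).const_mul 2).mono' hm ?_
    refine Eventually.of_forall fun ξ => ?_
    by_cases hξ : ξ = 0
    · simp [hξ]; positivity
    · have : ‖ξ‖ ≠ 0 := by simpa
      apply le_of_eq
      simp [pow_succ]
      field_simp
  | zero =>
    rw [← integrableOn_univ, ← Set.union_compl_self (Metric.ball (0:ℂ) 1)]
    refine IntegrableOn.union ?_ ?_
    · obtain ⟨C, hC⟩ := G.decay 0 0
      refine (inv_norm_integrableOn.const_mul (2 * C)).mono' hm.restrict ?_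
      refine Eventually.of_forall fun ξ => ?_
      have := hC.2 ξ
      simp at this ⊢
      have h2 : 0 ≤ 2 * ‖ξ‖⁻¹ := by positivity
      calc 2 / ‖ξ‖ * ‖G ξ‖ = 2 * ‖ξ‖⁻¹ * ‖G ξ‖ := by ring
        _ ≤ 2 * ‖ξ‖⁻¹ * C := by gcongr
        _ = _ := by ring
    · refine ((G.integrable (μ := volume)).norm.const_mul 2).integrableOn.mono' hm.restrict ?_
      refine (ae_restrict_iff' Metric.isOpen_ball.measurableSet.compl).2 ?_
      refine Eventually.of_forall fun ξ hξ => ?_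
      have h1 : 1 ≤ ‖ξ‖ := by simpa using hξ
      simp
      gcongr
      exact div_le_self (by norm_num) h1

open FourierTransform in
/-- For h Schwartz, ξ ↦ (−2i/ξ) F(h)(ξ) is absolutely integrable on ℝ², and
u(z) = (1/(2π)) ∫ (−2i/ξ) F(h)(ξ) e^{i(ξ₁x + ξ₂y)} dξ is infinitely differentiable. -/
theorem stmt7 (h : SchwartzMap ℂ ℂ) :
    Integrable (fun ξ : ℂ => (-2 * Complex.I / ξ) * fourierT (fun z => h z) ξ) ∧
    ContDiff ℝ (⊤ : ℕ∞) (fun z : ℂ =>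
      (1 / (2 * Real.pi)) *
        ∫ ξ : ℂ, (-2 * Complex.I / ξ) * fourierT (fun w => h w) ξ *
          Complex.exp (Complex.I * Complex.ofReal (ξ.re * z.re + ξ.im * z.im))) := by
  obtain ⟨G, hG⟩ := fourierT_schwartz h
  simp only [hG]
  constructor
  · have hm : AEStronglyMeasurable (fun ξ : ℂ => (-2 * Complex.I / ξ) * G ξ) := by
      have : Measurable G := G.continuous.measurable
      exact Measurable.aestronglyMeasurable (by fun_prop)
    rw [← integrable_norm_iff hm]
    simpa using moments G 0
  · have hc := Real.contDiff_fourier (N := ⊤) (f := fun ξ : ℂ => (-2 * Complex.I / ξ) * G ξ)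
      (fun n _ => moments G n)
    refine contDiff_const.mul ?_
    have hc2 : ContDiff ℝ (⊤ : ℕ∞) (fun z : ℂ =>
        𝓕 (fun ξ : ℂ => (-2 * Complex.I / ξ) * G ξ) ((-(2 * Real.pi)⁻¹) • z)) :=
      hc.comp (contDiff_const_smul _)
    refine (congrArg (ContDiff ℝ (⊤ : ℕ∞)) (funext fun z => ?_)).mp hc2
    rw [Real.fourier_eq']
    apply integral_congr_ae
    refine Eventually.of_forall fun ξ => ?_
    simp only [smul_eq_mul]
    rw [mul_comm]
    congr 2
    rw [inner_smul_right, Complex.inner]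
    have : (Real.pi : ℂ) ≠ 0 := by exact_mod_cast Real.pi_ne_zero
    push_cast
    simp
    field_simp
end

section
/- Let h ∈ S(ℝ²;ℂ). Then for every (x,y) ∈ ℝ², with z = x + iy, the integral (1/π) ∫_{ℝ²} h(x′,y′)/(z − z′) dx′ dy′ (z′ = x′ + iy′) converges absolutely, and it equals the inverse Fourier transform representation of ∂̄⁻¹h: (1/(2π)) ∫_{ℝ²} (−2i/(ξ₁ + iξ₂)) F(h)(ξ₁,ξ₂) e^{i(ξ₁x + ξ₂y)} dξ₁ dξ₂ = (1/π) ∫_{ℝ²} h(x′,y′)/(z − z′) dx′ dy′. -/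
open Complex MeasureTheory Filter

lemma aux_sub (h : SchwartzMap ℂ ℂ) (z : ℂ) : Integrable (fun u : ℂ => h (z - u)) :=
  (h.integrable (μ := volume)).comp_sub_left z

lemma aux_int (h : SchwartzMap ℂ ℂ) (z : ℂ) : Integrable (fun u : ℂ => h (z - u) / u) := by
  obtain ⟨C, hC⟩ : ∃ C, ∀ x, ‖h x‖ ≤ C := by
    obtain ⟨C, hC⟩ := h.decay 0 0
    exact ⟨C, fun x => by simpa using hC.2 x⟩
  have h1 : Integrable (fun u : ℂ => (Set.indicator (Set.Iic (1:ℝ)) (fun y => y⁻¹) ‖u‖)) := by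
    rw [integrable_fun_norm_addHaar (volume : Measure ℂ)
      (f := Set.indicator (Set.Iic (1:ℝ)) (fun y => y⁻¹))]
    have : IntegrableOn (Set.indicator (Set.Iic (1:ℝ)) (fun _ => (1:ℝ))) (Set.Ioi 0) := by
      rw [IntegrableOn, integrable_indicator_iff measurableSet_Iic, IntegrableOn,
        Measure.restrict_restrict measurableSet_Iic]
      refine integrableOn_const (by rw [Set.inter_comm, Set.Ioi_inter_Iic]; simp)
    refine this.congr_fun ?_ measurableSet_Ioi
    intro y hy
    have hy : y ≠ 0 := (ne_of_gt hy)
    by_cases hy1 : y ≤ 1 <;> simp [hy1, hy]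
  refine ((h1.const_mul C).add (aux_sub h z).norm).mono' ?_ ?_
  · exact ((h.continuous.comp (continuous_const.sub continuous_id)).measurable.div
      measurable_id).aestronglyMeasurable
  · refine Eventually.of_forall fun u => ?_
    have hC0 : 0 ≤ C := (norm_nonneg _).trans (hC 0)
    simp only [norm_div, Pi.add_apply]
    by_cases hu : ‖u‖ ≤ 1
    · simp only [Set.indicator, Set.mem_Iic, hu, if_true]
      rw [div_eq_mul_inv]
      have := mul_le_mul_of_nonneg_right (hC (z-u)) (inv_nonneg.2 (norm_nonneg u))
      have := norm_nonneg (h (z-u))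
      linarith
    · simp only [Set.indicator, Set.mem_Iic, hu, if_false, mul_zero, zero_add]
      exact div_le_self (norm_nonneg _) (not_le.1 hu).le

lemma aux_fubini (g : ℂ → ℂ) (hg : Measurable g) (hgi : Integrable (fun ξ => g ξ / ξ))
    (φ : ℝ → ℝ → ℝ) (hφm : Measurable (Function.uncurry φ)) (hφ0 : ∀ t r, 0 ≤ φ t r)
    (hφi : ∀ r > 0, IntegrableOn (fun t => φ t r) (Set.Ioi 0))
    (hφ : ∀ r > 0, ∫ t in Set.Ioi (0:ℝ), φ t r = (r^2)⁻¹) :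
    ∫ ξ, g ξ / ξ = ∫ t in Set.Ioi (0:ℝ), ∫ ξ : ℂ, g ξ * (starRingEnd ℂ ξ * (φ t ‖ξ‖ : ℂ)) := by
  have key : Integrable (Function.uncurry fun (t : ℝ) (ξ : ℂ) =>
      g ξ * (starRingEnd ℂ ξ * (φ t ‖ξ‖ : ℂ))) ((volume.restrict (Set.Ioi 0)).prod volume) := by
    have hm : Measurable (Function.uncurry fun (t : ℝ) (ξ : ℂ) =>
      g ξ * (starRingEnd ℂ ξ * (φ t ‖ξ‖ : ℂ))) := by
      refine (hg.comp measurable_snd).mul (Measurable.mul ?_ ?_)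
      · exact (Complex.continuous_conj.measurable.comp measurable_snd)
      · exact Complex.measurable_ofReal.comp
          (hφm.comp (measurable_fst.prodMk (measurable_snd.norm)))
    rw [integrable_prod_iff' hm.aestronglyMeasurable]
    have hne : ∀ᵐ ξ : ℂ, ξ ≠ 0 := by simp [ae_iff]
    constructor
    · filter_upwards [hne] with ξ hξ
      have h1 : Integrable (fun t => g ξ * (starRingEnd ℂ ξ * (φ t ‖ξ‖ : ℂ)))
          (volume.restrict (Set.Ioi 0)) :=
        (((hφi ‖ξ‖ (norm_pos_iff.2 hξ)).ofReal (𝕜 := ℂ)).const_mul _).const_mul _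
      exact h1
    · refine hgi.norm.congr ?_
      filter_upwards [hne] with ξ hξ
      have hp := norm_pos_iff.2 hξ
      simp only [Function.uncurry_apply_pair, norm_mul, RCLike.norm_conj, norm_div,
        Complex.norm_real, Real.norm_of_nonneg (hφ0 _ _)]
      rw [integral_const_mul, integral_const_mul, hφ _ hp]
      field_simp
  rw [integral_integral_swap key]
  refine integral_congr_ae ?_
  have hne : ∀ᵐ ξ : ℂ, ξ ≠ 0 := by simp [ae_iff]
  filter_upwards [hne] with ξ hξ
  have hp := norm_pos_iff.2 hξ
  rw [integral_const_mul, integral_const_mul, integral_complex_ofReal, hφ _ hp]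
  have h2 : ((‖ξ‖ ^ 2 : ℝ) : ℂ) = ξ * starRingEnd ℂ ξ := by
    rw [Complex.mul_conj, Complex.normSq_eq_norm_sq]
  have h3 : starRingEnd ℂ ξ ≠ 0 := by simpa using hξ
  push_cast at h2 ⊢
  rw [h2]
  field_simp

lemma aux_phi1 (r : ℝ) (hr : 0 < r) : IntegrableOn (fun t => Real.exp (-t * r^2)) (Set.Ioi 0) ∧
    ∫ t in Set.Ioi (0:ℝ), Real.exp (-t * r^2) = (r^2)⁻¹ := by
  have e : (fun t => Real.exp (-t * r^2)) = fun t => Real.exp (-(r^2) * t) := by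
    ext t; ring_nf
  rw [e]
  have h2 : -(r^2) < 0 := by nlinarith
  refine ⟨integrableOn_exp_mul_Ioi h2 0, ?_⟩
  rw [integral_exp_mul_Ioi h2 0]
  simp [neg_div, div_neg]

lemma aux_phi2 (r : ℝ) (hr : 0 < r) :
    IntegrableOn (fun t => (4 * t^2)⁻¹ * Real.exp (- r^2 / (4*t))) (Set.Ioi 0) ∧
    ∫ t in Set.Ioi (0:ℝ), (4 * t^2)⁻¹ * Real.exp (- r^2 / (4*t)) = (r^2)⁻¹ := by
  set g : ℝ → ℝ := fun t => (r^2)⁻¹ * expNegInvGlue (4 * t / r^2) with hgdef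
  have hgc : Continuous g := by
    have := (expNegInvGlue.contDiff (n := 0)).continuous
    fun_prop
  have hev : ∀ t > 0, g t = (r^2)⁻¹ * Real.exp (- r^2 / (4*t)) := by
    intro t ht
    have : ¬ (4 * t / r^2 ≤ 0) := not_le.2 (by positivity)
    simp only [hgdef, expNegInvGlue, this, if_false]
    congr 2
    field_simp
  have hd : ∀ t ∈ Set.Ioi (0:ℝ), HasDerivAt g ((4 * t^2)⁻¹ * Real.exp (- r^2 / (4*t))) t := by
    intro t ht
    have ht : 0 < t := ht
    have hE : g =ᶠ[nhds t] fun t => (r^2)⁻¹ * Real.exp (- r^2 / (4*t)) := by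
      filter_upwards [lt_mem_nhds ht] with s hs using hev s hs
    refine HasDerivAt.congr_of_eventuallyEq ?_ hE
    have h1 : HasDerivAt (fun t : ℝ => - r^2 / (4*t)) (r^2 / (4 * t^2)) t := by
      have h0 : HasDerivAt (fun t : ℝ => 4 * t) 4 t := by
        simpa using (hasDerivAt_id t).const_mul 4
      have := (hasDerivAt_const t (-r^2)).fun_div h0 (by positivity)
      refine this.congr_deriv ?_
      field_simp
      ring
    refine ((h1.exp).const_mul (r^2)⁻¹).congr_deriv ?_
    field_simp
  have hl : Tendsto g atTop (nhds ((r^2)⁻¹)) := by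
    have : Tendsto (fun t : ℝ => (r^2)⁻¹ * Real.exp (- r^2 / (4*t))) atTop
        (nhds ((r^2)⁻¹ * Real.exp 0)) := by
      refine Tendsto.const_mul _ (Real.continuous_exp.continuousAt.tendsto.comp ?_)
      exact tendsto_const_nhds.div_atTop (tendsto_id.const_mul_atTop (by norm_num))
    rw [Real.exp_zero, mul_one] at this
    refine this.congr' ?_
    filter_upwards [eventually_gt_atTop 0] with s hs using (hev s hs).symm
  have hp : ∀ t ∈ Set.Ioi (0:ℝ), 0 ≤ (4 * t^2)⁻¹ * Real.exp (- r^2 / (4*t)) := by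
    intro t _; positivity
  refine ⟨integrableOn_Ioi_deriv_of_nonneg hgc.continuousWithinAt hd hp hl, ?_⟩
  rw [integral_Ioi_of_hasDerivAt_of_nonneg hgc.continuousWithinAt hd hp hl]
  simp [hgdef, expNegInvGlue]

lemma aux_g0 (t : ℝ) (ht : 0 < t) (a : ℝ) :
    Integrable (fun x : ℝ => cexp (I * a * x) * cexp (-t * x^2)) := by
  have := integrable_cexp_quadratic (b := (t:ℂ)) (by simpa using ht) (I * a) 0
  refine this.congr (Eventually.of_forall fun x => ?_)
  simp only [← Complex.exp_add]; ring_nf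

lemma aux_g1 (t : ℝ) (ht : 0 < t) (a : ℝ) :
    Integrable (fun x : ℝ => (x:ℂ) * (cexp (I * a * x) * cexp (-t * x^2))) := by
  have := integrable_mul_cexp_neg_mul_sq (b := (t:ℂ)) (by simpa using ht)
  refine this.norm.mono' (by fun_prop) (Eventually.of_forall fun x => ?_)
  have : ‖cexp (I * a * x)‖ = 1 := by
    rw [show I * a * x = ((a * x : ℝ) : ℂ) * I by push_cast; ring, Complex.norm_exp_ofReal_mul_I]
  simp [this]

lemma aux_g1i (t : ℝ) (ht : 0 < t) (a : ℝ) :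
    ∫ x : ℝ, (x:ℂ) * (cexp (I * a * x) * cexp (-t * x^2)) =
    (I * a / (2 * t)) * ∫ x : ℝ, cexp (I * a * x) * cexp (-t * x^2) := by
  have hd : ∀ x : ℝ, HasDerivAt (fun x : ℝ => cexp (I * a * x) * cexp (-t * x^2))
      ((I * a) * (cexp (I * a * x) * cexp (-t * x^2)) -
        (2 * t) * ((x:ℂ) * (cexp (I * a * x) * cexp (-t * x^2)))) x := by
    intro x
    have h1 : HasDerivAt (fun x : ℂ => cexp (I * a * x) * cexp (-t * x^2))
      ((I * a) * (cexp (I * a * x) * cexp (-t * x^2)) -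
        (2 * t) * ((x:ℂ) * (cexp (I * a * x) * cexp (-t * x^2)))) (x:ℂ) := by
      have h2 := ((hasDerivAt_id (x:ℂ)).const_mul (I * a)).cexp
      have h3 := ((hasDerivAt_pow 2 (x:ℂ)).const_mul (-t:ℂ)).cexp
      refine (h2.mul h3).congr_deriv ?_
      simp only [id]
      push_cast
      ring
    exact h1.comp_ofReal
  have hi0 := (aux_g0 t ht a).const_mul (I * a)
  have hi1 := (aux_g1 t ht a).const_mul (2 * t : ℂ)
  have := integral_eq_zero_of_hasDerivAt_of_integrable hd (hi0.sub hi1) (aux_g0 t ht a)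
  rw [integral_sub hi0 hi1, integral_const_mul, integral_const_mul] at this
  have ht' : (t:ℂ) ≠ 0 := by exact_mod_cast ht.ne'
  generalize (∫ x : ℝ, (x:ℂ) * (cexp (I * a * x) * cexp (-t * x^2))) = A at this ⊢
  generalize (∫ x : ℝ, cexp (I * a * x) * cexp (-t * x^2)) = B at this ⊢
  field_simp
  linear_combination -this

/-- the integrand as product -/
lemma aux_K_prod (t : ℝ) (u : ℂ) (p : ℝ × ℝ) :
    starRingEnd ℂ (measurableEquivRealProd.symm p) *
      (Real.exp (-t * ‖measurableEquivRealProd.symm p‖^2) : ℂ) *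
      cexp (I * ((measurableEquivRealProd.symm p).re * u.re +
        (measurableEquivRealProd.symm p).im * u.im : ℝ)) =
    ((p.1:ℂ) * (cexp (I * u.re * p.1) * cexp (-t * p.1^2))) *
        (cexp (I * u.im * p.2) * cexp (-t * p.2^2)) -
    I * ((cexp (I * u.re * p.1) * cexp (-t * p.1^2)) *
        ((p.2:ℂ) * (cexp (I * u.im * p.2) * cexp (-t * p.2^2)))) := by
  have h1 : ‖measurableEquivRealProd.symm p‖^2 = p.1^2 + p.2^2 := by
    rw [← Complex.normSq_eq_norm_sq, Complex.normSq_apply]; simp; ring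
  have h2 : starRingEnd ℂ (measurableEquivRealProd.symm p) = p.1 - I * p.2 := by
    apply Complex.ext <;> simp
  rw [h1, h2]
  have h3 : (Real.exp (-t * (p.1^2+p.2^2)) : ℂ) = cexp (-t * p.1^2) * cexp (-t * p.2^2) := by
    rw [← Complex.exp_add]; push_cast; ring_nf
  have h4 : cexp (I * ((measurableEquivRealProd.symm p).re * u.re +
        (measurableEquivRealProd.symm p).im * u.im : ℝ)) =
      cexp (I * u.re * p.1) * cexp (I * u.im * p.2) := by
    rw [← Complex.exp_add]; simp; ring_nf
  rw [h3, h4]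
  ring

lemma aux_K (t : ℝ) (ht : 0 < t) (u : ℂ) :
    Integrable (fun ξ : ℂ => starRingEnd ℂ ξ * (Real.exp (-t * ‖ξ‖^2) : ℂ) *
      cexp (I * (ξ.re * u.re + ξ.im * u.im : ℝ))) ∧
    ∫ ξ : ℂ, starRingEnd ℂ ξ * (Real.exp (-t * ‖ξ‖^2) : ℂ) *
      cexp (I * (ξ.re * u.re + ξ.im * u.im : ℝ)) =
    2 * Real.pi * I * (starRingEnd ℂ u * ((4 * t^2)⁻¹ * Real.exp (- ‖u‖^2 / (4*t)) : ℝ)) := by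
  have i1 := (aux_g1 t ht u.re).mul_prod (aux_g0 t ht u.im)
  have i2 := ((aux_g0 t ht u.re).mul_prod (aux_g1 t ht u.im)).const_mul I
  have mp := Complex.volume_preserving_equiv_real_prod.symm
  have me := measurableEquivRealProd.symm.measurableEmbedding
  constructor
  · rw [← mp.integrable_comp_emb me]
    refine (i1.sub i2).congr (Eventually.of_forall fun p => ?_)
    exact (aux_K_prod t u p).symm
  · rw [← mp.integral_comp me]
    simp_rw [aux_K_prod t u]
    rw [Measure.volume_eq_prod, integral_sub i1 i2, integral_const_mul,
      integral_prod_mul (fun x : ℝ => (x:ℂ) * (cexp (I * u.re * x) * cexp (-t * x^2)))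
        (fun y : ℝ => cexp (I * u.im * y) * cexp (-t * y^2)),
      integral_prod_mul (fun x : ℝ => (cexp (I * u.re * x) * cexp (-t * x^2)))
        (fun y : ℝ => (y:ℂ) * (cexp (I * u.im * y) * cexp (-t * y^2))),
      aux_g1i t ht, aux_g1i t ht, fourierIntegral_gaussian (by simpa using ht),
      fourierIntegral_gaussian (by simpa using ht)]
    have ht' : (t:ℂ) ≠ 0 := by exact_mod_cast ht.ne'
    have hpi : (Real.pi:ℂ) ≠ 0 := by exact_mod_cast Real.pi_ne_zero
    have hs : ((Real.pi / t : ℂ) ^ (1/2:ℂ)) * ((Real.pi / t : ℂ) ^ (1/2:ℂ)) = Real.pi / t := by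
      rw [← Complex.cpow_add _ _ (div_ne_zero hpi ht')]; norm_num
    have he : (Real.exp (- ‖u‖^2 / (4*t)) : ℂ) =
        cexp (-(u.re:ℂ)^2/(4*t)) * cexp (-(u.im:ℂ)^2/(4*t)) := by
      rw [← Complex.exp_add, ← Complex.normSq_eq_norm_sq, Complex.normSq_apply]
      push_cast; ring_nf
    have hc : starRingEnd ℂ u = u.re - I * u.im := by apply Complex.ext <;> simp
    rw [Complex.ofReal_mul, he, hc]
    push_cast
    have h5 : ∀ s A B : ℂ, s * s = Real.pi / t →
      I * u.re / (2*t) * (s * A) * (s * B) - I * (s * A * (I * u.im / (2*t) * (s * B))) =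
       2 * Real.pi * I * ((u.re - I * u.im) * ((4 * (t:ℂ)^2)⁻¹ * (A * B))) := by
      intro s A B hs
      have : I * u.re / (2*t) * (s * A) * (s * B) - I * (s * A * (I * u.im / (2*t) * (s * B))) =
        (s * s) * (I * u.re / (2*t) * A * B - I * (A * (I * u.im / (2*t) * B))) := by ring
      rw [this, hs]
      field_simp
      ring
    exact h5 _ _ _ hs

lemma aux_F (h : SchwartzMap ℂ ℂ) : ∃ g : SchwartzMap ℂ ℂ,
    ∀ ξ, fourierT (fun w => h w) ξ = (1 / (2 * Real.pi)) * g ((2 * Real.pi : ℝ)⁻¹ • ξ) := by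
  refine ⟨FourierTransform.fourier h, fun ξ => ?_⟩
  rw [SchwartzMap.fourier_coe, Real.fourier_eq', fourierT]
  congr 1
  refine integral_congr_ae (Eventually.of_forall fun w => ?_)
  simp only [smul_eq_mul]
  rw [mul_comm]
  congr 2
  simp only [inner_smul_right, Complex.inner]
  have hpi : (Real.pi:ℂ) ≠ 0 := by exact_mod_cast Real.pi_ne_zero
  simp
  field_simp

lemma aux_mid (h : SchwartzMap ℂ ℂ) (z : ℂ) (t : ℝ) (ht : 0 < t) :
    ∫ ξ : ℂ, (fourierT (fun w => h w) ξ *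
          Complex.exp (Complex.I * Complex.ofReal (ξ.re * z.re + ξ.im * z.im))) *
        (starRingEnd ℂ ξ * (Real.exp (-t * ‖ξ‖^2) : ℂ)) =
    I * ∫ u : ℂ, h (z - u) *
      (starRingEnd ℂ u * ((4 * t^2)⁻¹ * Real.exp (- ‖u‖^2 / (4*t)) : ℝ)) := by
  have hpi : (Real.pi:ℂ) ≠ 0 := by exact_mod_cast Real.pi_ne_zero
  have hmul : Integrable (fun p : ℂ × ℂ => (starRingEnd ℂ p.1 * (Real.exp (-t * ‖p.1‖^2) : ℂ)
      * cexp (I * (p.1.re * z.re + p.1.im * z.im : ℝ))) * h p.2) (volume.prod volume) :=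
    (aux_K t ht z).1.mul_prod (h.integrable (μ := volume))
  have key : Integrable (Function.uncurry fun (ξ w : ℂ) => (starRingEnd ℂ ξ *
      (Real.exp (-t * ‖ξ‖^2) : ℂ) * cexp (I * (ξ.re * z.re + ξ.im * z.im : ℝ))) * h w *
      cexp (-I * (ξ.re * w.re + ξ.im * w.im : ℝ))) (volume.prod volume) := by
    refine hmul.mul_bdd (c := 1) ?_ ?_
    · have : Continuous fun p : ℂ × ℂ =>
        cexp (-I * (p.1.re * p.2.re + p.1.im * p.2.im : ℝ)) := by fun_prop
      exact this.aestronglyMeasurable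
    · refine Eventually.of_forall fun p => ?_
      rw [Complex.norm_exp]; simp
  have e1 : ∀ ξ : ℂ, (fourierT (fun w => h w) ξ *
          Complex.exp (Complex.I * Complex.ofReal (ξ.re * z.re + ξ.im * z.im))) *
        (starRingEnd ℂ ξ * (Real.exp (-t * ‖ξ‖^2) : ℂ)) = (1 / (2 * Real.pi)) *
      ∫ w : ℂ, (starRingEnd ℂ ξ *
      (Real.exp (-t * ‖ξ‖^2) : ℂ) * cexp (I * (ξ.re * z.re + ξ.im * z.im : ℝ))) * h w *
      cexp (-I * (ξ.re * w.re + ξ.im * w.im : ℝ)) := by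
    intro ξ
    simp_rw [mul_assoc _ (h _) _]
    rw [integral_const_mul, fourierT]
    ring
  simp_rw [e1]
  rw [integral_const_mul, integral_integral_swap key]
  have e2 : ∀ w : ℂ, ∫ ξ : ℂ, (starRingEnd ℂ ξ *
      (Real.exp (-t * ‖ξ‖^2) : ℂ) * cexp (I * (ξ.re * z.re + ξ.im * z.im : ℝ))) * h w *
      cexp (-I * (ξ.re * w.re + ξ.im * w.im : ℝ)) =
      2 * Real.pi * I * (h w * (starRingEnd ℂ (z - w) *
        ((4 * t^2)⁻¹ * Real.exp (- ‖z - w‖^2 / (4*t)) : ℝ))) := by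
    intro w
    have e3 : ∀ ξ : ℂ, (starRingEnd ℂ ξ *
      (Real.exp (-t * ‖ξ‖^2) : ℂ) * cexp (I * (ξ.re * z.re + ξ.im * z.im : ℝ))) * h w *
      cexp (-I * (ξ.re * w.re + ξ.im * w.im : ℝ)) = h w * (starRingEnd ℂ ξ *
      (Real.exp (-t * ‖ξ‖^2) : ℂ) * cexp (I * (ξ.re * (z-w).re + ξ.im * (z-w).im : ℝ))) := by
      intro ξ
      have : cexp (I * (ξ.re * (z-w).re + ξ.im * (z-w).im : ℝ)) =
        cexp (I * (ξ.re * z.re + ξ.im * z.im : ℝ)) *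
          cexp (-I * (ξ.re * w.re + ξ.im * w.im : ℝ)) := by
        rw [← Complex.exp_add]; push_cast [Complex.sub_re, Complex.sub_im]; ring_nf
      rw [this]; ring
    simp_rw [e3]
    rw [integral_const_mul, (aux_K t ht (z-w)).2]
    ring
  simp_rw [e2]
  rw [integral_const_mul, ← integral_sub_left_eq_self _ volume z]
  simp_rw [sub_sub_cancel]
  field_simp

theorem stmt9 (h : SchwartzMap ℂ ℂ) (z : ℂ) :
    Integrable (fun w : ℂ => h w / (z - w)) ∧
    (1 / (2 * Real.pi)) *
        (∫ ξ : ℂ, (-2 * Complex.I / ξ) * fourierT (fun w => h w) ξ *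
          Complex.exp (Complex.I * Complex.ofReal (ξ.re * z.re + ξ.im * z.im))) =
      (1 / (Real.pi : ℂ)) * ∫ w : ℂ, h w / (z - w) := by
  have hint := aux_int h z
  constructor
  · have := hint.comp_sub_left z
    simpa only [sub_sub_cancel] using this
  have hpi : (Real.pi:ℂ) ≠ 0 := by exact_mod_cast Real.pi_ne_zero
  obtain ⟨g, hg⟩ := aux_F h
  have hFc : Continuous (fun ξ => fourierT (fun w => h w) ξ) := by
    simp_rw [hg]
    have := g.continuous
    fun_prop
  set G : ℂ → ℂ := fun ξ => fourierT (fun w => h w) ξ *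
          Complex.exp (Complex.I * Complex.ofReal (ξ.re * z.re + ξ.im * z.im)) with hG
  have hGc : Continuous G := by fun_prop
  have hFi : Integrable (fun ξ => fourierT (fun w => h w) ξ / ξ) := by
    have h1 := (aux_int g 0).comp_sub_left 0
    have h2 := (h1.comp_smul (R := (2 * Real.pi : ℝ)⁻¹)
      (inv_ne_zero (by positivity))).const_mul (-(1 / (2 * Real.pi) / (2 * Real.pi)) : ℂ)
    refine h2.congr (Eventually.of_forall fun ξ => ?_)
    simp only [hg, zero_sub, neg_neg]
    rw [Complex.real_smul]
    push_cast
    by_cases hξ : ξ = 0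
    · simp [hξ]
    field_simp
  have hGi : Integrable (fun ξ => G ξ / ξ) := by
    refine hFi.norm.mono' (hGc.measurable.div measurable_id).aestronglyMeasurable
      (Eventually.of_forall fun ξ => ?_)
    have : ‖Complex.exp (Complex.I * Complex.ofReal (ξ.re * z.re + ξ.im * z.im))‖ = 1 := by
      rw [Complex.norm_exp]; simp
    simp only [hG, norm_div, norm_mul, this, mul_one, le_refl]
  have s1 := aux_fubini G hGc.measurable hGi (fun t r => Real.exp (-t * r^2))
    (by fun_prop) (fun t r => by positivity)
    (fun r hr => (aux_phi1 r hr).1) (fun r hr => (aux_phi1 r hr).2)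
  have s2 := aux_fubini (fun u => h (z - u)) (by have := h.continuous; fun_prop) hint
    (fun t r => (4 * t^2)⁻¹ * Real.exp (- r^2 / (4*t)))
    (by unfold Function.uncurry; fun_prop) (fun t r => by positivity)
    (fun r hr => (aux_phi2 r hr).1) (fun r hr => (aux_phi2 r hr).2)
  have s3 : ∫ ξ, G ξ / ξ = I * ∫ u, h (z - u) / u := by
    rw [s1, s2, ← integral_const_mul]
    refine setIntegral_congr_fun measurableSet_Ioi fun t ht => ?_
    exact aux_mid h z t ht
  have e1 : (∫ ξ : ℂ, (-2 * Complex.I / ξ) * fourierT (fun w => h w) ξ *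
          Complex.exp (Complex.I * Complex.ofReal (ξ.re * z.re + ξ.im * z.im))) =
      (-2 * I) * ∫ ξ, G ξ / ξ := by
    rw [← integral_const_mul]
    refine integral_congr_ae (Eventually.of_forall fun ξ => ?_)
    simp only [hG]; ring
  have e2 : ∫ w : ℂ, h w / (z - w) = ∫ u, h (z - u) / u := by
    rw [← integral_sub_left_eq_self _ volume z]
    simp_rw [sub_sub_cancel]
  rw [e1, s3, e2]
  field_simp
  linear_combination (-∫ u, h (z - u) / u) * Complex.I_sq
end
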